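/- Let (M, φ_M) = (N, φ_N) * (P, φ_P) be a free product of von Neumann algebras endowed with faithful normal states, with E : M → N the unique conditional expectation satisfying φ_N ∘ E = φ_M. Assume that the centralizer N_{φ_N} is a factor. Then the triple (M, N, φ_M) is intertwining stable. -/

import Mathlib

/-!
Common framework for formalizing Houdayer–Isono,
"Pointwise inner automorphisms of almost periodic factors".

Von Neumann algebras are modeled concretely, following Mathlib, as
`VonNeumannAlgebra H` for a complex Hilbert space `H`.  Notions that are not
available in Mathlib (normal states and weights, modular automorphism groups,
Connes cocycles, tensor/free product decompositions, …) are modeled by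
explicit predicates/structures whose fields record their standard
characterizing properties (e.g. the modular group of a state is characterized
as the pointwise SOT-continuous one-parameter automorphism group satisfying
the KMS condition).
-/

open scoped ComplexOrder ENNReal

namespace HSC

variable {H : Type} [NormedAddCommGroup H] [InnerProductSpace ℂ H] [CompleteSpace H]

/-- The bounded operators on the Hilbert space `H`. -/
abbrev Op (H : Type) [NormedAddCommGroup H] [InnerProductSpace ℂ H] [CompleteSpace H] : Type :=
  H →L[ℂ] H

/-- Positivity of a bounded operator on a Hilbert space. -/
def IsPos (x : Op H) : Prop := ContinuousLinearMap.IsPositive x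

/-- `p` is an (orthogonal) projection belonging to the set `A` of operators. -/
def IsProjIn (A : Set (Op H)) (p : Op H) : Prop := p ∈ A ∧ star p = p ∧ p * p = p

/-- `u` is a unitary belonging to the set `A` of operators. -/
def IsUnitaryIn (A : Set (Op H)) (u : Op H) : Prop := u ∈ A ∧ star u * u = 1 ∧ u * star u = 1

/-- `v` is a partial isometry. -/
def IsPartialIsom (v : Op H) : Prop := star v * v * (star v * v) = star v * v

/-- `φ` is a positive linear functional on `M` (recorded as a function on all of `B(H)`;
only its values on `M` matter). -/
structure IsPLF (M : VonNeumannAlgebra H) (φ : Op H → ℂ) : Prop where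
  map_add : ∀ x ∈ M, ∀ y ∈ M, φ (x + y) = φ x + φ y
  map_smul : ∀ (c : ℂ), ∀ x ∈ M, φ (c • x) = c * φ x
  pos : ∀ x ∈ M, 0 ≤ φ (star x * x)

/-- `φ` is a *normal* positive linear functional on `M`: a positive linear functional which is
completely additive on orthogonal families of projections (sums taken in the strong topology). -/
structure IsNormalPLF (M : VonNeumannAlgebra H) (φ : Op H → ℂ) extends IsPLF M φ : Prop where
  normal : ∀ (ι : Type) (p : ι → Op H) (q : Op H),
    (∀ i, IsProjIn (M : Set (Op H)) (p i)) → IsProjIn (M : Set (Op H)) q →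
    (Pairwise fun i j => p i * p j = 0) →
    (∀ ξ : H, HasSum (fun i => p i ξ) (q ξ)) →
    HasSum (fun i => φ (p i)) (φ q)

/-- `φ` is a normal state on `M`. -/
def IsNormalState (M : VonNeumannAlgebra H) (φ : Op H → ℂ) : Prop :=
  IsNormalPLF M φ ∧ φ 1 = 1

/-- Faithfulness of a positive linear functional on `M`. -/
def IsFaithfulOn (M : VonNeumannAlgebra H) (φ : Op H → ℂ) : Prop :=
  ∀ x ∈ M, φ (star x * x) = 0 → x = 0

/-- `φ` is a faithful normal state on `M`. -/
def IsFNState (M : VonNeumannAlgebra H) (φ : Op H → ℂ) : Prop :=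
  IsNormalState M φ ∧ IsFaithfulOn M φ

/-- `p` is the support projection `s(φ)` of `φ` in `M`: the smallest projection of `M`
compressing to which does not change `φ`. -/
def IsSupportProjOf (M : VonNeumannAlgebra H) (φ : Op H → ℂ) (p : Op H) : Prop :=
  IsProjIn (M : Set (Op H)) p ∧ (∀ x ∈ M, φ (p * x * p) = φ x) ∧
    ∀ q, IsProjIn (M : Set (Op H)) q → (∀ x ∈ M, φ (q * x * q) = φ x) → p * q = p

/-- `ψ ∼_M φ` : the normal positive functionals `ψ` and `φ` are intertwined in `M`,
i.e. there are a nonzero partial isometry `v ∈ s(ψ) M s(φ)` and `l > 0` with `ψ v = l v φ`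
(with the bimodule conventions `(ψ v)(x) = ψ(vx)`, `(v φ)(x) = φ(xv)`). -/
def Intertwined (M : VonNeumannAlgebra H) (ψ φ : Op H → ℂ) : Prop :=
  ∃ (v q p : Op H) (l : ℝ), 0 < l ∧ v ∈ M ∧ IsPartialIsom v ∧ v ≠ 0 ∧
    IsSupportProjOf M ψ q ∧ IsSupportProjOf M φ p ∧ q * v = v ∧ v * p = v ∧
    ∀ x ∈ M, ψ (v * x) = (l : ℂ) * φ (x * v)

/-- An automorphism of the von Neumann algebra `M` (automatically normal). -/
structure VNAut (M : VonNeumannAlgebra H) where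
  toFun : Op H → Op H
  invFun : Op H → Op H
  mem' : ∀ x ∈ M, toFun x ∈ M
  inv_mem' : ∀ x ∈ M, invFun x ∈ M
  left_inv' : ∀ x ∈ M, invFun (toFun x) = x
  right_inv' : ∀ x ∈ M, toFun (invFun x) = x
  map_add' : ∀ x ∈ M, ∀ y ∈ M, toFun (x + y) = toFun x + toFun y
  map_smul' : ∀ (c : ℂ), ∀ x ∈ M, toFun (c • x) = c • toFun x
  map_mul' : ∀ x ∈ M, ∀ y ∈ M, toFun (x * y) = toFun x * toFun y
  map_star' : ∀ x ∈ M, toFun (star x) = star (toFun x)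

/-- `Θ` is pointwise inner: for every normal state `ψ` there is a unitary `u ∈ M` with
`Θ(ψ) = u ψ u*`, i.e. `ψ(Θ⁻¹(x)) = ψ(u* x u)` for all `x ∈ M`. -/
def PointwiseInner {M : VonNeumannAlgebra H} (Θ : VNAut M) : Prop :=
  ∀ ψ : Op H → ℂ, IsNormalState M ψ →
    ∃ u, IsUnitaryIn (M : Set (Op H)) u ∧
      ∀ x ∈ M, ψ (Θ.invFun x) = ψ (star u * x * u)

/-- The closed horizontal strip `0 ≤ Im z ≤ 1`. -/
def strip : Set ℂ := {z | 0 ≤ z.im ∧ z.im ≤ 1}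

/-- The open horizontal strip `0 < Im z < 1`. -/
def stripo : Set ℂ := {z | 0 < z.im ∧ z.im < 1}

/-- `σ` is the modular automorphism group `σ^φ` of the (faithful normal) state `φ` on `M`:
a pointwise SOT-continuous one-parameter group of ∗-automorphisms of `M` preserving `φ` and
satisfying the KMS condition at inverse temperature 1. -/
structure IsModularFlow (M : VonNeumannAlgebra H) (φ : Op H → ℂ) (σ : ℝ → Op H → Op H) :
    Prop where
  mem' : ∀ (t : ℝ), ∀ x ∈ M, σ t x ∈ M
  zero' : ∀ x ∈ M, σ 0 x = x
  add' : ∀ (s t : ℝ), ∀ x ∈ M, σ (s + t) x = σ s (σ t x)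
  map_add' : ∀ (t : ℝ), ∀ x ∈ M, ∀ y ∈ M, σ t (x + y) = σ t x + σ t y
  map_smul' : ∀ (t : ℝ) (c : ℂ), ∀ x ∈ M, σ t (c • x) = c • σ t x
  map_mul' : ∀ (t : ℝ), ∀ x ∈ M, ∀ y ∈ M, σ t (x * y) = σ t x * σ t y
  map_star' : ∀ (t : ℝ), ∀ x ∈ M, σ t (star x) = star (σ t x)
  invariant' : ∀ (t : ℝ), ∀ x ∈ M, φ (σ t x) = φ x
  continuous' : ∀ x ∈ M, ∀ ξ : H, Continuous fun t : ℝ => σ t x ξ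
  kms' : ∀ x ∈ M, ∀ y ∈ M, ∃ F : ℂ → ℂ, ContinuousOn F strip ∧
    DifferentiableOn ℂ F stripo ∧ (∃ C : ℝ, ∀ z ∈ strip, ‖F z‖ ≤ C) ∧
    (∀ t : ℝ, F (t : ℂ) = φ (σ t x * y)) ∧
    (∀ t : ℝ, F ((t : ℂ) + Complex.I) = φ (y * σ t x))

/-- `l ^ (i t)` for `l > 0`. -/
noncomputable def cpowit (l t : ℝ) : ℂ := Complex.exp (Complex.I * t * Real.log l)

/-- `x ∈ M` is an `l`-eigenvector of the modular flow `σ`, i.e. `σ_t(x) = l^{it} x`. -/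
def IsEigenvector (M : VonNeumannAlgebra H) (σ : ℝ → Op H → Op H) (l : ℝ) (x : Op H) :
    Prop :=
  x ∈ M ∧ ∀ t : ℝ, σ t x = cpowit l t • x

/-- The point spectrum `σ_p(Δ_φ)` of the modular operator, described via eigenvectors in `M`. -/
def pointSpectrum (M : VonNeumannAlgebra H) (σ : ℝ → Op H → Op H) : Set ℝ :=
  {l | 0 < l ∧ ∃ x, x ≠ 0 ∧ IsEigenvector M σ l x}

/-- The linear span of the eigenvectors of the modular flow. -/
def eigenSpan (M : VonNeumannAlgebra H) (σ : ℝ → Op H → Op H) : Submodule ℂ (Op H) :=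
  Submodule.span ℂ {x | ∃ l : ℝ, 0 < l ∧ IsEigenvector M σ l x}

/-- Almost periodicity of `φ` (via its modular flow `σ`): the linear span of the
eigenvectors is ∗-strongly dense in `M`. -/
def IsAlmostPeriodicFlow (M : VonNeumannAlgebra H) (σ : ℝ → Op H → Op H) : Prop :=
  ∀ x ∈ M, ∀ ε : ℝ, 0 < ε → ∀ Ξ : Finset H, ∃ y ∈ eigenSpan M σ,
    ∀ ξ ∈ Ξ, ‖(x - y) ξ‖ < ε ∧ ‖(star x - star y) ξ‖ < ε

/-- The centralizer `M_φ` of a state `φ` on `M`. -/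
def stateCentralizer (M : VonNeumannAlgebra H) (φ : Op H → ℂ) : Set (Op H) :=
  {x | x ∈ M ∧ ∀ y ∈ M, φ (x * y) = φ (y * x)}

/-- The fixed-point algebra of the flow `σ` on `M` (`= M_φ` for the modular flow of a weight). -/
def flowFixed (M : VonNeumannAlgebra H) (σ : ℝ → Op H → Op H) : Set (Op H) :=
  {x | x ∈ M ∧ ∀ t : ℝ, σ t x = x}

/-- A set of operators (e.g. a von Neumann subalgebra) has trivial center. -/
def IsFactorSet (A : Set (Op H)) : Prop :=
  ∀ x ∈ A, (∀ y ∈ A, x * y = y * x) → ∃ c : ℂ, x = c • (1 : Op H)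

/-- `M` is a factor. -/
def IsFactor (M : VonNeumannAlgebra H) : Prop := IsFactorSet (M : Set (Op H))

/-- Murray–von Neumann equivalence of projections, relative to the set `A`. -/
def MvNEquivIn (A : Set (Op H)) (p q : Op H) : Prop :=
  ∃ v ∈ A, star v * v = p ∧ v * star v = q

/-- `p` is a finite projection relative to `A`: no proper subprojection of `p`
is Murray–von Neumann equivalent (in `A`) to `p`. -/
def IsFiniteProjIn (A : Set (Op H)) (p : Op H) : Prop :=
  ∀ q, IsProjIn A q → q * p = q → MvNEquivIn A p q → q = p

/-- `p` is a minimal projection relative to `A`. -/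
def IsMinimalProjIn (A : Set (Op H)) (p : Op H) : Prop :=
  IsProjIn A p ∧ p ≠ 0 ∧ ∀ q, IsProjIn A q → q * p = q → q = 0 ∨ q = p

/-- `M` is a type III factor: a factor with no nonzero finite projection. -/
def IsTypeIIIFactor (M : VonNeumannAlgebra H) : Prop :=
  IsFactor M ∧
    ∀ p, IsProjIn (M : Set (Op H)) p → p ≠ 0 → ¬ IsFiniteProjIn (M : Set (Op H)) p

/-- The ∗-closed set `A` (e.g. a corner or a subalgebra) is a type II₁ factor:
trivial center, `1` finite, and no minimal projections. -/
def IsTypeII1FactorSet (A : Set (Op H)) : Prop :=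
  IsFactorSet A ∧ (1 : Op H) ∈ A ∧ IsFiniteProjIn A 1 ∧ ∀ p, ¬ IsMinimalProjIn A p

/-- `A` is a type I_∞ factor (model for `B(ℓ²)`): a factor with a minimal projection
whose unit is not finite. -/
def IsTypeIInfFactorSet (A : Set (Op H)) : Prop :=
  IsFactorSet A ∧ (1 : Op H) ∈ A ∧ (∃ p, IsMinimalProjIn A p) ∧ ¬ IsFiniteProjIn A 1

/-- `M` is a type III₁ factor.  By the Connes–Størmer transitivity theorem, among
type III factors with separable predual, type III₁ is characterized by the topological
transitivity of the unitary group action on faithful normal states. -/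
def IsTypeIII1Factor (M : VonNeumannAlgebra H) : Prop :=
  IsTypeIIIFactor M ∧
    ∀ φ ψ : Op H → ℂ, IsFNState M φ → IsFNState M ψ → ∀ ε : ℝ, 0 < ε →
      ∃ u, IsUnitaryIn (M : Set (Op H)) u ∧
        ∀ x ∈ M, ‖x‖ ≤ 1 → ‖φ (star u * x * u) - ψ x‖ < ε

/-- `M` is injective (= amenable, = hyperfinite by Connes' theorem):
there is a norm-one projection `B(H) → M`. -/
def IsInjectiveVNA (M : VonNeumannAlgebra H) : Prop :=
  ∃ E : Op H →ₗ[ℂ] Op H, (∀ x, E x ∈ M) ∧ (∀ x ∈ M, E x = x) ∧ ∀ x, ‖E x‖ ≤ ‖x‖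

/-- `M` is (a copy of) the Araki–Woods factor `R_∞`: the unique amenable (injective)
type III₁ factor with separable predual. -/
def IsArakiWoodsRInfty (M : VonNeumannAlgebra H) : Prop :=
  IsTypeIII1Factor M ∧ IsInjectiveVNA M

/-- Data of a faithful normal semifinite weight: its value `val` on positive elements
(in `[0,∞]`), together with a linear extension `cval` of its restriction to the
definition ideal `m_φ` (the values of `cval` outside `m_φ` are irrelevant). -/
structure WeightData (H : Type) [NormedAddCommGroup H] [InnerProductSpace ℂ H]
    [CompleteSpace H] where
  val : Op H → ℝ≥0∞
  cval : Op H → ℂ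

/-- `W` is a faithful normal semifinite weight on `M`. -/
structure IsFNSWeight (M : VonNeumannAlgebra H) (W : WeightData H) : Prop where
  map_add : ∀ x ∈ M, ∀ y ∈ M, IsPos x → IsPos y → W.val (x + y) = W.val x + W.val y
  map_smul : ∀ c : ℝ, 0 < c → ∀ x ∈ M, IsPos x →
    W.val ((c : ℂ) • x) = ENNReal.ofReal c * W.val x
  faithful : ∀ x ∈ M, IsPos x → W.val x = 0 → x = 0
  semifinite : ∀ x ∈ M, IsPos x → x ≠ 0 →
    ∃ y ∈ M, IsPos y ∧ y ≠ 0 ∧ IsPos (x - y) ∧ W.val y ≠ ⊤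
  normal : ∀ (ι : Type) (p : ι → Op H) (q : Op H),
    (∀ i, IsProjIn (M : Set (Op H)) (p i)) → IsProjIn (M : Set (Op H)) q →
    (Pairwise fun i j => p i * p j = 0) →
    (∀ ξ : H, HasSum (fun i => p i ξ) (q ξ)) →
    W.val q = ∑' i, W.val (p i)
  cval_add : ∀ x ∈ M, ∀ y ∈ M, W.cval (x + y) = W.cval x + W.cval y
  cval_smul : ∀ (c : ℂ), ∀ x ∈ M, W.cval (c • x) = c * W.cval x
  cval_compat : ∀ x ∈ M, IsPos x → W.val x ≠ ⊤ → W.cval x = ((W.val x).toReal : ℂ)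

/-- `σ` is the modular automorphism group `σ^φ` of the faithful normal semifinite
weight `W` on `M` (KMS condition required on the definition ideal). -/
structure IsModularFlowW (M : VonNeumannAlgebra H) (W : WeightData H)
    (σ : ℝ → Op H → Op H) : Prop where
  mem' : ∀ (t : ℝ), ∀ x ∈ M, σ t x ∈ M
  zero' : ∀ x ∈ M, σ 0 x = x
  add' : ∀ (s t : ℝ), ∀ x ∈ M, σ (s + t) x = σ s (σ t x)
  map_add' : ∀ (t : ℝ), ∀ x ∈ M, ∀ y ∈ M, σ t (x + y) = σ t x + σ t y
  map_smul' : ∀ (t : ℝ) (c : ℂ), ∀ x ∈ M, σ t (c • x) = c • σ t x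
  map_mul' : ∀ (t : ℝ), ∀ x ∈ M, ∀ y ∈ M, σ t (x * y) = σ t x * σ t y
  map_star' : ∀ (t : ℝ), ∀ x ∈ M, σ t (star x) = star (σ t x)
  invariant' : ∀ (t : ℝ), ∀ x ∈ M, IsPos x → W.val (σ t x) = W.val x
  continuous' : ∀ x ∈ M, ∀ ξ : H, Continuous fun t : ℝ => σ t x ξ
  kms' : ∀ x ∈ M, ∀ y ∈ M,
    W.val (star x * x) ≠ ⊤ → W.val (x * star x) ≠ ⊤ →
    W.val (star y * y) ≠ ⊤ → W.val (y * star y) ≠ ⊤ →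
    ∃ F : ℂ → ℂ, ContinuousOn F strip ∧ DifferentiableOn ℂ F stripo ∧
      (∃ C : ℝ, ∀ z ∈ strip, ‖F z‖ ≤ C) ∧
      (∀ t : ℝ, F (t : ℂ) = W.cval (σ t x * y)) ∧
      (∀ t : ℝ, F ((t : ℂ) + Complex.I) = W.cval (y * σ t x))

/-- The weight `W` is strictly semifinite: its restriction to the centralizer
(= fixed points of the modular flow `σ`) is semifinite. -/
def IsStrictlySemifiniteOn (M : VonNeumannAlgebra H) (W : WeightData H)
    (σ : ℝ → Op H → Op H) : Prop :=
  ∀ x ∈ flowFixed M σ, IsPos x → x ≠ 0 →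
    ∃ y ∈ flowFixed M σ, IsPos y ∧ y ≠ 0 ∧ IsPos (x - y) ∧ W.val y ≠ ⊤

/-- `h` is a positive element of the corner `pAp`, invertible in this corner. -/
def CornerPosInvertibleIn (A : Set (Op H)) (p h : Op H) : Prop :=
  h ∈ A ∧ IsPos h ∧ p * h = h ∧ h * p = h ∧
    ∃ h' ∈ A, p * h' = h' ∧ h' * p = h' ∧ h * h' = p ∧ h' * h = p

/-- `Θ` is locally pointwise inner for the strictly semifinite weight `W` (with modular flow
`σ`): `Θ(φ) = φ`, and for every nonzero projection `p ∈ M_φ` with `φ(p) < ∞` and every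
positive invertible `h ∈ pM_φp` one has `Θ(φ_h) ∼_M φ_h`, where `φ_h = φ(h^{1/2}·h^{1/2})`
(below `k = h^{1/2}` is the positive square root of `h` in `M_φ`). -/
def LocallyPointwiseInnerW {M : VonNeumannAlgebra H} (W : WeightData H)
    (σ : ℝ → Op H → Op H) (Θ : VNAut M) : Prop :=
  (∀ x ∈ M, IsPos x → W.val (Θ.invFun x) = W.val x) ∧
  ∀ p, IsProjIn (flowFixed M σ) p → p ≠ 0 → W.val p ≠ ⊤ →
  ∀ h, CornerPosInvertibleIn (flowFixed M σ) p h →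
  ∀ k, k ∈ flowFixed M σ → IsPos k → k * k = h →
    Intertwined M (fun x => W.cval (k * Θ.invFun x * k)) (fun x => W.cval (k * x * k))

/-- `Θ` is locally pointwise inner for the faithful normal state `φ` with modular flow `σ`. -/
def LocallyPointwiseInnerS {M : VonNeumannAlgebra H} (φ : Op H → ℂ)
    (σ : ℝ → Op H → Op H) (Θ : VNAut M) : Prop :=
  (∀ x ∈ M, φ (Θ.invFun x) = φ x) ∧
  ∀ p, IsProjIn (flowFixed M σ) p → p ≠ 0 →
  ∀ h, CornerPosInvertibleIn (flowFixed M σ) p h →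
  ∀ k, k ∈ flowFixed M σ → IsPos k → k * k = h →
    Intertwined M (fun x => φ (k * Θ.invFun x * k)) (fun x => φ (k * x * k))

/-- `Θ` is locally pointwise inner for the faithful normal state `φ`, stated with the
algebraically-defined centralizer `M_φ = {x : φ(xy) = φ(yx)}`. -/
def LocallyPointwiseInnerC {M : VonNeumannAlgebra H} (φ : Op H → ℂ) (Θ : VNAut M) : Prop :=
  (∀ x ∈ M, φ (Θ.invFun x) = φ x) ∧
  ∀ p, IsProjIn (stateCentralizer M φ) p → p ≠ 0 →
  ∀ h, CornerPosInvertibleIn (stateCentralizer M φ) p h →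
  ∀ k, k ∈ stateCentralizer M φ → IsPos k → k * k = h →
    Intertwined M (fun x => φ (k * Θ.invFun x * k)) (fun x => φ (k * x * k))

/-- `E : M → N` is a faithful normal conditional expectation. -/
structure IsCondExp (M N : VonNeumannAlgebra H) (E : Op H → Op H) : Prop where
  subset' : (N : Set (Op H)) ⊆ (M : Set (Op H))
  mem' : ∀ x ∈ M, E x ∈ N
  fix' : ∀ x ∈ N, E x = x
  map_add' : ∀ x ∈ M, ∀ y ∈ M, E (x + y) = E x + E y
  map_smul' : ∀ (c : ℂ), ∀ x ∈ M, E (c • x) = c • E x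
  bimod' : ∀ a ∈ N, ∀ x ∈ M, ∀ b ∈ N, E (a * x * b) = a * E x * b
  map_star' : ∀ x ∈ M, E (star x) = star (E x)
  pos' : ∀ x ∈ M, IsPos x → IsPos (E x)
  faithful' : ∀ x ∈ M, IsPos x → E x = 0 → x = 0
  normal' : ∀ ρ : Op H → ℂ, IsNormalState N ρ → IsNormalState M (fun x => ρ (E x))

/-- The triple `(M, N, φ)` (with expectation `E : M → N`, `φ ∘ E = φ`) is
intertwining stable (Definition 4.1 of Houdayer–Isono). -/
def IntertwiningStable (M N : VonNeumannAlgebra H) (E : Op H → Op H)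
    (φ : Op H → ℂ) : Prop :=
  ∀ Θ : VNAut M,
    (∀ x ∈ M, E (Θ.toFun x) = Θ.toFun (E x)) →
    (∀ x ∈ M, φ (Θ.invFun x) = φ x) →
    ∀ ψ : Op H → ℂ, IsNormalPLF N ψ → (∃ x ∈ N, ψ x ≠ 0) →
      Intertwined M (fun x => ψ (E (Θ.invFun x))) (fun x => ψ (E x)) →
      Intertwined N (fun x => ψ (Θ.invFun x)) ψ

/-- `M = N ⊗̄ P`: `N` and `P` are commuting subalgebras of `M` which generate `M`
and admit normal product states (slice maps). -/
structure IsTensorDecomposition (M N P : VonNeumannAlgebra H) : Prop where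
  subN : (N : Set (Op H)) ⊆ (M : Set (Op H))
  subP : (P : Set (Op H)) ⊆ (M : Set (Op H))
  comm : ∀ x ∈ N, ∀ y ∈ P, x * y = y * x
  generates :
    Set.centralizer (Set.centralizer ((N : Set (Op H)) ∪ (P : Set (Op H)))) = (M : Set (Op H))
  slice : ∀ (ρN ρP : Op H → ℂ), IsNormalState N ρN → IsNormalState P ρP →
    ∃ ρ : Op H → ℂ, IsNormalState M ρ ∧ ∀ x ∈ N, ∀ y ∈ P, ρ (x * y) = ρN x * ρP y

/-- `E = id_N ⊗ φ_P : N ⊗̄ P → N` is the slice conditional expectation attached to `φ_P`. -/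
def IsSliceExpectation (M N P : VonNeumannAlgebra H) (φP : Op H → ℂ)
    (E : Op H → Op H) : Prop :=
  IsCondExp M N E ∧ ∀ x ∈ N, ∀ y ∈ P, E (x * y) = φP y • x

/-- `(M, φ) = (N, φN) ∗ (P, φP)`: `N` and `P` are subalgebras of `M` which generate `M`,
the state `φ` restricts to `φN`, `φP`, and `N`, `P` are free with respect to `φ`. -/
structure IsFreeProductDecomposition (M N P : VonNeumannAlgebra H)
    (φ φN φP : Op H → ℂ) : Prop where
  subN : (N : Set (Op H)) ⊆ (M : Set (Op H))
  subP : (P : Set (Op H)) ⊆ (M : Set (Op H))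
  generates :
    Set.centralizer (Set.centralizer ((N : Set (Op H)) ∪ (P : Set (Op H)))) = (M : Set (Op H))
  restN : ∀ x ∈ N, φ x = φN x
  restP : ∀ x ∈ P, φ x = φP x
  free : ∀ (n : ℕ) (x : Fin n → Op H) (ε : Fin n → Bool), n ≠ 0 →
    (∀ i, x i ∈ (if ε i then (N : Set (Op H)) else (P : Set (Op H)))) →
    (∀ i, φ (x i) = 0) →
    (∀ i j : Fin n, (i : ℕ) + 1 = (j : ℕ) → ε i ≠ ε j) →
    φ (List.ofFn x).prod = 0

/-- `f` restricts to a ∗-isomorphism `N ≅ P`. -/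
structure IsVNIso (N P : VonNeumannAlgebra H) (f : Op H → Op H) : Prop where
  mem' : ∀ x ∈ N, f x ∈ P
  surj' : ∀ y ∈ P, ∃ x ∈ N, f x = y
  inj' : ∀ x ∈ N, ∀ y ∈ N, f x = f y → x = y
  map_add' : ∀ x ∈ N, ∀ y ∈ N, f (x + y) = f x + f y
  map_smul' : ∀ (c : ℂ), ∀ x ∈ N, f (c • x) = c • f x
  map_mul' : ∀ x ∈ N, ∀ y ∈ N, f (x * y) = f x * f y
  map_star' : ∀ x ∈ N, f (star x) = star (f x)

/-- `M` satisfies the Haagerup–Størmer conjecture: an automorphism of `M` is pointwise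
inner iff it is the composition of an inner automorphism and a modular automorphism
`σ_t^χ` of some faithful normal state `χ`. -/
def SatisfiesHSC (M : VonNeumannAlgebra H) : Prop :=
  ∀ Θ : VNAut M, PointwiseInner Θ ↔
    ∃ (χ : Op H → ℂ) (σ : ℝ → Op H → Op H) (u : Op H) (t : ℝ),
      IsFNState M χ ∧ IsModularFlow M χ σ ∧ IsUnitaryIn (M : Set (Op H)) u ∧
      ∀ x ∈ M, Θ.toFun x = u * σ t x * star u

/-- `Λ` is a countable subgroup of `ℝ_{>0}`, dense in `ℝ_{>0}`. -/
def IsCountableDenseSubgroup (Λ : Set ℝ) : Prop :=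
  Λ ⊆ Set.Ioi (0 : ℝ) ∧ (1 : ℝ) ∈ Λ ∧ (∀ a ∈ Λ, ∀ b ∈ Λ, a * b ∈ Λ) ∧
    (∀ a ∈ Λ, a⁻¹ ∈ Λ) ∧ Λ.Countable ∧ Set.Ioi (0 : ℝ) ⊆ closure Λ

/-- `g` is a character of the (discrete) group `Λ < ℝ_{>0}`, i.e. an element of the dual
compact group `G = Λ̂` (only the values of `g` on `Λ` are relevant). -/
def IsCharacterOn (Λ : Set ℝ) (g : ℝ → ℂ) : Prop :=
  g 1 = 1 ∧ (∀ a ∈ Λ, ‖g a‖ = 1) ∧ ∀ a ∈ Λ, ∀ b ∈ Λ, g (a * b) = g a * g b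

/-- `Φ ∈ E_{M,φ}`: `Φ` is a faithful normal positive linear functional with
`s(φ) ∈ M_Φ` and `Φ s(φ) = s(φ) Φ = φ`. -/
def MemE (M : VonNeumannAlgebra H) (φ Φ : Op H → ℂ) : Prop :=
  IsNormalPLF M Φ ∧ IsFaithfulOn M Φ ∧
    ∃ p, IsSupportProjOf M φ p ∧ (∀ x ∈ M, Φ (p * x) = Φ (x * p)) ∧
      ∀ x ∈ M, Φ (p * x) = φ x

/-- `w = ([DΨ : DΦ]_t)_t` is the Connes Radon–Nikodym cocycle of the pair `(Ψ, Φ)` of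
faithful normal positive functionals (with `σΦ` the modular flow of `Φ`): the unique
σ-strongly continuous family of unitaries satisfying the cocycle identity and the
relative KMS condition. -/
structure IsConnesCocycle (M : VonNeumannAlgebra H) (Φ Ψ : Op H → ℂ)
    (σΦ : ℝ → Op H → Op H) (w : ℝ → Op H) : Prop where
  unitary' : ∀ t : ℝ, IsUnitaryIn (M : Set (Op H)) (w t)
  cocycle' : ∀ s t : ℝ, w (s + t) = w s * σΦ s (w t)
  continuous' : ∀ ξ : H, Continuous fun t : ℝ => w t ξ
  kms' : ∀ x ∈ M, ∀ y ∈ M, ∃ F : ℂ → ℂ, ContinuousOn F strip ∧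
    DifferentiableOn ℂ F stripo ∧ (∃ C : ℝ, ∀ z ∈ strip, ‖F z‖ ≤ C) ∧
    (∀ t : ℝ, F (t : ℂ) = Ψ (w t * σΦ t x * y)) ∧
    (∀ t : ℝ, F ((t : ℂ) + Complex.I) = Φ (y * (w t * σΦ t x)))

/-- `S` is a strongly dense subset of `M`. -/
def StronglyDenseIn (M : VonNeumannAlgebra H) (S : Set (Op H)) : Prop :=
  S ⊆ (M : Set (Op H)) ∧ ∀ x ∈ M, ∀ ε : ℝ, 0 < ε → ∀ Ξ : Finset H,
    ∃ y ∈ S, ∀ ξ ∈ Ξ, ‖(x - y) ξ‖ < ε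

/-- There is a net `(t_j)` in `ℝ` along which `φ(σ_{t_j}^Φ(b^*) w_{t_j}^* s(ψ) a) → 0`
for all `a, b ∈ S` (nets are encoded by maps out of a nontrivially filtered index type). -/
def VanishingNet (φ : Op H → ℂ) (σΦ : ℝ → Op H → Op H) (w : ℝ → Op H)
    (sψ : Op H) (S : Set (Op H)) : Prop :=
  ∃ (ι : Type) (l : Filter ι), l.NeBot ∧ ∃ t : ι → ℝ,
    ∀ a ∈ S, ∀ b ∈ S,
      Filter.Tendsto (fun j => φ (σΦ (t j) (star b) * (star (w (t j)) * (sψ * a))))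
        l (nhds (0 : ℂ))

/-- `(D, π, lam)` is the discrete core `d_{Λ,φ}(M) = M ⋊_{σ^{Λ,φ}} G` of `(M, φ)` with
respect to `Λ = σ_p(Δ_φ)` and `G = Λ̂`: `π` is a normal unital ∗-embedding of `M` into `D`,
`lam` implements `G` by unitaries of `D` satisfying the covariance relation
`λ_g π(x) λ_g^* = ⟨g, l⟩ π(x)` on `l`-eigenvectors, and `π(M)` together with the `λ_g`
generate `D`. -/
structure IsDiscreteCore {K : Type} [NormedAddCommGroup K] [InnerProductSpace ℂ K]
    [CompleteSpace K] (M : VonNeumannAlgebra H) (σ : ℝ → Op H → Op H)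
    (D : VonNeumannAlgebra K) (π : Op H → Op K) (lam : (ℝ → ℂ) → Op K) : Prop where
  mem' : ∀ x ∈ M, π x ∈ D
  inj' : ∀ x ∈ M, ∀ y ∈ M, π x = π y → x = y
  map_one' : π 1 = 1
  map_add' : ∀ x ∈ M, ∀ y ∈ M, π (x + y) = π x + π y
  map_smul' : ∀ (c : ℂ), ∀ x ∈ M, π (c • x) = c • π x
  map_mul' : ∀ x ∈ M, ∀ y ∈ M, π (x * y) = π x * π y
  map_star' : ∀ x ∈ M, π (star x) = star (π x)
  lam_unitary' : ∀ g, IsCharacterOn (pointSpectrum M σ) g →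
    IsUnitaryIn (D : Set (Op K)) (lam g)
  lam_one' : lam (fun _ => 1) = 1
  lam_mul' : ∀ g h, IsCharacterOn (pointSpectrum M σ) g →
    IsCharacterOn (pointSpectrum M σ) h → lam (fun r => g r * h r) = lam g * lam h
  covariance' : ∀ g, IsCharacterOn (pointSpectrum M σ) g →
    ∀ l ∈ pointSpectrum M σ, ∀ x, IsEigenvector M σ l x →
      lam g * π x * star (lam g) = g l • π x
  generates' : Set.centralizer (Set.centralizer
      ((π '' (M : Set (Op H))) ∪ (lam '' {g | IsCharacterOn (pointSpectrum M σ) g})))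
    = (D : Set (Op K))

open scoped InnerProductSpace ComplexConjugate

section Basics

theorem smul_memV {M : VonNeumannAlgebra H} (c : ℂ) {x : Op H} (hx : x ∈ M) : c • x ∈ M :=
  M.toStarSubalgebra.smul_mem hx c

theorem mem_of_commute {M : VonNeumannAlgebra H} {x : Op H}
    (h : ∀ y ∈ M.commutant, y * x = x * y) : x ∈ M := by
  rw [← M.commutant_commutant]
  exact VonNeumannAlgebra.mem_commutant_iff.2 h

theorem commute_of_mem {M : VonNeumannAlgebra H} {x y : Op H} (hx : x ∈ M)
    (hy : y ∈ M.commutant) : x * y = y * x :=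
  VonNeumannAlgebra.mem_commutant_iff.1 hy x hx

theorem cfc_memV {M : VonNeumannAlgebra H} {x : Op H} (hx : x ∈ M) (f : ℝ → ℝ) :
    cfc f x ∈ M :=
  mem_of_commute fun _ hy => (Commute.cfc_real (commute_of_mem hx hy) f).symm.eq

theorem sqrt_memV {M : VonNeumannAlgebra H} {x : Op H} (hx : x ∈ M) :
    CFC.sqrt x ∈ M :=
  mem_of_commute fun _ hy => (Commute.cfcₙ_nnreal (commute_of_mem hx hy) _).symm.eq

theorem exists_sqrt {M : VonNeumannAlgebra H} {x : Op H} (hx : x ∈ M) (h0 : 0 ≤ x) :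
    ∃ s ∈ M, 0 ≤ s ∧ star s = s ∧ s * s = x := by
  have hs : 0 ≤ CFC.sqrt x := CFC.sqrt_nonneg x
  exact ⟨CFC.sqrt x, sqrt_memV hx, hs, (IsSelfAdjoint.of_nonneg hs).star_eq,
    CFC.sqrt_mul_sqrt_self x h0⟩

theorem mul_app (x y : Op H) (v : H) : (x * y) v = x (y v) := rfl

theorem inner_star_left (x : Op H) (a b : H) : ⟪star x a, b⟫_ℂ = ⟪a, x b⟫_ℂ := by
  rw [ContinuousLinearMap.star_eq_adjoint, ContinuousLinearMap.adjoint_inner_left]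

theorem inner_star_right (x : Op H) (a b : H) : ⟪a, star x b⟫_ℂ = ⟪x a, b⟫_ℂ := by
  rw [ContinuousLinearMap.star_eq_adjoint, ContinuousLinearMap.adjoint_inner_right]

theorem inner_star_mul_self (x : Op H) (a : H) : ⟪a, (star x * x) a⟫_ℂ = ((‖x a‖ ^ 2 : ℝ) : ℂ) := by
  rw [mul_app, inner_star_right, inner_self_eq_norm_sq_to_K]
  norm_cast

namespace IsPLF
variable {M : VonNeumannAlgebra H} {φ : Op H → ℂ}

theorem map_zero (h : IsPLF M φ) : φ 0 = 0 := by
  simpa using h.map_smul 0 0 (zero_mem M)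

theorem map_neg (h : IsPLF M φ) {x : Op H} (hx : x ∈ M) : φ (-x) = -φ x := by
  simpa using h.map_smul (-1) x hx

theorem map_sub (h : IsPLF M φ) {x y : Op H} (hx : x ∈ M) (hy : y ∈ M) : φ (x - y) = φ x - φ y := by
  rw [sub_eq_add_neg, h.map_add x hx _ (neg_mem hy), h.map_neg hy, sub_eq_add_neg]

theorem map_sum (h : IsPLF M φ) {ι : Type*} (s : Finset ι) {f : ι → Op H} (hf : ∀ i ∈ s, f i ∈ M) :
    φ (∑ i ∈ s, f i) = ∑ i ∈ s, φ (f i) := by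
  classical
  induction s using Finset.induction_on with
  | empty => simpa using h.map_zero
  | insert a s ha ih =>
    rw [Finset.sum_insert ha, Finset.sum_insert ha, h.map_add _ (hf a (by simp)) _
      (sum_mem fun i hi => hf i (by simp [hi])), ih fun i hi => hf i (by simp [hi])]

theorem nonneg (h : IsPLF M φ) {x : Op H} (hx : x ∈ M) (h0 : 0 ≤ x) : 0 ≤ φ x := by
  obtain ⟨s, hs, -, hss, rfl⟩ := exists_sqrt hx h0
  simpa [hss] using h.pos s hs

theorem mono (h : IsPLF M φ) {x y : Op H} (hx : x ∈ M) (hy : y ∈ M) (hxy : x ≤ y) : φ x ≤ φ y := by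
  have := h.nonneg (sub_mem hy hx) (sub_nonneg.2 hxy)
  rwa [h.map_sub hy hx, sub_nonneg] at this

theorem map_star_of_selfAdjoint (h : IsPLF M φ) {x : Op H} (hx : x ∈ M) (hs : star x = x) :
    conj (φ x) = φ x := by
  have h1 := h.pos (1 + x) (add_mem (one_mem M) hx)
  have h2 := h.pos (1 - x) (sub_mem (one_mem M) hx)
  have e : (4 : ℂ) • x = star (1 + x) * (1 + x) - star (1 - x) * (1 - x) := by
    have : (4 : ℂ) • x = x + x + x + x := by
      rw [show (4 : ℂ) = 1 + 1 + 1 + 1 by norm_num]; simp only [add_smul, one_smul]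
    rw [this]; simp only [star_add, star_sub, star_one, hs]; noncomm_ring
  have e2 : 4 * φ x = φ (star (1 + x) * (1 + x)) - φ (star (1 - x) * (1 - x)) := by
    rw [← h.map_smul _ _ hx, e, h.map_sub]
    · exact mul_mem (star_mem (add_mem (one_mem M) hx)) (add_mem (one_mem M) hx)
    · exact mul_mem (star_mem (sub_mem (one_mem M) hx)) (sub_mem (one_mem M) hx)
  have e3 : (φ x).im = 0 := by
    have := congrArg Complex.im e2
    have i1 := (Complex.nonneg_iff.1 h1).2
    have i2 := (Complex.nonneg_iff.1 h2).2
    rw [Complex.sub_im, ← i1, ← i2] at this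
    simpa using this
  exact Complex.conj_eq_iff_im.2 e3

theorem map_star (h : IsPLF M φ) {x : Op H} (hx : x ∈ M) : φ (star x) = conj (φ x) := by
  have hx' := star_mem hx
  have h1 := h.map_star_of_selfAdjoint (add_mem hx hx') (by simp [add_comm])
  have h2 := h.map_star_of_selfAdjoint (smul_memV Complex.I (sub_mem hx hx'))
    (by simp [smul_sub]; abel)
  rw [h.map_add _ hx _ hx'] at h1
  rw [h.map_smul _ _ (sub_mem hx hx'), h.map_sub hx hx'] at h2
  rw [Complex.ext_iff] at h1 h2 ⊢
  simp at h1 h2 ⊢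
  constructor <;> linarith

theorem cauchy_schwarz (h : IsPLF M φ) {a b : Op H} (ha : a ∈ M) (hb : b ∈ M) :
    ‖φ (star a * b)‖ ^ 2 ≤ (φ (star a * a)).re * (φ (star b * b)).re := by
  let c : PreInnerProductSpace.Core ℂ M.toStarSubalgebra :=
    { inner := fun x y => φ (star (x : Op H) * y)
      conj_inner_symm := fun x y => by
        have hx : (x : Op H) ∈ M := x.2
        have hy : (y : Op H) ∈ M := y.2
        change conj (φ (star (y : Op H) * x)) = φ (star (x : Op H) * y)
        rw [← h.map_star (mul_mem (star_mem hy) hx)]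
        simp
      re_inner_nonneg := fun x => (Complex.nonneg_iff.1 (h.pos x x.2)).1
      add_left := fun x y z => by
        have hx : (x : Op H) ∈ M := x.2
        have hy : (y : Op H) ∈ M := y.2
        have hz : (z : Op H) ∈ M := z.2
        change φ (star ((x : Op H) + y) * z) = _
        rw [star_add, add_mul, h.map_add _ (mul_mem (star_mem hx) hz) _
          (mul_mem (star_mem hy) hz)]
      smul_left := fun x y r => by
        have hx : (x : Op H) ∈ M := x.2
        have hy : (y : Op H) ∈ M := y.2
        change φ (star (r • (x : Op H)) * y) = _
        rw [star_smul, smul_mul_assoc, h.map_smul _ _ (mul_mem (star_mem hx) hy)]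
        rfl }
  have := @InnerProductSpace.Core.inner_mul_inner_self_le ℂ M.toStarSubalgebra _ _ _ c
    ⟨a, ha⟩ ⟨b, hb⟩
  have e : ‖φ (star b * a)‖ = ‖φ (star a * b)‖ := by
    rw [show star b * a = star (star a * b) by simp, h.map_star (mul_mem (star_mem ha) hb)]
    simp
  rw [sq]
  nth_rewrite 2 [← e]
  exact this

theorem re_nonneg (h : IsPLF M φ) {x : Op H} (hx : x ∈ M) : 0 ≤ (φ (star x * x)).re :=
  (Complex.nonneg_iff.1 (h.pos x hx)).1

end IsPLF

theorem star_mul_mul_le (x a : Op H) :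
    star a * (star x * x) * a ≤ ((‖x‖ ^ 2 : ℝ) : ℂ) • (star a * a) := by
  rw [ContinuousLinearMap.le_def, ContinuousLinearMap.isPositive_iff_complex]
  intro v
  have h1 : ⟪v, (((‖x‖ ^ 2 : ℝ) : ℂ) • (star a * a) - star a * (star x * x) * a) v⟫_ℂ
      = ((‖x‖ ^ 2 * ‖a v‖ ^ 2 - ‖x (a v)‖ ^ 2 : ℝ) : ℂ) := by
    rw [show star a * (star x * x) * a = star (x * a) * (x * a) by simp [mul_assoc],
      sub_apply, smul_apply, inner_sub_right,
      inner_smul_right, inner_star_mul_self, inner_star_mul_self]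
    push_cast; simp
  have h2 : ‖x (a v)‖ ^ 2 ≤ ‖x‖ ^ 2 * ‖a v‖ ^ 2 := by
    rw [← mul_pow]; gcongr; exact x.le_opNorm _
  rw [← inner_conj_symm, h1]
  constructor
  · simp only [Complex.conj_ofReal, RCLike.re_eq_complex_re, Complex.ofReal_re]
  · simp only [Complex.conj_ofReal, RCLike.re_eq_complex_re, Complex.ofReal_re]; linarith

theorem IsPLF.bound {M : VonNeumannAlgebra H} {φ : Op H → ℂ} (h : IsPLF M φ)
    {x a : Op H} (hx : x ∈ M) (ha : a ∈ M) :
    (φ (star a * (star x * x) * a)).re ≤ ‖x‖ ^ 2 * (φ (star a * a)).re := by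
  have h1 : star a * (star x * x) * a ∈ M :=
    mul_mem (mul_mem (star_mem ha) (mul_mem (star_mem hx) hx)) ha
  have h2 : star a * a ∈ M := mul_mem (star_mem ha) ha
  have := h.mono h1 (smul_memV _ h2) (star_mul_mul_le x a)
  rw [h.map_smul _ _ h2] at this
  simpa only [Complex.re_ofReal_mul] using (Complex.le_def.1 this).1

theorem IsPLF.norm_le {M : VonNeumannAlgebra H} {φ : Op H → ℂ} (h : IsPLF M φ)
    {x : Op H} (hx : x ∈ M) : ‖φ x‖ ≤ (φ 1).re * ‖x‖ := by
  have h1 := h.cauchy_schwarz (one_mem M) hx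
  have h2 := h.bound hx (one_mem M)
  have h3 := h.re_nonneg (one_mem M)
  simp only [star_one, one_mul, mul_one] at h1 h2 h3
  refine abs_le_of_sq_le_sq' (by nlinarith) (by positivity) |>.2

end Basics

section ClosureProj

/-- The orthogonal projection onto the closure of a subspace. -/
noncomputable def clProj (U : Submodule ℂ H) : Op H := U.topologicalClosure.starProjection

theorem clProj_eq_self {U : Submodule ℂ H} {v : H} (hv : v ∈ U.topologicalClosure) :
    clProj U v = v :=
  Submodule.starProjection_eq_self_iff.2 hv

theorem clProj_of_mem {U : Submodule ℂ H} {v : H} (hv : v ∈ U) : clProj U v = v :=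
  clProj_eq_self (U.le_topologicalClosure hv)

theorem clProj_mem_closure (U : Submodule ℂ H) (v : H) : clProj U v ∈ U.topologicalClosure :=
  Submodule.starProjection_apply_mem _ v

theorem clProj_mul_self (U : Submodule ℂ H) : clProj U * clProj U = clProj U :=
  Submodule.isIdempotentElem_starProjection _

theorem inner_clProj (U : Submodule ℂ H) (a b : H) :
    ⟪clProj U a, b⟫_ℂ = ⟪a, clProj U b⟫_ℂ :=
  Submodule.inner_starProjection_left_eq_right _ a b

theorem star_clProj (U : Submodule ℂ H) : star (clProj U) = clProj U := by
  ext a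
  refine ext_inner_right ℂ fun b => ?_
  rw [inner_star_left, inner_clProj]

theorem norm_clProj_le (U : Submodule ℂ H) : ‖clProj U‖ ≤ 1 :=
  Submodule.starProjection_norm_le _

omit [CompleteSpace H] in
/-- Continuous maps agreeing on a subspace agree on its closure. -/
theorem eq_on_closure {K : Type*} [TopologicalSpace K] [T2Space K]
    {f g : H → K} (hf : Continuous f) (hg : Continuous g)
    {U : Submodule ℂ H} (h : ∀ u ∈ U, f u = g u) {v : H} (hv : v ∈ U.topologicalClosure) :
    f v = g v := by
  have : closure (U : Set H) ⊆ {v | f v = g v} :=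
    closure_minimal (fun u hu => h u hu) (isClosed_eq hf hg)
  exact this hv

theorem clProj_le_of_fix {U : Submodule ℂ H} {x : Op H} (h : ∀ u ∈ U, x u = u) :
    x * clProj U = clProj U := by
  ext v
  exact eq_on_closure x.continuous continuous_id h (clProj_mem_closure U v)

theorem mul_clProj_eq_zero {U : Submodule ℂ H} {x : Op H} (h : ∀ u ∈ U, x u = 0) :
    x * clProj U = 0 := by
  ext v
  exact eq_on_closure x.continuous continuous_const h (clProj_mem_closure U v)

theorem clProj_mul_of_range {U : Submodule ℂ H} {x : Op H} (h : ∀ v, x v ∈ U) :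
    clProj U * x = x := by
  ext v
  exact clProj_of_mem (h v)

theorem clProj_mul_mul_clProj {U : Submodule ℂ H} {y : Op H} (h : ∀ u ∈ U, y u ∈ U) :
    clProj U * (y * clProj U) = y * clProj U := by
  ext v
  refine eq_on_closure (f := fun w => clProj U (y w)) (g := y) (by fun_prop) (by fun_prop)
    (fun u hu => clProj_of_mem (h u hu)) (clProj_mem_closure U v)

theorem clProj_commute {U : Submodule ℂ H} {y : Op H} (h : ∀ u ∈ U, y u ∈ U)
    (h' : ∀ u ∈ U, star y u ∈ U) : y * clProj U = clProj U * y := by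
  have h1 := clProj_mul_mul_clProj h
  have h2 := congrArg star (clProj_mul_mul_clProj h')
  simp only [star_mul, star_star, star_clProj] at h2
  rw [← h1, ← mul_assoc, h2]

theorem clProj_mem {M : VonNeumannAlgebra H} {U : Submodule ℂ H}
    (h : ∀ y ∈ M.commutant, ∀ u ∈ U, y u ∈ U) : clProj U ∈ M :=
  mem_of_commute fun y hy => clProj_commute (h y hy) (h _ (star_mem hy))

theorem isProjIn_clProj {M : VonNeumannAlgebra H} {U : Submodule ℂ H}
    (h : ∀ y ∈ M.commutant, ∀ u ∈ U, y u ∈ U) : IsProjIn (M : Set (Op H)) (clProj U) :=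
  ⟨clProj_mem h, star_clProj U, clProj_mul_self U⟩

theorem isProjIn_range {M : VonNeumannAlgebra H} {x : Op H} (hx : x ∈ M) :
    IsProjIn (M : Set (Op H)) (clProj (LinearMap.range (x : H →ₗ[ℂ] H))) := by
  refine isProjIn_clProj ?_
  rintro y hy _ ⟨w, rfl⟩
  exact ⟨y w, by simpa [mul_app] using congrArg (fun z : Op H => z w) (commute_of_mem hx hy)⟩

theorem clProj_range_mul (x : Op H) : clProj (LinearMap.range (x : H →ₗ[ℂ] H)) * x = x :=
  clProj_mul_of_range fun v => ⟨v, rfl⟩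

theorem IsProjIn.one_sub {M : VonNeumannAlgebra H} {p : Op H}
    (hp : IsProjIn (M : Set (Op H)) p) : IsProjIn (M : Set (Op H)) (1 - p) := by
  refine ⟨sub_mem (one_mem M) hp.1, by simp [hp.2.1], ?_⟩
  rw [mul_sub, sub_mul, sub_mul, hp.2.2]; simp

theorem IsProjIn.mul_comm_zero {A : Set (Op H)} {p q : Op H} (hp : IsProjIn A p)
    (hq : IsProjIn A q) (h : p * q = 0) : q * p = 0 := by
  have := congrArg star h
  rwa [star_mul, hp.2.1, hq.2.1, star_zero] at this

theorem IsProjIn.le_comm {A : Set (Op H)} {p q : Op H} (hp : IsProjIn A p)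
    (hq : IsProjIn A q) (h : p * q = q) : q * p = q := by
  have := congrArg star h
  rwa [star_mul, hp.2.1, hq.2.1] at this

theorem IsProjIn.sub {M : VonNeumannAlgebra H} {p q : Op H} (hp : IsProjIn (M : Set (Op H)) p)
    (hq : IsProjIn (M : Set (Op H)) q) (h : p * q = q) :
    IsProjIn (M : Set (Op H)) (p - q) := by
  refine ⟨sub_mem (S := VonNeumannAlgebra H) hp.1 hq.1, by simp [hp.2.1, hq.2.1], ?_⟩
  rw [mul_sub, sub_mul, sub_mul, hp.2.2, hq.2.2, h, hp.le_comm hq h]; simp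

theorem IsProjIn.add {M : VonNeumannAlgebra H} {p q : Op H} (hp : IsProjIn (M : Set (Op H)) p)
    (hq : IsProjIn (M : Set (Op H)) q) (h : p * q = 0) :
    IsProjIn (M : Set (Op H)) (p + q) := by
  refine ⟨add_mem (S := VonNeumannAlgebra H) hp.1 hq.1, by simp [hp.2.1, hq.2.1], ?_⟩
  rw [mul_add, add_mul, add_mul, hp.2.2, hq.2.2, h, hp.mul_comm_zero hq h]; simp

theorem IsProjIn.norm_sq {A : Set (Op H)} {p : Op H} (hp : IsProjIn A p) (v : H) :
    ⟪v, p v⟫_ℂ = ((‖p v‖ ^ 2 : ℝ) : ℂ) := by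
  rw [← inner_star_mul_self, hp.2.1, hp.2.2]

theorem isProjIn_sum {M : VonNeumannAlgebra H} {ι : Type*} {p : ι → Op H}
    (hp : ∀ i, IsProjIn (M : Set (Op H)) (p i)) (ho : Pairwise fun i j => p i * p j = 0)
    (s : Finset ι) : IsProjIn (M : Set (Op H)) (∑ i ∈ s, p i) := by
  classical
  induction s using Finset.induction_on with
  | empty => exact ⟨by simp, by simp, by simp⟩
  | insert a s ha ih =>
    rw [Finset.sum_insert ha]
    refine (hp a).add ih ?_
    rw [Finset.mul_sum]
    exact Finset.sum_eq_zero fun i hi => ho (fun h => ha (h ▸ hi))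

/-- Orthogonal families of projections of `M` are summable in the strong topology. -/
theorem exists_sum_proj {M : VonNeumannAlgebra H} {ι : Type*} {p : ι → Op H}
    (hp : ∀ i, IsProjIn (M : Set (Op H)) (p i)) (ho : Pairwise fun i j => p i * p j = 0) :
    ∃ q, IsProjIn (M : Set (Op H)) q ∧ (∀ ξ, HasSum (fun i => p i ξ) (q ξ)) ∧
      (∀ i, q * p i = p i) ∧ ∀ x : Op H, (∀ i, x * p i = p i) → x * q = q := by
  classical
  have app : ∀ i j, ∀ v, p i (p j v) = if i = j then p j v else 0 := by
    intro i j v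
    split_ifs with h
    · subst h; rw [← mul_app, (hp i).2.2]
    · rw [← mul_app, ho h]; rfl
  have sa : ∀ i a b, ⟪p i a, b⟫_ℂ = ⟪a, p i b⟫_ℂ := fun i a b => by
    conv_lhs => rw [← (hp i).2.1]
    exact inner_star_left _ _ _
  set U : Submodule ℂ H := ⨆ i, LinearMap.range (p i : H →ₗ[ℂ] H) with hU
  have hUi : ∀ i v, p i v ∈ U := fun i v =>
    (le_iSup (fun i => LinearMap.range (p i : H →ₗ[ℂ] H)) i) ⟨v, rfl⟩
  have hUcomm : ∀ y ∈ M.commutant, ∀ u ∈ U, y u ∈ U := by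
    intro y hy u hu
    induction hu using Submodule.iSup_induction' with
    | mem i x hx =>
      obtain ⟨w, rfl⟩ := hx
      have : y (p i w) = p i (y w) := by
        rw [← mul_app, ← mul_app, commute_of_mem (hp i).1 hy]
      exact this ▸ hUi i _
    | zero => simp
    | add a b _ _ iha ihb => rw [map_add]; exact add_mem iha ihb
  have hfix : ∀ x : Op H, (∀ i, x * p i = p i) → ∀ u ∈ U, x u = u := by
    intro x hx u hu
    induction hu using Submodule.iSup_induction' with
    | mem i v hv =>
      obtain ⟨w, rfl⟩ := hv
      exact congrArg (fun z : Op H => z w) (hx i)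
    | zero => simp
    | add a b _ _ iha ihb => rw [map_add, iha, ihb]
  refine ⟨clProj U, isProjIn_clProj hUcomm, fun ξ => ?_, fun i => ?_, fun x hx => ?_⟩
  · have horth : OrthogonalFamily ℂ (fun i => LinearMap.range (p i : H →ₗ[ℂ] H))
        fun i => (LinearMap.range (p i : H →ₗ[ℂ] H)).subtypeₗᵢ := by
      rintro i j hij ⟨_, v, rfl⟩ ⟨_, w, rfl⟩
      change ⟪p i v, p j w⟫_ℂ = 0
      rw [sa, app, if_neg hij, inner_zero_right]
    have hsq : Summable fun i => ‖p i ξ‖ ^ 2 := by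
      refine summable_of_sum_le (c := ‖ξ‖ ^ 2) (fun i => by positivity) fun s => ?_
      have hs := isProjIn_sum hp ho s
      have h1 : ‖(∑ i ∈ s, p i) ξ‖ ^ 2 = ∑ i ∈ s, ‖p i ξ‖ ^ 2 := by
        have := hs.norm_sq ξ
        rw [sum_apply, inner_sum] at this
        simp only [fun i => (hp i).norm_sq ξ] at this
        rw [← sum_apply] at this
        exact_mod_cast this.symm
      have h2 : ‖(∑ i ∈ s, p i) ξ‖ ^ 2 ≤ ‖ξ‖ * ‖(∑ i ∈ s, p i) ξ‖ := by
        have := norm_inner_le_norm (𝕜 := ℂ) ξ ((∑ i ∈ s, p i) ξ)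
        rw [hs.norm_sq ξ] at this
        simpa using this
      rw [← h1]
      nlinarith [norm_nonneg ((∑ i ∈ s, p i) ξ), norm_nonneg ξ]
    have hsum : Summable fun i => p i ξ :=
      (horth.summable_iff_norm_sq_summable fun i => ⟨p i ξ, ξ, rfl⟩).2 hsq
    have hmem : ∑' i, p i ξ ∈ U.topologicalClosure :=
      isClosed_closure.mem_of_tendsto hsum.hasSum
        (Filter.Eventually.of_forall fun s => subset_closure (sum_mem fun i _ => hUi i ξ))
    have hpj : ∀ j, p j (∑' i, p i ξ) = p j ξ := by
      intro j
      rw [(p j).map_tsum hsum, tsum_eq_single j]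
      · rw [app, if_pos rfl]
      · intro i hi; rw [app, if_neg hi.symm]
    have : clProj U ξ = ∑' i, p i ξ := by
      refine (Submodule.eq_starProjection_of_mem_of_inner_eq_zero hmem fun w hw => ?_)
      refine eq_on_closure (f := fun w => ⟪ξ - ∑' i, p i ξ, w⟫_ℂ) (g := fun _ => 0)
        (by fun_prop) continuous_const ?_ hw
      intro u hu
      induction hu using Submodule.iSup_induction' with
      | mem i x hx =>
        obtain ⟨v, rfl⟩ := hx
        change ⟪_, p i v⟫_ℂ = 0
        rw [← sa, map_sub, hpj, sub_self, inner_zero_left]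
      | zero => simp
      | add a b _ _ iha ihb => simp only [inner_add_right] at *; rw [iha, ihb, add_zero]
    rw [this]
    exact hsum.hasSum
  · exact clProj_mul_of_range fun v => hUi i v
  · exact clProj_le_of_fix (hfix x hx)

/-- Existence of maximal orthogonal families of elements with a given property. -/
theorem exists_maximal_orthogonal (Q : Op H → Prop) :
    ∃ S : Set (Op H), (∀ r ∈ S, Q r) ∧ (S.Pairwise fun r r' => r * r' = 0) ∧
      ∀ r, Q r → (∀ r' ∈ S, r * r' = 0 ∧ r' * r = 0) → r ∈ S := by
  obtain ⟨S, hS⟩ := zorn_subset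
    {S : Set (Op H) | (∀ r ∈ S, Q r) ∧ S.Pairwise fun r r' => r * r' = 0} (by
      intro c hc hch
      refine ⟨⋃₀ c, ⟨?_, ?_⟩, fun s hs => Set.subset_sUnion_of_mem hs⟩
      · rintro r ⟨s, hs, hr⟩
        exact (hc hs).1 r hr
      · exact (Set.pairwise_sUnion hch.directedOn).2 fun s hs => (hc hs).2)
  refine ⟨S, hS.prop.1, hS.prop.2, fun r hr hr' => ?_⟩
  have : insert r S ∈ {S : Set (Op H) | (∀ r ∈ S, Q r) ∧ S.Pairwise fun r r' => r * r' = 0} := by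
    refine ⟨?_, ?_⟩
    · rintro x (rfl | hx)
      · exact hr
      · exact hS.prop.1 x hx
    · exact hS.prop.2.insert fun b hb _ => hr' b hb
  exact hS.le_of_ge this (Set.subset_insert r S) (Set.mem_insert r S)

end ClosureProj

section Spectral

theorem re_inner_nonneg {x : Op H} (hx : 0 ≤ x) (v : H) : 0 ≤ (⟪v, x v⟫_ℂ).re :=
  (ContinuousLinearMap.nonneg_iff_isPositive x).1 hx |>.re_inner_nonneg_right v

theorem re_inner_mono {x y : Op H} (hxy : x ≤ y) (v : H) :
    (⟪v, x v⟫_ℂ).re ≤ (⟪v, y v⟫_ℂ).re := by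
  have := re_inner_nonneg (sub_nonneg.2 hxy) v
  rw [sub_apply, inner_sub_right, Complex.sub_re] at this
  linarith

theorem mul_eq_zero_of_nonneg {c f : Op H} (h0 : 0 ≤ c) (h : star f * c * f = 0) :
    c * f = 0 := by
  have hs := CFC.sqrt_mul_sqrt_self c h0
  have hsa := (IsSelfAdjoint.of_nonneg (CFC.sqrt_nonneg c)).star_eq
  have h1 : star (CFC.sqrt c * f) * (CFC.sqrt c * f) = 0 := by
    rw [star_mul, hsa, mul_assoc, ← mul_assoc (CFC.sqrt c), hs, ← mul_assoc, h]
  have h2 := CStarRing.star_mul_self_eq_zero_iff _ |>.1 h1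
  rw [← hs, mul_assoc, h2, mul_zero]

theorem mul_eq_zero_of_le {c y f : Op H} (h0 : 0 ≤ c) (hcy : c ≤ y) (hy : y * f = 0) :
    c * f = 0 := by
  refine mul_eq_zero_of_nonneg h0 (le_antisymm ?_ (star_left_conjugate_nonneg h0 f))
  calc star f * c * f ≤ star f * y * f := star_left_conjugate_le_conjugate hcy f
    _ = 0 := by rw [mul_assoc, hy, mul_zero]

/-- The truncation `min ((s - t)₊, δ)`. -/
noncomputable def clip (t δ s : ℝ) : ℝ := min (max (s - t) 0) δ

theorem continuous_clip (t δ : ℝ) : Continuous (clip t δ) := by unfold clip; fun_prop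

theorem sum_clip {δ : ℝ} (hδ : 0 ≤ δ) {s : ℝ} (hs : 0 ≤ s) (n : ℕ) :
    ∑ k ∈ Finset.range n, clip (k * δ) δ s = min s (n * δ) := by
  induction n with
  | zero => simp [hs]
  | succ n ih =>
    rw [Finset.sum_range_succ, ih]
    unfold clip
    push_cast
    rcases le_total s (n * δ) with h | h
    · rw [min_eq_left h, max_eq_right (by linarith), min_eq_left hδ, min_eq_left (by nlinarith)]
      ring
    · rw [min_eq_right h, max_eq_left (by linarith)]
      rcases le_total s ((n + 1) * δ) with h' | h'
      · rw [min_eq_left h', min_eq_left (by linarith)]; ring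
      · rw [min_eq_right h', min_eq_right (by linarith)]; ring

theorem clip_le_self {t δ s : ℝ} (ht : 0 ≤ t) (hs : 0 ≤ s) : clip t δ s ≤ s :=
  (min_le_left _ _).trans (max_le (by linarith) hs)

theorem clip_nonneg {t δ s : ℝ} (hδ : 0 ≤ δ) : 0 ≤ clip t δ s :=
  le_min (le_max_right _ _) hδ

theorem clip_mul_clip {t δ s : ℝ} (hδ : 0 ≤ δ) :
    clip t δ s * clip (t + δ) δ s = δ * clip (t + δ) δ s := by
  unfold clip
  rcases le_total (s - (t + δ)) 0 with h | h
  · rw [max_eq_right h, min_eq_left hδ]; ring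
  · rw [min_eq_right (le_max_of_le_left (by linarith : δ ≤ s - t))]

theorem clip_bounds {y : Op H} (hy : 0 ≤ y) {δ : ℝ} (hδ : 0 < δ) (t : ℝ) :
    0 ≤ cfc (clip t δ) y ∧
    cfc (clip t δ) y ≤ δ • clProj (LinearMap.range ((cfc (clip t δ) y : Op H) : H →ₗ[ℂ] H)) ∧
    δ • clProj (LinearMap.range ((cfc (clip (t + δ) δ) y : Op H) : H →ₗ[ℂ] H)) ≤
      cfc (clip t δ) y := by
  have hsa : IsSelfAdjoint y := IsSelfAdjoint.of_nonneg hy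
  have h0 : 0 ≤ cfc (clip t δ) y := cfc_nonneg fun s _ => clip_nonneg hδ.le
  have hcs : star (cfc (clip t δ) y) = cfc (clip t δ) y := (IsSelfAdjoint.of_nonneg h0).star_eq
  refine ⟨h0, ?_, ?_⟩
  · set c := cfc (clip t δ) y with hc
    set e := clProj (LinearMap.range (c : H →ₗ[ℂ] H)) with he
    have h1 : c ≤ δ • (1 : Op H) := by
      rw [← Algebra.algebraMap_eq_smul_one, ← cfc_const δ y hsa]
      exact cfc_mono (fun s _ => min_le_right _ _) (continuous_clip t δ).continuousOn
        continuousOn_const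
    have h2 : e * c = c := clProj_range_mul c
    have h3 : c * e = c := by
      have := congrArg star h2
      rwa [star_mul, hcs, star_clProj] at this
    have := star_left_conjugate_le_conjugate h1 e
    rwa [star_clProj, h2, h3, mul_smul_comm, mul_one, smul_mul_assoc, clProj_mul_self] at this
  · set c := cfc (clip t δ) y with hc
    set d := cfc (clip (t + δ) δ) y with hd
    set e := clProj (LinearMap.range (d : H →ₗ[ℂ] H)) with he
    have h1 : c * d = δ • d := by
      rw [hc, hd, ← cfc_mul (clip t δ) (clip (t + δ) δ) y (continuous_clip _ _).continuousOn
        (continuous_clip _ _).continuousOn, ← cfc_smul δ (clip (t + δ) δ) y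
        (continuous_clip _ _).continuousOn]
      exact cfc_congr fun s _ => clip_mul_clip hδ.le
    have h2 : c * e = δ • e := by
      ext v
      refine eq_on_closure (f := c) (g := fun w => δ • w) c.continuous (by fun_prop) ?_
        (clProj_mem_closure _ v)
      rintro _ ⟨w, rfl⟩
      exact congrArg (fun z : Op H => z w) h1
    have h3 : e * c = δ • e := by
      have := congrArg star h2
      rwa [star_mul, hcs, star_clProj, star_smul, star_clProj, star_trivial] at this
    have h4 : c - δ • e = star (1 - e) * c * (1 - e) := by
      simp only [star_sub, star_one, he, star_clProj]
      rw [← he, sub_mul, one_mul, h3, mul_sub, mul_one, sub_mul, h2, smul_mul_assoc,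
        clProj_mul_self]
      abel
    rw [← sub_nonneg, h4]
    exact star_left_conjugate_nonneg h0 _

/-- If a positive functional is dominated by a vector functional on the projections below `q`,
then it is dominated on all positive elements supported by `q`. -/
theorem IsPLF.le_of_proj_le {M : VonNeumannAlgebra H} {φ : Op H → ℂ} (h : IsPLF M φ) {q : Op H}
    (hq : IsProjIn (M : Set (Op H)) q) {ξ : H}
    (hlt : ∀ r, IsProjIn (M : Set (Op H)) r → q * r = r → (φ r).re ≤ ‖r ξ‖ ^ 2)
    {y : Op H} (hy : y ∈ M) (hy0 : 0 ≤ y) (hyq : y * q = y) :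
    (φ y).re ≤ (⟪ξ, y ξ⟫_ℂ).re := by
  have key : ∀ δ : ℝ, 0 < δ → (φ y).re ≤ (⟪ξ, y ξ⟫_ℂ).re + δ * ‖ξ‖ ^ 2 := by
    intro δ hδ
    have hsa : IsSelfAdjoint y := IsSelfAdjoint.of_nonneg hy0
    have hspec : ∀ s ∈ spectrum ℝ y, 0 ≤ s := fun s hs => spectrum_nonneg_of_nonneg hy0 hs
    obtain ⟨n, hn⟩ := exists_nat_ge (‖y‖ / δ)
    set c : ℕ → Op H := fun k => cfc (clip (k * δ) δ) y with hc
    set e : ℕ → Op H := fun k => clProj (LinearMap.range (c k : H →ₗ[ℂ] H)) with he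
    have hcM : ∀ k, c k ∈ M := fun k => cfc_memV hy _
    have heP : ∀ k, IsProjIn (M : Set (Op H)) (e k) := fun k => isProjIn_range (hcM k)
    have hcb := fun k : ℕ => clip_bounds hy0 hδ (k * δ)
    have hsum : ∑ k ∈ Finset.range (n + 1), c k = y := by
      rw [hc, ← cfc_sum _ _ _ (fun i _ => (continuous_clip _ _).continuousOn)]
      conv_rhs => rw [← cfc_id ℝ y]
      refine cfc_congr fun s hs => ?_
      have hs' : s ≤ ((n + 1 : ℕ) : ℝ) * δ := by
        have h1 : |s| ≤ ‖y‖ := by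
          refine (spectrum.norm_le_norm_mul_of_mem hs).trans ?_
          exact mul_le_of_le_one_right (norm_nonneg _) ContinuousLinearMap.norm_id_le
        have h2 : ‖y‖ ≤ n * δ := by rwa [div_le_iff₀ hδ] at hn
        push_cast
        nlinarith [le_abs_self s]
      simp only [Finset.sum_apply]
      rw [sum_clip hδ.le (hspec s hs), min_eq_left hs']; rfl
    have hqe : ∀ k, q * e k = e k := by
      intro k
      have hle : c k ≤ y := by
        conv_rhs => rw [← cfc_id ℝ y]
        exact cfc_mono (fun s hs => clip_le_self (by positivity) (hspec s hs))
          (continuous_clip _ _).continuousOn continuousOn_id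
      have h1 : c k * (1 - q) = 0 :=
        mul_eq_zero_of_le (hcb k).1 hle (by rw [mul_sub, hyq, mul_one, sub_self])
      have h2 : c k * star q = c k := by
        rw [hq.2.1, ← sub_eq_zero, ← neg_eq_zero, ← h1, mul_sub, mul_one, neg_sub]
      have h3 : q * c k = c k := by
        have := congrArg star h2
        rwa [star_mul, star_star, (IsSelfAdjoint.of_nonneg (hcb k).1).star_eq] at this
      refine clProj_le_of_fix ?_
      rintro _ ⟨w, rfl⟩
      exact congrArg (fun z : Op H => z w) h3
    have h1 : ∀ k, (φ (c k)).re ≤ δ * ‖e k ξ‖ ^ 2 := by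
      intro k
      have := h.mono (hcM k) (smul_memV (δ : ℂ) (heP k).1) (hcb k).2.1
      rw [h.map_smul _ _ (heP k).1] at this
      have := (Complex.le_def.1 this).1
      rw [Complex.re_ofReal_mul] at this
      exact this.trans (mul_le_mul_of_nonneg_left (hlt _ (heP k) (hqe k)) hδ.le)
    have h2 : ∀ k : ℕ, δ * ‖e (k + 1) ξ‖ ^ 2 ≤ (⟪ξ, c k ξ⟫_ℂ).re := by
      intro k
      have := re_inner_mono (hcb k).2.2 ξ
      rw [show (k : ℝ) * δ + δ = ((k + 1 : ℕ) : ℝ) * δ by push_cast; ring] at this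
      refine le_trans (le_of_eq ?_) this
      change _ = (⟪ξ, ((δ : ℝ) : ℂ) • e (k + 1) ξ⟫_ℂ).re
      rw [inner_smul_right, (heP (k + 1)).norm_sq ξ]
      norm_cast
    have h3 : ‖e 0 ξ‖ ^ 2 ≤ ‖ξ‖ ^ 2 := by
      gcongr
      simpa using (e 0).le_of_opNorm_le (norm_clProj_le _) ξ
    have h4 : (⟪ξ, y ξ⟫_ℂ).re = ∑ k ∈ Finset.range (n + 1), (⟪ξ, c k ξ⟫_ℂ).re := by
      conv_lhs => rw [← hsum]
      rw [sum_apply, inner_sum, Complex.re_sum]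
    calc (φ y).re = ∑ k ∈ Finset.range (n + 1), (φ (c k)).re := by
          conv_lhs => rw [← hsum]
          rw [h.map_sum _ fun i _ => hcM i, Complex.re_sum]
      _ ≤ ∑ k ∈ Finset.range (n + 1), δ * ‖e k ξ‖ ^ 2 := Finset.sum_le_sum fun k _ => h1 k
      _ = ∑ k ∈ Finset.range n, δ * ‖e (k + 1) ξ‖ ^ 2 + δ * ‖e 0 ξ‖ ^ 2 :=
          Finset.sum_range_succ' _ _
      _ ≤ ∑ k ∈ Finset.range n, (⟪ξ, c k ξ⟫_ℂ).re + δ * ‖ξ‖ ^ 2 :=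
          add_le_add (Finset.sum_le_sum fun k _ => h2 k) (by gcongr)
      _ ≤ _ := by
          rw [h4, Finset.sum_range_succ]
          linarith [re_inner_nonneg (hcb n).1 ξ]
  have : Filter.Tendsto (fun δ : ℝ => (⟪ξ, y ξ⟫_ℂ).re + δ * ‖ξ‖ ^ 2) (nhdsWithin 0 (Set.Ioi 0))
      (nhds (⟪ξ, y ξ⟫_ℂ).re) := by
    have : Continuous fun δ : ℝ => (⟪ξ, y ξ⟫_ℂ).re + δ * ‖ξ‖ ^ 2 := by fun_prop
    simpa using (this.tendsto 0).mono_left nhdsWithin_le_nhds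
  exact ge_of_tendsto this (Filter.eventually_of_mem self_mem_nhdsWithin key)

end Spectral

section Dominate
variable {M : VonNeumannAlgebra H} {φ : Op H → ℂ}

/-- `φ` is dominated by the vector functional of `ξ` on positive elements supported by `q`. -/
def DominatedOn (M : VonNeumannAlgebra H) (φ : Op H → ℂ) (q : Op H) (ξ : H) : Prop :=
  ∀ y ∈ M, 0 ≤ y → y * q = y → (φ y).re ≤ (⟪ξ, y ξ⟫_ℂ).re

theorem IsNormalPLF.exists_dominatedOn (h : IsNormalPLF M φ) {p : Op H}
    (hp : IsProjIn (M : Set (Op H)) p) (hp0 : p ≠ 0) :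
    ∃ q ξ, IsProjIn (M : Set (Op H)) q ∧ q ≠ 0 ∧ p * q = q ∧ DominatedOn M φ q ξ := by
  obtain ⟨w, hw⟩ : ∃ w, p w ≠ 0 := by
    by_contra! hc
    exact hp0 (ContinuousLinearMap.ext hc)
  obtain ⟨ξ, hξ⟩ : ∃ ξ, (φ p).re < ‖p ξ‖ ^ 2 := by
    have hpos : 0 < ‖p w‖ := norm_pos_iff.2 hw
    obtain ⟨n, hn⟩ := exists_nat_gt ((φ p).re / ‖p w‖ ^ 2)
    refine ⟨((n + 1 : ℕ) : ℂ) • w, ?_⟩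
    rw [map_smul, norm_smul, Complex.norm_natCast, mul_pow]
    rw [div_lt_iff₀ (by positivity)] at hn
    refine hn.trans_le (mul_le_mul_of_nonneg_right ?_ (by positivity))
    push_cast
    nlinarith [(n.cast_nonneg : (0 : ℝ) ≤ n)]
  obtain ⟨S, hSQ, hSo, hSm⟩ := exists_maximal_orthogonal fun r : Op H =>
    IsProjIn (M : Set (Op H)) r ∧ r ≠ 0 ∧ p * r = r ∧ ‖r ξ‖ ^ 2 ≤ (φ r).re
  have hpr : ∀ i : S, IsProjIn (M : Set (Op H)) i.1 := fun i => (hSQ _ i.2).1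
  have hor : Pairwise fun i j : S => i.1 * j.1 = 0 := fun i j hij =>
    hSo i.2 j.2 fun hh => hij (Subtype.ext hh)
  obtain ⟨s, hs, hsum, hle, hun⟩ := exists_sum_proj hpr hor
  have hps : p * s = s := hun p fun i => (hSQ _ i.2).2.2.1
  have hsξ : ‖s ξ‖ ^ 2 ≤ (φ s).re := by
    have h1 := Complex.hasSum_re (h.normal S _ s hpr hs hor hsum)
    have h2 := Complex.hasSum_re ((hsum ξ).mapL (innerSL ℂ ξ))
    simp only [innerSL_apply_apply] at h2
    rw [hs.norm_sq] at h2
    refine hasSum_le (fun i => ?_) h2 h1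
    rw [(hpr i).norm_sq]
    exact (hSQ _ i.2).2.2.2
  have hq : IsProjIn (M : Set (Op H)) (p - s) := hp.sub hs hps
  have hpq : p * (p - s) = p - s := by rw [mul_sub, hp.2.2, hps]
  refine ⟨p - s, ξ, hq, ?_, hpq, ?_⟩
  · intro h0
    rw [sub_eq_zero] at h0
    rw [h0] at hξ
    exact absurd hsξ hξ.not_ge
  · intro y hy hy0 hyq
    refine h.toIsPLF.le_of_proj_le hq (fun r hr hqr => ?_) hy hy0 hyq
    by_contra! hlt
    have hr0 : r ≠ 0 := by
      rintro rfl
      rw [h.toIsPLF.map_zero] at hlt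
      simp at hlt
    have hmem : r ∈ S := by
      refine hSm r ⟨hr, hr0, ?_, hlt.le⟩ fun r' hr' => ?_
      · rw [← hqr, ← mul_assoc, hpq]
      · have h1 : r' * p = r' := hp.le_comm (hSQ _ hr').1 (hSQ _ hr').2.2.1
        have h2 : r' * s = r' := hs.le_comm (hSQ _ hr').1 (hle ⟨r', hr'⟩)
        have h3 : r' * r = 0 := by
          rw [← hqr, ← mul_assoc, mul_sub, h1, h2, sub_self, zero_mul]
        exact ⟨(hSQ _ hr').1.mul_comm_zero hr h3, h3⟩
    have h1 : s * r = r := hle ⟨r, hmem⟩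
    have h2 : p * r = r := (hSQ _ hmem).2.2.1
    rw [sub_mul, h1, h2, sub_self] at hqr
    exact hr0 hqr.symm

theorem IsNormalPLF.exists_dominating_partition (h : IsNormalPLF M φ) :
    ∃ S : Set (Op H), (∀ r ∈ S, IsProjIn (M : Set (Op H)) r) ∧
      S.Pairwise (fun r r' => r * r' = 0) ∧ (∀ ξ : H, HasSum (fun r : S => r.1 ξ) ξ) ∧
      ∀ r ∈ S, ∃ ξ, DominatedOn M φ r ξ := by
  obtain ⟨S, hSQ, hSo, hSm⟩ := exists_maximal_orthogonal fun r : Op H =>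
    IsProjIn (M : Set (Op H)) r ∧ r ≠ 0 ∧ ∃ ξ, DominatedOn M φ r ξ
  have hpr : ∀ i : S, IsProjIn (M : Set (Op H)) i.1 := fun i => (hSQ _ i.2).1
  have hor : Pairwise fun i j : S => i.1 * j.1 = 0 := fun i j hij =>
    hSo i.2 j.2 fun hh => hij (Subtype.ext hh)
  obtain ⟨s, hs, hsum, hle, -⟩ := exists_sum_proj hpr hor
  have hs1 : s = 1 := by
    by_contra hne
    obtain ⟨q, ξ, hq, hq0, hpq, hd⟩ := h.exists_dominatedOn hs.one_sub
      (sub_ne_zero.2 (Ne.symm hne))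
    have hz : ∀ r' ∈ S, r' * q = 0 := fun r' hr' => by
      rw [← hpq, ← mul_assoc, mul_sub, mul_one, hs.le_comm (hSQ _ hr').1 (hle ⟨r', hr'⟩),
        sub_self, zero_mul]
    have := hSm q ⟨hq, hq0, ξ, hd⟩ fun r' hr' =>
      ⟨(hSQ _ hr').1.mul_comm_zero hq (hz r' hr'), hz r' hr'⟩
    exact hq0 (by rw [← hq.2.2, hz q this])
  subst hs1
  exact ⟨S, fun r hr => (hSQ r hr).1, hSo, hsum, fun r hr => (hSQ r hr).2.2⟩

end Dominate

section Riesz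
variable {V : Type*} [AddCommGroup V] [Module ℂ V]

/-- Extension of a linear map controlled by `L` to a bounded operator vanishing on the orthogonal
complement of the range of `L`. -/
theorem exists_extension {F : Type*} [NormedAddCommGroup F] [NormedSpace ℂ F] [CompleteSpace F]
    (L : V →ₗ[ℂ] H) (J₀ : V →ₗ[ℂ] F) {C : ℝ} (hC : 0 ≤ C) (h : ∀ y, ‖J₀ y‖ ≤ C * ‖L y‖) :
    ∃ J : H →L[ℂ] F, (∀ y, J (L y) = J₀ y) ∧ (∀ v, J (clProj (LinearMap.range L) v) = J v) ∧
      ∀ v, ‖J v‖ ≤ C * ‖v‖ := by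
  set U := (LinearMap.range L).topologicalClosure with hU
  set e : V →ₗ[ℂ] U := L.codRestrict U fun y =>
    (LinearMap.range L).le_topologicalClosure ⟨y, rfl⟩ with he
  have hd : DenseRange e := by
    intro u
    rw [closure_subtype]
    have : (Subtype.val '' Set.range e : Set H) = (LinearMap.range L : Set H) := by
      ext v; simp [he]
    rw [this]
    exact u.2
  refine ⟨(J₀.extendOfNorm e).comp U.orthogonalProjectionOnto, fun y => ?_, fun v => ?_, fun v => ?_⟩
  · have : U.orthogonalProjectionOnto (L y) = e y :=
      Submodule.orthogonalProjectionOnto_mem_subspace_eq_self (K := U) (e y)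
    rw [ContinuousLinearMap.comp_apply, this]
    exact LinearMap.extendOfNorm_eq hd ⟨C, h⟩ y
  · have : U.orthogonalProjectionOnto (clProj (LinearMap.range L) v) = U.orthogonalProjectionOnto v :=
      Submodule.orthogonalProjectionOnto_mem_subspace_eq_self (K := U) (U.orthogonalProjectionOnto v)
    rw [ContinuousLinearMap.comp_apply, this, ContinuousLinearMap.comp_apply]
  · refine (LinearMap.norm_extendOfNorm_apply_le hd C h _).trans ?_
    exact mul_le_mul_of_nonneg_left (Submodule.norm_orthogonalProjectionOnto_apply_le U v) hC

/-- A bounded functional on the range of `L` is represented by a vector. -/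
theorem exists_rep (L : V →ₗ[ℂ] H) (ℓ : V →ₗ[ℂ] ℂ) {C : ℝ} (hC : 0 ≤ C)
    (h : ∀ y, ‖ℓ y‖ ≤ C * ‖L y‖) :
    ∃ t : H, (∀ y, ⟪t, L y⟫_ℂ = ℓ y) ∧ clProj (LinearMap.range L) t = t ∧ ‖t‖ ≤ C := by
  obtain ⟨J, hJ, hJp, hJC⟩ := exists_extension L ℓ hC h
  refine ⟨(InnerProductSpace.toDual ℂ H).symm J, fun y => ?_, ?_, ?_⟩
  · rw [InnerProductSpace.toDual_symm_apply, hJ]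
  · refine ext_inner_right ℂ fun v => ?_
    rw [inner_clProj, InnerProductSpace.toDual_symm_apply, InnerProductSpace.toDual_symm_apply, hJp]
  · rw [LinearIsometryEquiv.norm_map]
    exact J.opNorm_le_bound hC hJC

theorem ext_of_clProj {L : V →ₗ[ℂ] H} {s t : H} (hs : clProj (LinearMap.range L) s = s)
    (ht : clProj (LinearMap.range L) t = t) (h : ∀ y, ⟪s, L y⟫_ℂ = ⟪t, L y⟫_ℂ) : s = t := by
  refine ext_inner_right ℂ fun v => ?_
  rw [← hs, ← ht, inner_clProj, inner_clProj]
  refine eq_on_closure (f := fun v => ⟪s, v⟫_ℂ) (g := fun v => ⟪t, v⟫_ℂ) (by fun_prop)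
    (by fun_prop) ?_ (clProj_mem_closure (LinearMap.range L) v)
  rintro _ ⟨y, rfl⟩
  exact h y

/-- A bounded sesquilinear form on the range of `L` is represented by an operator. -/
theorem exists_sesq_rep (L : V →ₗ[ℂ] H) (B : V → V → ℂ)
    (hadd : ∀ x y z, B x (y + z) = B x y + B x z) (hsmul : ∀ x (c : ℂ) y, B x (c • y) = c * B x y)
    (hadd' : ∀ x y z, B (x + y) z = B x z + B y z)
    (hsmul' : ∀ x (c : ℂ) y, B (c • x) y = conj c * B x y)
    {C : ℝ} (hC : 0 ≤ C) (h : ∀ x y, ‖B x y‖ ≤ C * ‖L x‖ * ‖L y‖) :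
    ∃ T : Op H, (∀ x y, ⟪T (L x), L y⟫_ℂ = B x y) ∧ T * clProj (LinearMap.range L) = T ∧
      clProj (LinearMap.range L) * T = T := by
  have := fun x => exists_rep L (⟨⟨B x, hadd x⟩, fun c y => hsmul x c y⟩ : V →ₗ[ℂ] ℂ)
    (C := C * ‖L x‖) (by positivity) (h x)
  choose t ht htp htC using this
  have ht' : ∀ x y, ⟪t x, L y⟫_ℂ = B x y := ht
  set J₀ : V →ₗ[ℂ] H :=
    { toFun := t
      map_add' := fun x y => ext_of_clProj (htp _) (by rw [map_add, htp, htp]) fun z => by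
        rw [ht', hadd', inner_add_left, ht', ht']
      map_smul' := fun c x => ext_of_clProj (htp _) (by simp [htp]) fun z => by
        rw [ht', hsmul', RingHom.id_apply, inner_smul_left, ht'] }
  obtain ⟨T, hT, hTp, -⟩ := exists_extension L J₀ hC htC
  refine ⟨T, fun x y => by rw [hT]; exact ht' x y, ContinuousLinearMap.ext hTp, ?_⟩
  ext v
  have h1 : clProj (LinearMap.range L) (T (clProj (LinearMap.range L) v)) =
      T (clProj (LinearMap.range L) v) := by
    refine eq_on_closure (f := fun w => clProj (LinearMap.range L) (T w)) (g := T) (by fun_prop)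
      (by fun_prop) ?_ (clProj_mem_closure (LinearMap.range L) v)
    rintro _ ⟨y, rfl⟩
    rw [hT]; exact htp y
  rw [hTp] at h1
  exact h1

/-- An operator supported on the closed range of `L` is determined by its form on the range. -/
theorem op_ext_of_range {L : V →ₗ[ℂ] H} {S T : Op H} (hS : S * clProj (LinearMap.range L) = S)
    (hT : T * clProj (LinearMap.range L) = T) (hS' : clProj (LinearMap.range L) * S = S)
    (hT' : clProj (LinearMap.range L) * T = T)
    (h : ∀ x y, ⟪S (L x), L y⟫_ℂ = ⟪T (L x), L y⟫_ℂ) : S = T := by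
  rw [← hS, ← hT]
  ext v
  refine eq_on_closure (f := S) (g := T) (by fun_prop) (by fun_prop) ?_
    (clProj_mem_closure (LinearMap.range L) v)
  rintro _ ⟨x, rfl⟩
  refine ext_of_clProj (congrArg (fun z : Op H => z (L x)) hS')
    (congrArg (fun z : Op H => z (L x)) hT') (h x)

/-- Positivity of an operator supported on the closed range of `L`. -/
theorem nonneg_of_range {L : V →ₗ[ℂ] H} {T : Op H} (hT : T * clProj (LinearMap.range L) = T)
    (hT' : clProj (LinearMap.range L) * T = T)
    (h : ∀ x, 0 ≤ ⟪T (L x), L x⟫_ℂ) : 0 ≤ T := by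
  have key : ∀ v, 0 ≤ ⟪T v, v⟫_ℂ := by
    intro v
    have h1 : ⟪T v, v⟫_ℂ = ⟪T (clProj (LinearMap.range L) v), clProj (LinearMap.range L) v⟫_ℂ := by
      rw [← inner_clProj, ← mul_app, ← mul_app, hT', hT]
    rw [h1]
    have h2 : closure (LinearMap.range L : Set H) ⊆ {w | 0 ≤ ⟪T w, w⟫_ℂ} := by
      refine closure_minimal ?_ (isClosed_le continuous_const (by fun_prop))
      rintro _ ⟨y, rfl⟩
      exact h y
    exact h2 (clProj_mem_closure (LinearMap.range L) v)
  rw [ContinuousLinearMap.nonneg_iff_isPositive]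
  exact ContinuousLinearMap.isPositive_iff_complex T |>.2 fun v => by
    have := Complex.le_def.1 (key v)
    exact ⟨Complex.ext (by simp) (by simpa using this.2), by simpa using this.1⟩

end Riesz

section Radon
variable {K : Type} [NormedAddCommGroup K] [InnerProductSpace ℂ K] [CompleteSpace K]

/-- The orbit map `x ↦ π(x) η` on a von Neumann algebra. -/
noncomputable def orbit (M : VonNeumannAlgebra H) (π : Op H →⋆ₐ[ℂ] Op K) (η : K) :
    M.toStarSubalgebra →ₗ[ℂ] K where
  toFun x := π x η
  map_add' x y := by simp
  map_smul' c x := by simp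

theorem orbit_apply (M : VonNeumannAlgebra H) (π : Op H →⋆ₐ[ℂ] Op K) (η : K)
    (x : M.toStarSubalgebra) : orbit M π η x = π x η := rfl

theorem orbit_range_invariant (M : VonNeumannAlgebra H) (π : Op H →⋆ₐ[ℂ] Op K) (η : K) {a : Op H}
    (ha : a ∈ M) : ∀ u ∈ LinearMap.range (orbit M π η), π a u ∈ LinearMap.range (orbit M π η) := by
  rintro _ ⟨x, rfl⟩
  refine ⟨⟨a, ha⟩ * x, ?_⟩
  simp [orbit_apply]

theorem orbit_clProj_commute (M : VonNeumannAlgebra H) (π : Op H →⋆ₐ[ℂ] Op K) (η : K) {a : Op H}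
    (ha : a ∈ M) : π a * clProj (LinearMap.range (orbit M π η)) =
      clProj (LinearMap.range (orbit M π η)) * π a := by
  refine clProj_commute (orbit_range_invariant M π η ha) ?_
  rw [← map_star]
  exact orbit_range_invariant M π η (star_mem ha)

/-- A positive functional dominated by a vector functional of a representation is itself a vector
functional of this representation. -/
theorem IsPLF.exists_vector {M : VonNeumannAlgebra H} {φ : Op H → ℂ} (h : IsPLF M φ)
    (π : Op H →⋆ₐ[ℂ] Op K) (η : K) (hd : ∀ x ∈ M, (φ (star x * x)).re ≤ ‖π x η‖ ^ 2) :
    ∃ ζ : K, ∀ x ∈ M, φ x = ⟪ζ, π x ζ⟫_ℂ := by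
  set L := orbit M π η with hL
  have hsx : ∀ x y : M.toStarSubalgebra, star (x : Op H) * y ∈ M := fun x y =>
    mul_mem (star_mem x.2) y.2
  obtain ⟨T, hT, hTP, hPT⟩ := exists_sesq_rep L (fun x y => φ (star (x : Op H) * y))
    (fun x y z => by
      push_cast; rw [mul_add, h.map_add _ (hsx x y) _ (hsx x z)])
    (fun x c y => by
      change φ (star (x : Op H) * (c • (y : Op H))) = _
      rw [mul_smul_comm, h.map_smul _ _ (hsx x y)])
    (fun x y z => by
      push_cast; rw [star_add, add_mul, h.map_add _ (hsx x z) _ (hsx y z)])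
    (fun x c y => by
      change φ (star (c • (x : Op H)) * (y : Op H)) = _
      rw [star_smul, smul_mul_assoc, h.map_smul _ _ (hsx x y)]; rfl)
    (C := 1) zero_le_one (fun x y => by
      rw [one_mul]
      have h1 := h.cauchy_schwarz x.2 y.2
      have h2 := hd _ x.2
      have h3 := hd _ y.2
      have h4 := h.re_nonneg y.2
      refine abs_le_of_sq_le_sq' ?_ (by positivity) |>.2
      rw [mul_pow]
      exact h1.trans (mul_le_mul h2 h3 h4 (by positivity)))
  have hcomm : ∀ a ∈ M, Commute T (π a) := by
    intro a ha
    have hc := orbit_clProj_commute M π η ha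
    rw [← hL] at hc
    refine op_ext_of_range (L := L) ?_ ?_ ?_ ?_ ?_
    · rw [mul_assoc, hc, ← mul_assoc, hTP]
    · rw [mul_assoc, hTP]
    · rw [← mul_assoc, hPT]
    · rw [← mul_assoc, ← hc, mul_assoc, hPT]
    · intro x y
      have e1 : π a (L x) = L (⟨a, ha⟩ * x) := by simp [hL, orbit_apply]
      have e2 : π (star a) (L y) = L (⟨star a, star_mem ha⟩ * y) := by
        simp [hL, orbit_apply]
      rw [mul_app, e1, hT, mul_app]
      have : π a = star (π (star a)) := by rw [← StarHomClass.map_star π, star_star]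
      rw [this, inner_star_left, e2, hT]
      simp [mul_assoc]
  have hT0 : 0 ≤ T := nonneg_of_range hTP hPT fun x => by rw [hT]; exact h.pos _ x.2
  have hS := CFC.sqrt_mul_sqrt_self T hT0
  have hSs : star (CFC.sqrt T) = CFC.sqrt T :=
    (IsSelfAdjoint.of_nonneg (CFC.sqrt_nonneg T)).star_eq
  refine ⟨CFC.sqrt T η, fun x hx => ?_⟩
  have h1 : Commute (CFC.sqrt T) (π x) := Commute.cfcₙ_nnreal (hcomm x hx) _
  rw [← mul_app, ← h1.eq, mul_app]
  have h2 : ⟪CFC.sqrt T η, CFC.sqrt T (π x η)⟫_ℂ = ⟪T η, π x η⟫_ℂ := by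
    rw [← inner_star_left, hSs, ← mul_app, hS]
  rw [h2]
  have e1 : η = L 1 := by simp [hL, orbit_apply]
  have e2 : π x η = L ⟨x, hx⟩ := rfl
  rw [e2]
  conv_rhs => rw [e1]
  rw [hT]
  simp

end Radon

section Amplification

/-- The `ι`-fold Hilbert space direct sum of `H`. -/
abbrev Amp (ι : Type) (H : Type) [NormedAddCommGroup H] [InnerProductSpace ℂ H]
    [CompleteSpace H] : Type := lp (fun _ : ι => H) 2

variable {ι : Type}

theorem Amp.hasSum_norm_sq (ξ : Amp ι H) : HasSum (fun i => ‖ξ i‖ ^ 2) (‖ξ‖ ^ 2) := by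
  have := Complex.hasSum_re (lp.hasSum_inner (𝕜 := ℂ) ξ ξ)
  simp only [inner_self_eq_norm_sq_to_K] at this
  convert this using 1
  · ext i; norm_cast
  · norm_cast

omit [InnerProductSpace ℂ H] [CompleteSpace H] in
theorem memℓp_two {f : ι → H} (hf : Summable fun i => ‖f i‖ ^ 2) : Memℓp f 2 :=
  memℓp_gen (by simpa using hf)

theorem Amp.norm_le {ξ : Amp ι H} {C : ℝ} (hC : 0 ≤ C) (h : ∀ s : Finset ι, ∑ i ∈ s, ‖ξ i‖ ^ 2 ≤ C ^ 2) :
    ‖ξ‖ ≤ C :=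
  abs_le_of_sq_le_sq' (hasSum_le_of_sum_le ξ.hasSum_norm_sq h) hC |>.2

theorem norm_sq_apply_le (f : Op H) (v : H) : ‖f v‖ ^ 2 ≤ ‖f‖ ^ 2 * ‖v‖ ^ 2 := by
  rw [← mul_pow]
  gcongr
  exact f.le_opNorm v

/-- The diagonal action of an operator on the direct sum. -/
noncomputable def ampOp (f : Op H) : Op (Amp ι H) :=
  LinearMap.mkContinuous
    { toFun := fun ξ => (⟨fun i => f (ξ i), memℓp_two <|
        Summable.of_nonneg_of_le (fun _ => by positivity) (fun i => norm_sq_apply_le f (ξ i))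
          (ξ.hasSum_norm_sq.summable.mul_left _)⟩ : lp (fun _ : ι => H) 2)
      map_add' := fun ξ η => lp.ext (funext fun i => map_add f (ξ i) (η i))
      map_smul' := fun c ξ => by ext i; simp } ‖f‖ fun ξ => by
    refine Amp.norm_le (by positivity) fun s => ?_
    rw [mul_pow]
    refine (Finset.sum_le_sum fun i _ => norm_sq_apply_le f (ξ i)).trans ?_
    rw [← Finset.mul_sum]
    gcongr
    exact sum_le_hasSum s (fun _ _ => by positivity) ξ.hasSum_norm_sq

theorem ampOp_apply (f : Op H) (ξ : Amp ι H) (i : ι) : ampOp f ξ i = f (ξ i) := rfl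

theorem amp_ext {x y : Op (Amp ι H)} (h : ∀ ξ i, x ξ i = y ξ i) : x = y :=
  ContinuousLinearMap.ext fun ξ => lp.ext (funext (h ξ))

/-- The amplification representation. -/
noncomputable def amp (ι : Type) : Op H →⋆ₐ[ℂ] Op (Amp ι H) where
  toFun := ampOp
  map_one' := amp_ext fun ξ i => rfl
  map_mul' f g := amp_ext fun ξ i => rfl
  map_zero' := amp_ext fun ξ i => rfl
  map_add' f g := amp_ext fun ξ i => rfl
  commutes' c := amp_ext fun ξ i => by
    simp [ampOp_apply, Algebra.algebraMap_eq_smul_one]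
  map_star' f := by
    ext1 ξ
    refine ext_inner_right ℂ fun η => ?_
    rw [inner_star_left, lp.inner_eq_tsum, lp.inner_eq_tsum]
    exact tsum_congr fun i => inner_star_left _ _ _

theorem amp_apply (f : Op H) (ξ : Amp ι H) (i : ι) : amp ι f ξ i = f (ξ i) := rfl

end Amplification

section VectorSum
variable {M : VonNeumannAlgebra H} {φ : Op H → ℂ}

theorem IsPLF.compress (h : IsPLF M φ) {a : Op H} (ha : a ∈ M) :
    IsPLF M fun x => φ (star a * x * a) := by
  have hm : ∀ x ∈ M, star a * x * a ∈ M := fun x hx => mul_mem (mul_mem (star_mem ha) hx) ha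
  refine ⟨fun x hx y hy => ?_, fun c x hx => ?_, fun x hx => ?_⟩
  · rw [mul_add, add_mul, h.map_add _ (hm x hx) _ (hm y hy)]
  · rw [mul_smul_comm, smul_mul_assoc, h.map_smul _ _ (hm x hx)]
  · have := h.pos (x * a) (mul_mem hx ha)
    rw [star_mul] at this
    simpa only [mul_assoc] using this

theorem IsPLF.add_sq (h : IsPLF M φ) {a b : Op H} (ha : a ∈ M) (hb : b ∈ M) :
    (φ (star (a + b) * (a + b))).re ≤ 2 * (φ (star a * a)).re + 2 * (φ (star b * b)).re := by
  have m1 : star (a + b) * (a + b) ∈ M := mul_mem (star_mem (add_mem ha hb)) (add_mem ha hb)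
  have m2 : star (a - b) * (a - b) ∈ M := mul_mem (star_mem (sub_mem ha hb)) (sub_mem ha hb)
  have m3 : star a * a ∈ M := mul_mem (star_mem ha) ha
  have m4 : star b * b ∈ M := mul_mem (star_mem hb) hb
  have h1 : star (a + b) * (a + b) + star (a - b) * (a - b) =
      (2 : ℂ) • (star a * a) + (2 : ℂ) • (star b * b) := by
    simp only [star_add, star_sub, two_smul]; noncomm_ring
  have h2 := congrArg (fun z => (φ z).re) h1
  rw [h.map_add _ m1 _ m2, h.map_add _ (smul_memV 2 m3) _ (smul_memV 2 m4), h.map_smul _ _ m3,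
    h.map_smul _ _ m4] at h2
  have h3 := h.re_nonneg (sub_mem ha hb)
  simp only [Complex.add_re, Complex.mul_re, Complex.re_ofNat, Complex.im_ofNat, zero_mul,
    sub_zero] at h2
  linarith

theorem IsPLF.sum_sq (h : IsPLF M φ) {ι : Type*} (F : Finset ι) {a : ι → Op H}
    (ha : ∀ i, a i ∈ M) :
    (φ (star (∑ i ∈ F, a i) * ∑ i ∈ F, a i)).re ≤
      2 ^ F.card * ∑ i ∈ F, (φ (star (a i) * a i)).re := by
  classical
  induction F using Finset.induction_on with
  | empty => simp [h.map_zero]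
  | insert i F hi ih =>
    rw [Finset.sum_insert hi, Finset.sum_insert hi, Finset.card_insert_of_notMem hi]
    refine (h.add_sq (ha i) (sum_mem fun j _ => ha j)).trans ?_
    have h1 : (1 : ℝ) ≤ 2 ^ F.card := one_le_pow₀ (by norm_num)
    have h2 := h.re_nonneg (ha i)
    rw [pow_succ]
    nlinarith

theorem DominatedOn.le {r ξ} (h : DominatedOn M φ r ξ) (hr : IsProjIn (M : Set (Op H)) r)
    {x : Op H} (hx : x ∈ M) : (φ (star (x * r) * (x * r))).re ≤ ‖x (r ξ)‖ ^ 2 := by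
  have m : x * r ∈ M := mul_mem hx hr.1
  have := h (star (x * r) * (x * r)) (mul_mem (star_mem m) m) (star_mul_self_nonneg _)
    (by rw [mul_assoc, mul_assoc x, hr.2.2])
  rwa [inner_star_mul_self, Complex.ofReal_re] at this

theorem IsPLF.exists_vector_block (h : IsPLF M φ) {ι : Type} {p : ι → Op H}
    (hp : ∀ i, IsProjIn (M : Set (Op H)) (p i)) {ξ : ι → H}
    (hd : ∀ i, DominatedOn M φ (p i) (ξ i)) (F : Finset ι) :
    ∃ ζ : Amp ι H, ∀ x ∈ M, φ (star (∑ i ∈ F, p i) * x * ∑ i ∈ F, p i) = ⟪ζ, amp ι x ζ⟫_ℂ := by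
  classical
  have hF : ∑ i ∈ F, p i ∈ M := sum_mem fun i _ => (hp i).1
  set c : ℝ := 2 ^ F.card
  have hc : 0 ≤ c := by positivity
  set η : Amp ι H := ⟨fun i => if i ∈ F then ((√c : ℝ) : ℂ) • p i (ξ i) else 0, memℓp_two <|
    summable_of_ne_finset_zero (s := F) fun i hi => by simp [hi]⟩ with hη
  refine (h.compress hF).exists_vector (amp ι) η fun x hx => ?_
  have h1 : star (∑ i ∈ F, p i) * (star x * x) * ∑ i ∈ F, p i =
      star (∑ i ∈ F, x * p i) * ∑ i ∈ F, x * p i := by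
    rw [← Finset.mul_sum, star_mul]; simp only [mul_assoc]
  change (φ _).re ≤ _
  rw [h1]
  refine (h.sum_sq F fun i => mul_mem hx (hp i).1).trans ?_
  refine le_trans ?_ (sum_le_hasSum F (fun _ _ => by positivity) (amp ι x η).hasSum_norm_sq)
  rw [Finset.mul_sum]
  refine Finset.sum_le_sum fun i hi => ?_
  have h2 : amp ι x η i = ((√c : ℝ) : ℂ) • x (p i (ξ i)) := by
    rw [amp_apply, hη]; simp [hi]
  rw [h2, norm_smul, mul_pow, Complex.norm_real, Real.norm_eq_abs, sq_abs, Real.sq_sqrt hc]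
  exact mul_le_mul_of_nonneg_left ((hd i).le (hp i) hx) hc

/-- Concatenation of a square-summable sequence of vectors. -/
theorem exists_flatten {ι : Type} (ζ : ℕ → Amp ι H) (hs : Summable fun k => ‖ζ k‖ ^ 2) :
    ∃ η : Amp (ℕ × ι) H, ∀ (x : Op H) (n : ℕ),
      ∑ k ∈ Finset.range n, ‖amp ι x (ζ k)‖ ^ 2 ≤ ‖amp (ℕ × ι) x η‖ ^ 2 := by
  have hsum : Summable fun z : ℕ × ι => ‖ζ z.1 z.2‖ ^ 2 := by
    refine (summable_prod_of_nonneg fun _ => by positivity).2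
      ⟨fun k => (ζ k).hasSum_norm_sq.summable, ?_⟩
    simpa only [(Amp.hasSum_norm_sq _).tsum_eq] using hs
  refine ⟨⟨fun z => ζ z.1 z.2, memℓp_two hsum⟩, fun x n => ?_⟩
  have := (amp (ℕ × ι) x ⟨fun z => ζ z.1 z.2, memℓp_two hsum⟩).hasSum_norm_sq.prod_fiberwise
    (g := fun k => ‖amp ι x (ζ k)‖ ^ 2) fun k => (amp ι x (ζ k)).hasSum_norm_sq
  exact sum_le_hasSum _ (fun _ _ => by positivity) this

/-- A normal positive functional is an infinite sum of vector functionals. -/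
theorem IsNormalPLF.exists_amp (h : IsNormalPLF M φ) :
    ∃ (ι : Type) (ζ : Amp ι H), ∀ x ∈ M, φ x = ⟪ζ, amp ι x ζ⟫_ℂ := by
  classical
  have hφ := h.toIsPLF
  obtain ⟨S, hS, hSo, hS1, hSd⟩ := h.exists_dominating_partition
  have hp : ∀ i : S, IsProjIn (M : Set (Op H)) i.1 := fun i => hS _ i.2
  have ho : Pairwise fun i j : S => i.1 * j.1 = 0 := fun i j hij =>
    hSo i.2 j.2 fun hh => hij (Subtype.ext hh)
  choose ξ hξ using fun i : S => hSd i.1 i.2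
  have hone : IsProjIn (M : Set (Op H)) 1 := ⟨one_mem M, star_one _, one_mul _⟩
  have hsum := Complex.hasSum_re (h.normal S (fun i => i.1) 1 hp hone ho hS1)
  have hG : ∀ k : ℕ, ∃ G : Finset S, ∀ G' ⊇ G,
      (φ 1).re - ∑ i ∈ G', (φ i.1).re ≤ (1 / 4) ^ (k + 1) := by
    intro k
    have := (Metric.tendsto_atTop.1 hsum ((1 / 4) ^ (k + 1)) (by positivity))
    obtain ⟨G, hG⟩ := this
    refine ⟨G, fun G' hG' => ?_⟩
    have := hG G' hG'
    rw [Real.dist_eq, abs_lt] at this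
    linarith [this.1]
  choose G' hG' using hG
  set G : ℕ → Finset S := fun k => (Finset.range k).biUnion G' with hGdef
  have hmono : ∀ k, G k ⊆ G (k + 1) := fun k =>
    Finset.biUnion_subset_biUnion_of_subset_left _ (Finset.range_subset_range.2 k.le_succ)
  set Q : ℕ → Op H := fun k => ∑ i ∈ G k, i.1 with hQ
  have hQp : ∀ k, IsProjIn (M : Set (Op H)) (Q k) := fun k => isProjIn_sum hp ho (G k)
  set C : ℝ := (φ 1).re + 1
  have h1re : 0 ≤ (φ 1).re := by simpa using hφ.re_nonneg (one_mem M)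
  have hC : 1 ≤ C := by simpa [C] using h1re
  have hQφ : ∀ k, (φ (1 - Q k)).re ≤ C * (1 / 4) ^ k := by
    intro k
    rw [hφ.map_sub (one_mem M) (hQp k).1, hQ, hφ.map_sum _ fun i _ => (hp i).1, Complex.sub_re,
      Complex.re_sum]
    rcases k with _ | k
    · simp [hGdef, C]
    · refine (hG' k _ ?_).trans (le_mul_of_one_le_left (by positivity) hC)
      exact Finset.subset_biUnion_of_mem G' (Finset.self_mem_range_succ k)
  set F : ℕ → Finset S := fun k => G (k + 1) \ G k with hF
  have hPQ : ∀ k, ∑ i ∈ F k, i.1 = Q (k + 1) - Q k := fun k =>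
    eq_sub_of_add_eq (Finset.sum_sdiff (hmono k))
  choose ζ hζ using fun k => hφ.exists_vector_block hp hξ (F k)
  have hPp : ∀ k, IsProjIn (M : Set (Op H)) (∑ i ∈ F k, i.1) := fun k => isProjIn_sum hp ho (F k)
  have hζn : ∀ k, ‖ζ k‖ ^ 2 ≤ C * (1 / 4) ^ k := by
    intro k
    have h1 := hζ k 1 (one_mem M)
    rw [map_one, one_apply_eq_self, mul_one, (hPp k).2.1, (hPp k).2.2, hPQ,
      inner_self_eq_norm_sq_to_K] at h1
    have h2 : ‖ζ k‖ ^ 2 = (φ (Q (k + 1) - Q k)).re := by rw [h1]; norm_cast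
    have h3 := hφ.re_nonneg (hQp (k + 1)).one_sub.1
    rw [(hQp (k + 1)).one_sub.2.1, (hQp (k + 1)).one_sub.2.2,
      show 1 - Q (k + 1) = (1 - Q k) - (Q (k + 1) - Q k) by abel,
      hφ.map_sub (hQp k).one_sub.1 (by rw [← hPQ]; exact (hPp k).1), Complex.sub_re] at h3
    linarith [hQφ k]
  set ζ' : ℕ → Amp S H := fun k => ((√(2 ^ (k + 1)) : ℝ) : ℂ) • ζ k with hζ'
  have hnorm : ∀ k (x : Op H), ‖amp S x (ζ' k)‖ ^ 2 = 2 ^ (k + 1) * ‖amp S x (ζ k)‖ ^ 2 := by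
    intro k x
    rw [hζ', map_smul, norm_smul, mul_pow, Complex.norm_real, Real.norm_eq_abs, sq_abs,
      Real.sq_sqrt (by positivity)]
  have hsummable : Summable fun k => ‖ζ' k‖ ^ 2 := by
    refine Summable.of_nonneg_of_le (fun _ => by positivity) (fun k => ?_)
      ((summable_geometric_of_lt_one (r := 1 / 2) (by norm_num) (by norm_num)).mul_left (2 * C))
    have := hnorm k 1
    rw [map_one] at this
    simp only [one_apply_eq_self] at this
    rw [this]
    calc (2 : ℝ) ^ (k + 1) * ‖ζ k‖ ^ 2 ≤ 2 ^ (k + 1) * (C * (1 / 4) ^ k) := by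
          gcongr; exact hζn k
      _ = 2 * C * (2 * (1 / 4)) ^ k := by rw [mul_pow]; ring
      _ = 2 * C * (1 / 2) ^ k := by norm_num
  obtain ⟨η, hη⟩ := exists_flatten ζ' hsummable
  refine ⟨ℕ × S, hφ.exists_vector (amp _) η fun x hx => ?_⟩
  have step : ∀ n : ℕ, (φ (star x * x)).re ≤ ∑ k ∈ Finset.range n, ‖amp S x (ζ' k)‖ ^ 2 +
      2 ^ n * (φ (star (x * (1 - Q n)) * (x * (1 - Q n)))).re := by
    intro n
    induction n with
    | zero => simp [hQ, hGdef]
    | succ n ih =>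
      refine ih.trans ?_
      rw [Finset.sum_range_succ, hnorm, add_assoc]
      refine add_le_add le_rfl ?_
      have e1 : x * (1 - Q n) = x * (Q (n + 1) - Q n) + x * (1 - Q (n + 1)) := by
        rw [← mul_add]; congr 1; abel
      have e2 := hφ.add_sq (mul_mem hx (hPp n).1) (mul_mem hx (hQp (n + 1)).one_sub.1)
      rw [hPQ, ← e1] at e2
      have e3 := hζ n (star x * x) (mul_mem (star_mem hx) hx)
      have e4 : star (x * (Q (n + 1) - Q n)) * (x * (Q (n + 1) - Q n)) =
          star (∑ i ∈ F n, i.1) * (star x * x) * ∑ i ∈ F n, i.1 := by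
        rw [hPQ, star_mul]; simp only [mul_assoc]
      rw [e4, e3, map_mul, StarHomClass.map_star, inner_star_mul_self, Complex.ofReal_re] at e2
      rw [pow_succ]
      nlinarith [pow_pos (two_pos (α := ℝ)) n]
  have tail : ∀ n : ℕ, (φ (star x * x)).re ≤ ‖amp _ x η‖ ^ 2 + ‖x‖ ^ 2 * C * (1 / 2) ^ n := by
    intro n
    refine (step n).trans (add_le_add (hη x n) ?_)
    have h1 := hφ.bound hx (hQp n).one_sub.1
    have h2 : star (x * (1 - Q n)) * (x * (1 - Q n)) = star (1 - Q n) * (star x * x) * (1 - Q n) := by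
      rw [star_mul]; simp only [mul_assoc]
    rw [(hQp n).one_sub.2.1, (hQp n).one_sub.2.2] at h1
    rw [h2, (hQp n).one_sub.2.1]
    calc (2 : ℝ) ^ n * _ ≤ 2 ^ n * (‖x‖ ^ 2 * (C * (1 / 4) ^ n)) := by
          gcongr; exact h1.trans (by gcongr; exact hQφ n)
      _ = ‖x‖ ^ 2 * C * (2 * (1 / 4)) ^ n := by rw [mul_pow]; ring
      _ = _ := by norm_num
  have lim : Filter.Tendsto (fun n : ℕ => ‖amp (ℕ × S) x η‖ ^ 2 + ‖x‖ ^ 2 * C * (1 / 2) ^ n)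
      Filter.atTop (nhds (‖amp (ℕ × S) x η‖ ^ 2 + ‖x‖ ^ 2 * C * 0)) :=
    ((tendsto_pow_atTop_nhds_zero_of_lt_one (r := (1 / 2 : ℝ)) (by norm_num)
      (by norm_num)).const_mul _).const_add _
  rw [mul_zero, add_zero] at lim
  exact ge_of_tendsto' lim tail

end VectorSum

section VectorForm
variable {M : VonNeumannAlgebra H} {F G : Op H → ℂ}

/-- `F` agrees on `M` with an ultraweakly continuous functional. -/
def WFOn (M : VonNeumannAlgebra H) (F : Op H → ℂ) : Prop :=
  ∃ (ι : Type) (ζ η : Amp ι H), ∀ f ∈ M, F f = ⟪ζ, amp ι f η⟫_ℂ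

theorem IsNormalPLF.wfOn (h : IsNormalPLF M F) : WFOn M F :=
  let ⟨ι, ζ, hζ⟩ := h.exists_amp
  ⟨ι, ζ, ζ, hζ⟩

/-- The concatenation of two square summable families. -/
noncomputable def Amp.sumElim {ι κ : Type} (ζ : Amp ι H) (η : Amp κ H) : Amp (ι ⊕ κ) H :=
  ⟨Sum.elim ζ η, memℓp_two (HasSum.sum (f := fun i => ‖Sum.elim (ζ : ι → H) η i‖ ^ 2)
    ζ.hasSum_norm_sq η.hasSum_norm_sq).summable⟩

theorem Amp.inner_sumElim {ι κ : Type} (ζ ζ' : Amp ι H) (η η' : Amp κ H) (f : Op H) :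
    ⟪ζ.sumElim η, amp _ f (ζ'.sumElim η')⟫_ℂ = ⟪ζ, amp _ f ζ'⟫_ℂ + ⟪η, amp _ f η'⟫_ℂ :=
  (lp.hasSum_inner (𝕜 := ℂ) (ζ.sumElim η) (amp _ f (ζ'.sumElim η'))).unique
    (HasSum.sum (lp.hasSum_inner (𝕜 := ℂ) ζ (amp _ f ζ'))
      (lp.hasSum_inner (𝕜 := ℂ) η (amp _ f η')))

theorem WFOn.add (hF : WFOn M F) (hG : WFOn M G) : WFOn M fun f => F f + G f := by
  obtain ⟨ι, ζ, η, h⟩ := hF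
  obtain ⟨κ, ζ', η', h'⟩ := hG
  exact ⟨ι ⊕ κ, ζ.sumElim ζ', η.sumElim η', fun f hf => by
    simp only [Amp.inner_sumElim, h f hf, h' f hf]⟩

theorem WFOn.smul (c : ℂ) (hF : WFOn M F) : WFOn M fun f => c * F f := by
  obtain ⟨ι, ζ, η, h⟩ := hF
  exact ⟨ι, ζ, c • η, fun f hf => by
    simp only [h f hf, map_smul, inner_smul_right]⟩

theorem WFOn.sub (hF : WFOn M F) (hG : WFOn M G) : WFOn M fun f => F f - G f := by
  obtain ⟨ι, ζ, η, h⟩ := hF.add (hG.smul (-1))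
  exact ⟨ι, ζ, η, fun f hf => by rw [← h f hf]; ring⟩

theorem WFOn.mul_mul (hF : WFOn M F) {a b : Op H} (ha : a ∈ M) (hb : b ∈ M) :
    WFOn M fun f => F (a * f * b) := by
  obtain ⟨ι, ζ, η, h⟩ := hF
  refine ⟨ι, amp ι (star a) ζ, amp ι b η, fun f hf => ?_⟩
  beta_reduce
  rw [h _ (mul_mem (mul_mem ha hf) hb), StarHomClass.map_star, inner_star_left]
  simp

theorem WFOn.mul_right (hF : WFOn M F) {b : Op H} (hb : b ∈ M) : WFOn M fun f => F (f * b) := by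
  simpa using hF.mul_mul (one_mem M) hb

theorem WFOn.mul_left (hF : WFOn M F) {a : Op H} (ha : a ∈ M) : WFOn M fun f => F (a * f) := by
  simpa using hF.mul_mul ha (one_mem M)

/-- The orbit of a vector of an amplification under a space of operators. -/
noncomputable def ampOrbit {ι : Type} (A : Submodule ℂ (Op H)) (η : Amp ι H) :
    A →ₗ[ℂ] Amp ι H where
  toFun a := amp ι a η
  map_add' a b := by simp
  map_smul' c a := by simp

/-- A form of von Neumann's density theorem. -/
theorem WFOn.eq_zero (hF : WFOn M F) (A : Submodule ℂ (Op H)) (hAM : ∀ a ∈ A, a ∈ M)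
    (h1 : 1 ∈ A) (hmul : ∀ a ∈ A, ∀ b ∈ A, a * b ∈ A) (hstar : ∀ a ∈ A, star a ∈ A)
    (h0 : ∀ a ∈ A, F a = 0) {f : Op H} (hf : f ∈ M)
    (hfA : f ∈ Set.centralizer (Set.centralizer (A : Set (Op H)))) : F f = 0 := by
  classical
  obtain ⟨ι, ζ, η, h⟩ := hF
  set U := LinearMap.range (ampOrbit A η) with hU
  have hinv : ∀ a ∈ A, ∀ u ∈ U, amp ι a u ∈ U := by
    rintro a ha _ ⟨b, rfl⟩
    exact ⟨⟨a * b, hmul a ha b b.2⟩, by simp [ampOrbit]⟩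
  have hc : ∀ a ∈ A, amp ι a * clProj U = clProj U * amp ι a := fun a ha =>
    clProj_commute (hinv a ha) fun u hu => by
      rw [← StarHomClass.map_star]; exact hinv _ (hstar a ha) u hu
  have hent : ∀ i j v, f (clProj U (lp.single 2 j v) i) = clProj U (lp.single 2 j (f v)) i := by
    intro i j
    set Q : Op H := (lp.evalCLM ℂ (fun _ : ι => H) 2 i) ∘L (clProj U) ∘L
      (lp.singleContinuousLinearMap ℂ (fun _ : ι => H) 2 j) with hQ
    have hQa : ∀ v, Q v = clProj U (lp.single 2 j v) i := fun v => rfl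
    have hsing : ∀ (a : Op H) v, amp ι a (lp.single 2 j v) = lp.single 2 j (a v) := by
      intro a v
      ext k
      rw [amp_apply, lp.coeFn_single, lp.coeFn_single]
      by_cases hk : k = j
      · subst hk; simp
      · simp [Pi.single_eq_of_ne hk]
    have : Q ∈ Set.centralizer (A : Set (Op H)) := by
      intro a ha
      ext v
      rw [mul_app, mul_app, hQa, hQa, ← hsing, ← mul_app (clProj U), ← hc a ha]
      rfl
    intro v
    have := congrArg (fun z : Op H => z v) (hfA Q this)
    simp only [mul_app, hQa] at this
    exact this.symm
  have hcomm : amp ι f * clProj U = clProj U * amp ι f := by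
    refine ContinuousLinearMap.ext fun ξ => ?_
    have hs := lp.hasSum_single (by norm_num : (2 : ℝ≥0∞) ≠ ⊤) ξ
    refine (hs.mapL (amp ι f * clProj U)).unique ?_
    convert hs.mapL (clProj U * amp ι f) using 2 with j
    have hsing : amp ι f (lp.single 2 j (ξ j)) = lp.single 2 j (f (ξ j)) := by
      ext k
      rw [amp_apply, lp.coeFn_single, lp.coeFn_single]
      by_cases hk : k = j
      · subst hk; simp
      · simp [Pi.single_eq_of_ne hk]
    rw [mul_app, mul_app, hsing]
    ext i
    rw [amp_apply, hent]
  have hη : clProj U η = η := clProj_of_mem ⟨⟨1, h1⟩, by simp [ampOrbit]⟩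
  have hmem : amp ι f η ∈ U.topologicalClosure := by
    rw [← hη, ← mul_app, hcomm]
    exact clProj_mem_closure U _
  rw [h f hf]
  have hz := eq_on_closure (f := fun v => ⟪ζ, v⟫_ℂ) (g := fun _ => (0 : ℂ)) (by fun_prop)
    (by fun_prop) (U := U) (fun u hu => ?_) hmem
  · exact hz
  · obtain ⟨a, rfl⟩ := hu
    have := h0 a a.2
    rwa [h a (hAM a a.2)] at this

theorem IsNormalPLF.exists_support (hF : IsNormalPLF M F) : ∃ p, IsSupportProjOf M F p ∧
    (∀ x ∈ M, F (star x * x) = 0 → x * p = 0) ∧ (∀ x ∈ M, F (x * p) = F x) ∧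
    ∀ x ∈ M, F (p * x) = F x := by
  obtain ⟨ι, ζ, h⟩ := hF.exists_amp
  set U := Submodule.span ℂ {v | ∃ y ∈ M.commutant, ∃ i, v = y (ζ i)} with hU
  have hinv : ∀ y ∈ M.commutant, ∀ u ∈ U, y u ∈ U := by
    intro y hy u hu
    have : U ≤ U.comap (y : H →ₗ[ℂ] H) := by
      rw [hU, Submodule.span_le]
      rintro _ ⟨z, hz, i, rfl⟩
      exact Submodule.subset_span ⟨y * z, mul_mem hy hz, i, rfl⟩
    exact this hu
  have hp := isProjIn_clProj hinv
  have hζ : amp ι (clProj U) ζ = ζ := by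
    ext i
    exact clProj_of_mem (Submodule.subset_span ⟨1, one_mem _, i, rfl⟩)
  have h0 : ∀ x ∈ M, F (star x * x) = 0 → x * clProj U = 0 := by
    intro x hx hx0
    rw [h _ (mul_mem (star_mem hx) hx), map_mul, StarHomClass.map_star, inner_star_mul_self,
      Complex.ofReal_eq_zero, sq_eq_zero_iff, norm_eq_zero] at hx0
    refine mul_clProj_eq_zero fun u hu => ?_
    have : U ≤ LinearMap.ker (x : H →ₗ[ℂ] H) := by
      rw [hU, Submodule.span_le]
      rintro _ ⟨z, hz, i, rfl⟩
      have e1 : x (ζ i) = 0 := congrArg (fun v : Amp ι H => v i) hx0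
      have e2 := congrArg (fun w : Op H => w (ζ i)) (commute_of_mem hx hz)
      simp only [mul_app, e1, map_zero] at e2
      simpa using e2
    exact this hu
  have hr : ∀ x ∈ M, F (x * clProj U) = F x := fun x hx => by
    rw [h _ (mul_mem hx hp.1), h x hx, map_mul, mul_app, hζ]
  have hl : ∀ x ∈ M, F (clProj U * x) = F x := fun x hx => by
    rw [h _ (mul_mem hp.1 hx), h x hx, map_mul, mul_app, ← inner_star_left,
      ← StarHomClass.map_star, hp.2.1, hζ]
  refine ⟨clProj U, ⟨hp, fun x hx => ?_, fun q hq hqF => ?_⟩, h0, hr, hl⟩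
  · rw [hr _ (mul_mem hp.1 hx), hl x hx]
  · have h1 : F (star (1 - q) * (1 - q)) = 0 := by
      have := hqF 1 (one_mem M)
      rw [mul_one, hq.2.2] at this
      rw [star_sub, hq.2.1, star_one, mul_sub, mul_one, sub_mul, one_mul, hq.2.2, sub_self,
        sub_zero, hF.map_sub (one_mem M) hq.1, this, sub_self]
    have h2 := h0 _ (sub_mem (one_mem M) hq.1) h1
    rw [sub_mul, one_mul, sub_eq_zero] at h2
    have h3 := congrArg star h2
    rw [star_mul, hq.2.1, hp.2.1] at h3
    exact h3.symm

end VectorForm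

section Polar
variable {M N : VonNeumannAlgebra H} {F φ ρ σ : Op H → ℂ}

/-- The range projection of an operator. -/
noncomputable abbrev rangeProj (x : Op H) : Op H := clProj (LinearMap.range (x : H →ₗ[ℂ] H))

theorem exists_polar {x : Op H} (hx : x ∈ N) : ∃ u ∈ N,
    u * CFC.sqrt (star x * x) = x ∧
    u * rangeProj (CFC.sqrt (star x * x)) = u ∧
    star u * u = rangeProj (CFC.sqrt (star x * x)) := by
  have hxx : star x * x ∈ N := mul_mem (star_mem hx) hx
  have hss := CFC.sqrt_mul_sqrt_self (star x * x) (star_mul_self_nonneg x)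
  have hsa : star (CFC.sqrt (star x * x)) = CFC.sqrt (star x * x) :=
    (IsSelfAdjoint.of_nonneg (CFC.sqrt_nonneg _)).star_eq
  have htN : CFC.sqrt (star x * x) ∈ N := sqrt_memV hxx
  set t := CFC.sqrt (star x * x) with ht
  have hinner : ∀ v w, ⟪x v, x w⟫_ℂ = ⟪t v, t w⟫_ℂ := fun v w => by
    rw [← inner_star_left, ← mul_app, ← hss, mul_app, ← inner_star_left t, hsa]
  obtain ⟨u, hu, hus, -⟩ := exists_extension (t : H →ₗ[ℂ] H) (x : H →ₗ[ℂ] H) zero_le_one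
    fun y => by
      have : ‖x y‖ ^ 2 = ‖t y‖ ^ 2 := by
        have := hinner y y
        rw [inner_self_eq_norm_sq_to_K, inner_self_eq_norm_sq_to_K] at this
        exact_mod_cast this
      rw [one_mul]
      exact (pow_left_inj₀ (norm_nonneg _) (norm_nonneg _) two_ne_zero).1 this |>.le
  simp only [ContinuousLinearMap.coe_coe] at hu
  have hus' : u * rangeProj t = u := ContinuousLinearMap.ext hus
  have hsu := congrArg star hus'
  rw [star_mul, star_clProj] at hsu
  refine ⟨u, mem_of_commute fun y hy => ?_, ContinuousLinearMap.ext hu, hus', ?_⟩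
  · have hc := commute_of_mem (isProjIn_range htN).1 hy
    rw [← hus', mul_assoc, hc, ← mul_assoc, ← mul_assoc]
    refine ContinuousLinearMap.ext fun v => ?_
    refine eq_on_closure (f := ⇑(y * u)) (g := ⇑(u * y)) (y * u).continuous (u * y).continuous ?_
      (clProj_mem_closure _ v)
    rintro _ ⟨w, rfl⟩
    have e1 : t (y w) = y (t w) := congrArg (fun z : Op H => z w) (commute_of_mem htN hy)
    have e2 : x (y w) = y (x w) := congrArg (fun z : Op H => z w) (commute_of_mem hx hy)
    rw [mul_app, mul_app, ContinuousLinearMap.coe_coe, hu, ← e1, hu, e2]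
  · refine op_ext_of_range (L := (t : H →ₗ[ℂ] H)) ?_ (clProj_mul_self _) ?_ (clProj_mul_self _) ?_
    · rw [mul_assoc, hus']
    · rw [← mul_assoc, hsu]
    · intro v w
      rw [clProj_of_mem (LinearMap.mem_range_self _ v), mul_app, inner_star_left]
      simp only [ContinuousLinearMap.coe_coe, hu, hinner]

theorem WFOn.range_eq_zero (hF : WFOn M F) {t : Op H} (ht : t ∈ M)
    (h0 : ∀ w ∈ M, F (t * w) = 0) : F (rangeProj t) = 0 := by
  classical
  obtain ⟨ι, ζ, η, h⟩ := hF
  have hs := (isProjIn_range ht).1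
  set U := LinearMap.range (orbit M (amp ι) η) with hU
  have hQ : ∀ {a}, a ∈ M → ∀ v, amp ι a (clProj U v) = clProj U (amp ι a v) := fun ha v =>
    congrArg (fun z : Op (Amp ι H) => z v) (orbit_clProj_commute M (amp ι) η ha)
  have hη : clProj U η = η := clProj_of_mem ⟨1, by simp [orbit_apply]⟩
  have h1 : ∀ v, ⟪clProj U ζ, amp ι t v⟫_ℂ = 0 := fun v => by
    rw [inner_clProj, ← hQ ht]
    refine eq_on_closure (f := fun v => ⟪ζ, amp ι t v⟫_ℂ) (g := fun _ => (0 : ℂ)) (by fun_prop)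
      (by fun_prop) ?_ (clProj_mem_closure U v)
    rintro _ ⟨w, rfl⟩
    rw [orbit_apply, ← mul_app, ← map_mul, ← h _ (mul_mem ht w.2), h0 _ w.2]
  have h2 : ∀ i v, ⟪clProj U ζ i, t v⟫_ℂ = 0 := fun i v => by
    rw [← lp.inner_single_right, ← h1 (lp.single 2 i v)]
    congr 1
    ext k
    rw [amp_apply, lp.coeFn_single, lp.coeFn_single]
    by_cases hk : k = i
    · subst hk; simp
    · simp [Pi.single_eq_of_ne hk]
  rw [h _ hs, ← hη, hQ hs, ← inner_clProj, lp.inner_eq_tsum]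
  convert tsum_zero with i
  rw [amp_apply]
  refine eq_on_closure (f := fun v => ⟪clProj U ζ i, v⟫_ℂ) (g := fun _ => (0 : ℂ)) (by fun_prop)
      (by fun_prop) ?_ (clProj_mem_closure _ _)
  rintro _ ⟨w, rfl⟩
  exact h2 i w

theorem IsPLF.conj_eq (h : IsPLF M φ) {x : Op H} (hx : x ∈ M) : conj (φ x) = φ (star x) :=
  (h.map_star hx).symm

/-- The centralizer of a positive functional as a subspace. -/
def centralizerSubmodule (h : IsPLF M φ) : Submodule ℂ (Op H) where
  carrier := stateCentralizer M φ
  zero_mem' := ⟨zero_mem _, fun y _ => by simp⟩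
  add_mem' := fun {a b} ha hb => ⟨add_mem (S := VonNeumannAlgebra H) ha.1 hb.1, fun y hy => by
    rw [add_mul, mul_add, h.map_add _ (mul_mem ha.1 hy) _ (mul_mem hb.1 hy),
      h.map_add _ (mul_mem hy ha.1) _ (mul_mem hy hb.1), ha.2 y hy, hb.2 y hy]⟩
  smul_mem' := fun c a ha => ⟨smul_memV c ha.1, fun y hy => by
    rw [smul_mul_assoc, mul_smul_comm, h.map_smul _ _ (mul_mem ha.1 hy),
      h.map_smul _ _ (mul_mem hy ha.1), ha.2 y hy]⟩

theorem stateCentralizer_mul {a b : Op H} (ha : a ∈ stateCentralizer M φ)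
    (hb : b ∈ stateCentralizer M φ) : a * b ∈ stateCentralizer M φ :=
  ⟨mul_mem ha.1 hb.1, fun y hy => by
    rw [mul_assoc, ha.2 _ (mul_mem hb.1 hy), mul_assoc, hb.2 _ (mul_mem hy ha.1), mul_assoc]⟩

theorem one_mem_stateCentralizer : 1 ∈ stateCentralizer M φ := ⟨one_mem M, fun y _ => by simp⟩

theorem IsPLF.star_mem_stateCentralizer (h : IsPLF M φ) {a : Op H}
    (ha : a ∈ stateCentralizer M φ) : star a ∈ stateCentralizer M φ :=
  ⟨star_mem ha.1, fun y hy => by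
    have := congrArg conj (ha.2 _ (star_mem hy))
    rw [h.conj_eq (mul_mem ha.1 (star_mem hy)), h.conj_eq (mul_mem (star_mem hy) ha.1)] at this
    simpa using this.symm⟩

theorem IsNormalPLF.mem_stateCentralizer (h : IsNormalPLF M φ) {f : Op H} (hf : f ∈ M)
    (hc : f ∈ Set.centralizer (Set.centralizer (stateCentralizer M φ))) :
    f ∈ stateCentralizer M φ := by
  refine ⟨hf, fun y hy => sub_eq_zero.1 ?_⟩
  exact ((h.wfOn.mul_right hy).sub (h.wfOn.mul_left hy)).eq_zero
    (centralizerSubmodule h.toIsPLF) (fun a ha => ha.1) one_mem_stateCentralizer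
    (fun a ha b hb => stateCentralizer_mul ha hb) (fun a ha => h.star_mem_stateCentralizer ha)
    (fun a ha => sub_eq_zero.2 (ha.2 y hy)) hf hc

/-- An element intertwining two normal functionals gives rise to an intertwining partial
isometry, by polar decomposition. -/
theorem intertwined_of_mul (hρ : IsNormalPLF N ρ) (hσ : IsNormalPLF N σ) {x : Op H} (hx : x ∈ N)
    (hx0 : σ (star x * x) ≠ 0) {l : ℝ} (hl : 0 < l)
    (h : ∀ z ∈ N, ρ (x * z) = (l : ℂ) * σ (z * x)) : Intertwined N ρ σ := by
  obtain ⟨q, hq, -, hqr, hql⟩ := hρ.exists_support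
  obtain ⟨p, hp, hpσ, hpr, hpl⟩ := hσ.exists_support
  have hq1 := hq.1.1
  have hp1 := hp.1.1
  have hl0 : (l : ℂ) ≠ 0 := by exact_mod_cast hl.ne'
  set y := q * x * p with hy
  have hyN : y ∈ N := mul_mem (mul_mem hq1 hx) hp1
  have hyx : ∀ z ∈ N, σ (z * y) = σ (z * x) := by
    intro z hz
    apply mul_left_cancel₀ hl0
    rw [hy, ← mul_assoc, hpr _ (mul_mem hz (mul_mem hq1 hx)), ← mul_assoc,
      ← h _ (mul_mem hz hq1), ← mul_assoc, hqr _ (mul_mem hx hz), h z hz]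
  have hyz : ∀ z ∈ N, ρ (y * z) = (l : ℂ) * σ (z * y) := by
    intro z hz
    rw [hyx z hz, hy, mul_assoc, mul_assoc, hql _ (mul_mem hx (mul_mem hp1 hz)),
      h _ (mul_mem hp1 hz), mul_assoc, hpl _ (mul_mem hz hx)]
  have hy0 : y ≠ 0 := by
    intro hy0
    apply hx0
    rw [← hyx _ (star_mem hx), hy0, mul_zero, hσ.map_zero]
  have hqy : q * y = y := by rw [hy, ← mul_assoc, ← mul_assoc, hq.1.2.2]
  have hyp : y * p = y := by rw [hy, mul_assoc, hp.1.2.2]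
  clear_value y
  obtain ⟨u, hu, hut, hus, huu⟩ := exists_polar hyN
  have ha : star y * y ∈ N := mul_mem (star_mem hyN) hyN
  have hac : star y * y ∈ stateCentralizer N σ := by
    refine ⟨ha, fun z hz => ?_⟩
    apply mul_left_cancel₀ hl0
    have h1 : ∀ z ∈ N, ρ (z * star y) = (l : ℂ) * σ (star y * z) := fun z hz => by
      have := congrArg conj (hyz _ (star_mem hz))
      rw [map_mul, hρ.conj_eq (mul_mem hyN (star_mem hz)), hσ.conj_eq (mul_mem (star_mem hz) hyN),
        Complex.conj_ofReal] at this
      simpa using this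
    rw [mul_assoc, ← h1 _ (mul_mem hyN hz), mul_assoc, hyz _ (mul_mem hz (star_mem hyN)), mul_assoc]
  have hsa : star (CFC.sqrt (star y * y)) = CFC.sqrt (star y * y) :=
    (IsSelfAdjoint.of_nonneg (CFC.sqrt_nonneg _)).star_eq
  have hss := CFC.sqrt_mul_sqrt_self (star y * y) (star_mul_self_nonneg y)
  have htN : CFC.sqrt (star y * y) ∈ N := sqrt_memV ha
  have htc : CFC.sqrt (star y * y) ∈ stateCentralizer N σ := by
    refine hσ.mem_stateCentralizer htN fun b hb => ?_
    have : Commute (star y * y) b := hb _ hac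
    exact (Commute.cfcₙ_nnreal this _).symm.eq
  set t := CFC.sqrt (star y * y) with ht
  have hsN := isProjIn_range htN
  have hsc : rangeProj t ∈ stateCentralizer N σ := by
    refine hσ.mem_stateCentralizer hsN.1 fun b hb => ?_
    have hinv : ∀ b ∈ Set.centralizer (stateCentralizer N σ),
        ∀ v ∈ LinearMap.range (t : H →ₗ[ℂ] H), b v ∈ LinearMap.range (t : H →ₗ[ℂ] H) := by
      rintro b hb _ ⟨v, rfl⟩
      exact ⟨b v, congrArg (fun z : Op H => z v) (hb t htc)⟩
    refine clProj_commute (hinv b hb) (hinv _ fun c hc => ?_)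
    have := congrArg star (hb _ (hσ.star_mem_stateCentralizer hc))
    simpa using this.symm
  set s := rangeProj t with hs
  have hut0 : ∀ w ∈ N, ρ (u * (t * w)) - (l : ℂ) * σ (t * w * u) = 0 := by
    intro w hw
    rw [← mul_assoc, hut, hyz w hw, mul_assoc t, htc.2 _ (mul_mem hw hu), mul_assoc, hut, sub_self]
  have hzero : ∀ z ∈ N, ρ (u * z) = (l : ℂ) * σ (z * u) := by
    intro z hz
    have h1 := (((hρ.wfOn.mul_left hu).mul_right hz).sub
      (((hσ.wfOn.mul_right hu).mul_right hz).smul l))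
    have h2 := h1.range_eq_zero htN fun w hw => by
      have := hut0 _ (mul_mem hw hz)
      simpa only [mul_assoc] using this
    rw [← hs, sub_eq_zero] at h2
    rw [← mul_assoc, hus, mul_assoc, hsc.2 _ (mul_mem hz hu), mul_assoc, hus] at h2
    exact h2
  refine ⟨u, q, p, l, hl, hu, ?_, ?_, hq, hp, ?_, ?_, hzero⟩
  · rw [IsPartialIsom, huu, hsN.2.2]
  · rintro rfl
    rw [zero_mul] at hut
    exact hy0 hut.symm
  · have : (q * u - u) * s = 0 := mul_clProj_eq_zero <| by
      rintro _ ⟨v, rfl⟩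
      have e1 : u (t v) = y v := congrArg (fun z : Op H => z v) hut
      have e2 : q (y v) = y v := congrArg (fun z : Op H => z v) hqy
      rw [sub_apply, mul_app, ContinuousLinearMap.coe_coe, e1, e2, sub_self]
    rw [sub_mul, mul_assoc, hus, sub_eq_zero] at this
    exact this
  · have htp : t * (1 - p) = 0 := by
      have e1 : star (t * (1 - p)) * (t * (1 - p)) = 0 := by
        rw [star_mul, hsa, mul_assoc, ← mul_assoc t, hss, mul_assoc, mul_sub, mul_one, hyp,
          sub_self, mul_zero, mul_zero]
      exact CStarRing.star_mul_self_eq_zero_iff _ |>.1 e1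
    have e2 : (1 - p) * t = 0 := by
      have := congrArg star htp
      rwa [star_mul, hsa, star_sub, star_one, hp.1.2.1, star_zero] at this
    have e3 : (1 - p) * s = 0 := mul_clProj_eq_zero <| by
      rintro _ ⟨v, rfl⟩
      exact congrArg (fun z : Op H => z v) e2
    have e4 := congrArg star e3
    rw [star_mul, star_sub, star_one, hp.1.2.1, hsN.2.1, star_zero, mul_sub, mul_one,
      sub_eq_zero] at e4
    rw [← hus, mul_assoc, ← e4]

theorem IsFactorSet.exists_mul_ne_zero (hφ : IsNormalPLF N φ)
    (hfac : IsFactorSet (stateCentralizer N φ)) {a b : Op H}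
    (hb : b ∈ stateCentralizer N φ) (ha0 : a ≠ 0) (hb0 : b ≠ 0) :
    ∃ z ∈ stateCentralizer N φ, a * z * b ≠ 0 := by
  by_contra! hcon
  set U := Submodule.span ℂ {v | ∃ z ∈ stateCentralizer N φ, ∃ w, v = z (b w)} with hU
  have key : ∀ y : Op H, (∀ z ∈ stateCentralizer N φ, ∀ w,
      ∃ z' ∈ stateCentralizer N φ, ∃ w', y (z (b w)) = z' (b w')) → ∀ u ∈ U, y u ∈ U := by
    intro y hy u hu
    have : U ≤ U.comap (y : H →ₗ[ℂ] H) := by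
      rw [hU, Submodule.span_le]
      rintro _ ⟨z, hz, w, rfl⟩
      exact Submodule.subset_span (hy z hz w)
    exact this hu
  have hcomm : ∀ y : Op H, (∀ z ∈ stateCentralizer N φ, z * y = y * z) → ∀ u ∈ U, y u ∈ U := by
    refine fun y hy => key y fun z hz w => ⟨z, hz, y w, ?_⟩
    rw [← mul_app y, ← hy z hz, mul_app, ← mul_app y, ← hy b hb, mul_app]
  have hq : IsProjIn (N : Set (Op H)) (clProj U) := isProjIn_clProj fun y hy =>
    hcomm y fun z hz => commute_of_mem hz.1 hy
  have hqc : clProj U ∈ stateCentralizer N φ := by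
    refine hφ.mem_stateCentralizer hq.1 fun y hy => clProj_commute (hcomm y hy) (hcomm _ ?_)
    intro c hc
    have := congrArg star (hy _ (hφ.star_mem_stateCentralizer hc))
    simpa using this.symm
  have hmul : ∀ y ∈ stateCentralizer N φ, ∀ u ∈ U, y u ∈ U := fun y hy =>
    key y fun z hz w => ⟨y * z, stateCentralizer_mul hy hz, w, rfl⟩
  obtain ⟨c, hc⟩ := hfac _ hqc fun y hy =>
    (clProj_commute (hmul y hy) (hmul _ (hφ.star_mem_stateCentralizer hy))).symm
  have haq : a * clProj U = 0 := mul_clProj_eq_zero fun u hu => by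
    have : U ≤ LinearMap.ker (a : H →ₗ[ℂ] H) := by
      rw [hU, Submodule.span_le]
      rintro _ ⟨z, hz, w, rfl⟩
      exact congrArg (fun f : Op H => f w) (hcon z hz)
    exact this hu
  rw [hc, mul_smul_comm, mul_one, smul_eq_zero, or_iff_left ha0] at haq
  apply hb0
  ext w
  have : clProj U (b w) = b w :=
    clProj_of_mem (Submodule.subset_span ⟨1, one_mem_stateCentralizer, w, rfl⟩)
  rw [← this, hc, haq]
  simp

end Polar

section Automorphism
variable {M N : VonNeumannAlgebra H} {φ : Op H → ℂ}

/-- The inverse automorphism. -/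
def VNAut.symm (Θ : VNAut M) : VNAut M where
  toFun := Θ.invFun
  invFun := Θ.toFun
  mem' := Θ.inv_mem'
  inv_mem' := Θ.mem'
  left_inv' := Θ.right_inv'
  right_inv' := Θ.left_inv'
  map_add' x hx y hy := by
    have hx' := Θ.inv_mem' x hx
    have hy' := Θ.inv_mem' y hy
    conv_lhs => rw [← Θ.right_inv' x hx, ← Θ.right_inv' y hy, ← Θ.map_add' _ hx' _ hy',
      Θ.left_inv' _ (add_mem hx' hy')]
  map_smul' c x hx := by
    have hx' := Θ.inv_mem' x hx
    conv_lhs => rw [← Θ.right_inv' x hx, ← Θ.map_smul' _ _ hx', Θ.left_inv' _ (smul_memV c hx')]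
  map_mul' x hx y hy := by
    have hx' := Θ.inv_mem' x hx
    have hy' := Θ.inv_mem' y hy
    conv_lhs => rw [← Θ.right_inv' x hx, ← Θ.right_inv' y hy, ← Θ.map_mul' _ hx' _ hy',
      Θ.left_inv' _ (mul_mem hx' hy')]
  map_star' x hx := by
    have hx' := Θ.inv_mem' x hx
    conv_lhs => rw [← Θ.right_inv' x hx, ← Θ.map_star' _ hx', Θ.left_inv' _ (star_mem hx')]

theorem VNAut.map_zero (Θ : VNAut M) : Θ.toFun 0 = 0 := by
  have := Θ.map_smul' 0 0 (zero_mem M)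
  rwa [zero_smul, zero_smul] at this

theorem VNAut.isProjIn (Θ : VNAut M) {p : Op H} (hp : IsProjIn (M : Set (Op H)) p) :
    IsProjIn (M : Set (Op H)) (Θ.toFun p) :=
  ⟨Θ.mem' p hp.1, by rw [← Θ.map_star' p hp.1, hp.2.1],
    by rw [← Θ.map_mul' p hp.1 p hp.1, hp.2.2]⟩

/-- Automorphisms of von Neumann algebras are normal. -/
theorem IsNormalPLF.comp_aut (h : IsNormalPLF M φ) (Θ : VNAut M) :
    IsNormalPLF M fun x => φ (Θ.toFun x) where
  map_add x hx y hy := by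
    rw [Θ.map_add' x hx y hy, h.map_add _ (Θ.mem' x hx) _ (Θ.mem' y hy)]
  map_smul c x hx := by rw [Θ.map_smul' c x hx, h.map_smul c _ (Θ.mem' x hx)]
  pos x hx := by
    rw [Θ.map_mul' _ (star_mem hx) _ hx, Θ.map_star' x hx]
    exact h.pos _ (Θ.mem' x hx)
  normal ι p q hp hq ho hsum := by
    have hp' := fun i => Θ.isProjIn (hp i)
    have hq' := Θ.isProjIn hq
    have ho' : Pairwise fun i j => Θ.toFun (p i) * Θ.toFun (p j) = 0 := fun i j hij => by
      beta_reduce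
      rw [← Θ.map_mul' _ (hp i).1 _ (hp j).1, ho hij, Θ.map_zero]
    obtain ⟨r, hr, hrs, hrp, hmin⟩ := exists_sum_proj hp' ho'
    have hqp : ∀ i, q * p i = p i := fun i => by
      classical
      ext v
      refine (hsum (p i v)).unique ?_
      convert hasSum_ite_eq i (p i v) using 2 with j
      split_ifs with hj
      · rw [hj, ← mul_app, (hp i).2.2]
      · rw [← mul_app, ho hj]; simp
    have h1 : Θ.toFun q * r = r := hmin _ fun i => by
      rw [← Θ.map_mul' _ hq.1 _ (hp i).1, hqp]
    have hr' := Θ.inv_mem' r hr.1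
    have h2 : Θ.invFun r * q = q := by
      ext v
      refine ((hsum v).mapL (Θ.invFun r)).unique ?_
      convert hsum v using 2 with i
      have := congrArg Θ.invFun (hrp i)
      rw [← Θ.right_inv' r hr.1, ← Θ.map_mul' _ hr' _ (hp i).1,
        Θ.left_inv' _ (mul_mem hr' (hp i).1), Θ.left_inv' _ (hp i).1] at this
      rw [← mul_app, this]
    have h3 : r * Θ.toFun q = Θ.toFun q := by
      conv_lhs => rw [← Θ.right_inv' r hr.1, ← Θ.map_mul' _ hr' _ hq.1, h2]
    have h4 := congrArg star h1
    rw [star_mul, hq'.2.1, hr.2.1, h3] at h4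
    rw [h4]
    exact h.normal ι _ r hp' hr ho' hrs

end Automorphism

section FreeProduct
variable {M N P : VonNeumannAlgebra H} {φ φN φP : Op H → ℂ} {E : Op H → Op H}

theorem IsCondExp.mem (hE : IsCondExp M N E) {x : Op H} (hx : x ∈ N) : x ∈ M := hE.subset' hx

theorem IsCondExp.map_mul_left (hE : IsCondExp M N E) {a x : Op H} (ha : a ∈ N) (hx : x ∈ M) :
    E (a * x) = a * E x := by simpa using hE.bimod' a ha x hx 1 (one_mem N)

theorem IsCondExp.map_mul_right (hE : IsCondExp M N E) {x b : Op H} (hx : x ∈ M) (hb : b ∈ N) :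
    E (x * b) = E x * b := by simpa using hE.bimod' 1 (one_mem N) x hx b hb

theorem IsCondExp.map_zero (hE : IsCondExp M N E) : E 0 = 0 := hE.fix' 0 (zero_mem N)

/-- Elements of `A` on which `φ` vanishes. -/
def Centered (A : VonNeumannAlgebra H) (φ : Op H → ℂ) (c : Op H) : Prop := c ∈ A ∧ φ c = 0

/-- Alternating products of centered elements of `P` and `N` which begin and end in `P`. -/
inductive Word (N P : VonNeumannAlgebra H) (φ : Op H → ℂ) : Op H → Prop
  | base {p : Op H} : Centered P φ p → Word N P φ p
  | snoc {w n p : Op H} : Word N P φ w → Centered N φ n → Centered P φ p → Word N P φ (w * n * p)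

theorem Word.append {v n w : Op H} (hv : Word N P φ v) (hn : Centered N φ n)
    (hw : Word N P φ w) : Word N P φ (v * n * w) := by
  induction hw with
  | base hp => exact hv.snoc hn hp
  | snoc _ hm hp ih => rw [← mul_assoc, ← mul_assoc]; exact ih.snoc hm hp

theorem Word.left_cases {w : Op H} (hw : Word N P φ w) : Centered P φ w ∨
    ∃ p n v, Centered P φ p ∧ Centered N φ n ∧ Word N P φ v ∧ w = p * n * v := by
  induction hw with
  | base hp => exact .inl hp
  | @snoc w m q hw hm hq ih =>
    refine .inr ?_
    obtain h | ⟨p, n, v, hp, hn, hv, rfl⟩ := ih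
    · exact ⟨w, m, q, h, hm, .base hq, rfl⟩
    · exact ⟨p, n, v * m * q, hp, hn, hv.snoc hm hq, by simp only [mul_assoc]⟩

theorem IsPLF.star_centered {A : VonNeumannAlgebra H} (h : IsPLF M φ)
    (hA : (A : Set (Op H)) ⊆ M) {c : Op H} (hc : Centered A φ c) : Centered A φ (star c) :=
  ⟨star_mem hc.1, by rw [h.map_star (hA hc.1), hc.2, _root_.map_zero]⟩

theorem IsPLF.sub_centered {A : VonNeumannAlgebra H} (h : IsPLF M φ) (h1 : φ 1 = 1)
    (hA : (A : Set (Op H)) ⊆ M) {c : Op H} (hc : c ∈ A) : Centered A φ (c - φ c • 1) := by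
  refine ⟨sub_mem hc (smul_memV _ (one_mem A)), ?_⟩
  rw [h.map_sub (hA hc) (smul_memV _ (one_mem M)), h.map_smul _ _ (one_mem M), h1, mul_one, sub_self]

/-- A free product decomposition together with the conditional expectation onto the first
factor. -/
structure FreeExp (M N P : VonNeumannAlgebra H) (φ φN φP : Op H → ℂ) (E : Op H → Op H) :
    Prop where
  free : IsFreeProductDecomposition M N P φ φN φP
  state : IsFNState M φ
  exp : IsCondExp M N E
  inv : ∀ x ∈ M, φ (E x) = φ x

theorem FreeExp.plf (h : FreeExp M N P φ φN φP E) : IsPLF M φ := h.state.1.1.toIsPLF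

theorem FreeExp.one (h : FreeExp M N P φ φN φP E) : φ 1 = 1 := h.state.1.2

theorem FreeExp.star_word (h : FreeExp M N P φ φN φP E) {w : Op H} (hw : Word N P φ w) :
    Word N P φ (star w) := by
  induction hw with
  | base hp => exact .base (h.plf.star_centered h.free.subP hp)
  | snoc _ hm hp ih =>
    rw [star_mul, star_mul, ← mul_assoc]
    exact (Word.base (h.plf.star_centered h.free.subP hp)).append
      (h.plf.star_centered h.free.subN hm) ih

theorem FreeExp.word_mem (h : FreeExp M N P φ φN φP E) {w : Op H} (hw : Word N P φ w) :
    w ∈ M := by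
  induction hw with
  | base hp => exact h.free.subP hp.1
  | snoc _ hm hp ih => exact mul_mem (mul_mem ih (h.free.subN hm.1)) (h.free.subP hp.1)

theorem FreeExp.free_list (h : FreeExp M N P φ φN φP E) {L : List (Bool × Op H)} (h0 : L ≠ [])
    (hc : ∀ a ∈ L, Centered (if a.1 then N else P) φ a.2)
    (hL : L.IsChain fun a b => a.1 ≠ b.1) : φ (L.map Prod.snd).prod = 0 := by
  have := h.free.free L.length (fun i => (L.get i).2) (fun i => (L.get i).1)
    (by simpa using h0) (fun i => ?_) (fun i => (hc _ (L.get_mem i)).2) (fun i j hij => ?_)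
  · rwa [show (List.ofFn fun i => (L.get i).2) = L.map Prod.snd from
      List.ext_getElem (by simp) fun i _ _ => by simp] at this
  · have := (hc _ (L.get_mem i)).1
    split_ifs with h'
    · rwa [if_pos h'] at this
    · rwa [if_neg h'] at this
  · have := List.isChain_iff_getElem.1 hL i (by omega)
    simp only [List.get_eq_getElem]
    convert this using 3
    exact hij.symm

theorem Word.exists_list {w : Op H} (hw : Word N P φ w) : ∃ L : List (Bool × Op H), L ≠ [] ∧
    (∀ a ∈ L, Centered (if a.1 then N else P) φ a.2) ∧ (L.IsChain fun a b => a.1 ≠ b.1) ∧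
    (∀ a ∈ L.getLast?, a.1 = false) ∧ (∀ a ∈ L.head?, a.1 = false) ∧
    (L.map Prod.snd).prod = w := by
  induction hw with
  | @base p hp => exact ⟨[(false, p)], by simp, by simpa using hp, by simp, by simp, by simp, by simp⟩
  | @snoc w n p hw hn hp ih =>
    obtain ⟨L, h0, hc, hL, hl, hh, rfl⟩ := ih
    refine ⟨L ++ [(true, n), (false, p)], by simp, ?_, ?_, by simp, ?_, by simp [mul_assoc]⟩
    · intro a ha
      simp only [List.mem_append, List.mem_cons, List.not_mem_nil, or_false] at ha
      obtain ha | rfl | rfl := ha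
      · exact hc a ha
      · simpa using hn
      · simpa using hp
    · rw [List.isChain_append]
      refine ⟨hL, by simp, fun a ha b hb => ?_⟩
      have := hl a ha
      simp only [List.head?_cons, Option.mem_def, Option.some.injEq] at hb
      simp [this, ← hb]
    · intro a ha
      rw [List.head?_append_of_ne_nil _ h0] at ha
      exact hh a ha

theorem FreeExp.exp_word (h : FreeExp M N P φ φN φP E) {w : Op H} (hw : Word N P φ w) :
    E w = 0 := by
  have hwM := h.word_mem hw
  obtain ⟨L, h0, hc, hL, -, hh, hprod⟩ := hw.exists_list
  have h1 : φ w = 0 := by rw [← hprod]; exact h.free_list h0 hc hL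
  have h2 : ∀ c, Centered N φ c → φ (c * w) = 0 := by
    intro c hc'
    have := h.free_list (L := (true, c) :: L) (by simp) (by simpa using ⟨hc', by simpa using hc⟩)
      (by
        rw [List.isChain_cons]
        exact ⟨fun a ha => by simp [hh a ha], hL⟩)
    simpa [hprod] using this
  have h3 : ∀ c ∈ N, φ (c * w) = 0 := by
    intro c hc'
    have hcc := h.plf.sub_centered h.one h.free.subN hc'
    have := h2 _ hcc
    rw [sub_mul, smul_mul_assoc, one_mul, h.plf.map_sub (mul_mem (h.free.subN hc') hwM)
      (smul_memV _ hwM), h.plf.map_smul _ _ hwM, h1, mul_zero, sub_zero] at this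
    exact this
  have hE := h.exp.mem' w hwM
  refine h.state.2 _ (h.exp.mem hE) ?_
  rw [← h.exp.map_mul_left (star_mem hE) hwM, h.inv _ (mul_mem (h.exp.mem (star_mem hE)) hwM)]
  exact h3 _ (star_mem hE)

/-- The span of the reduced words of even type. -/
def wordSpan (N P : VonNeumannAlgebra H) (φ : Op H → ℂ) : Submodule ℂ (Op H) :=
  Submodule.span ℂ ({1} ∪ {x | ∃ c ∈ N, ∃ w, Word N P φ w ∧ x = c * w} ∪
    {x | ∃ c ∈ N, ∃ w, Word N P φ w ∧ x = w * c})

theorem Word.mem_wordSpan {w : Op H} (hw : Word N P φ w) : w ∈ wordSpan N P φ :=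
  Submodule.subset_span <| .inl <| .inr ⟨1, one_mem N, w, hw, by simp⟩

theorem FreeExp.mul_mem_wordSpan (h : FreeExp M N P φ φN φP E) {v w : Op H}
    (hv : Word N P φ v) (hw : Word N P φ w) : v * w ∈ wordSpan N P φ := by
  have hone : (1 : Op H) ∈ wordSpan N P φ := Submodule.subset_span (.inl (.inl rfl))
  have hP : ∀ {p q : Op H}, Centered P φ p → Centered P φ q →
      ∃ r, Centered P φ r ∧ ∃ c : ℂ, p * q = r + c • 1 := fun hp hq =>
    ⟨_, h.plf.sub_centered h.one h.free.subP (mul_mem hp.1 hq.1), _, (sub_add_cancel _ _).symm⟩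
  induction hv generalizing w with
  | @base p hp =>
    obtain hq | ⟨q, n, w', hq, hn, hw', rfl⟩ := hw.left_cases
    · obtain ⟨r, hr, c, hc⟩ := hP hp hq
      rw [hc]
      exact add_mem (Word.base hr).mem_wordSpan (Submodule.smul_mem _ _ hone)
    · obtain ⟨r, hr, c, hc⟩ := hP hp hq
      rw [← mul_assoc, ← mul_assoc, hc, add_mul, add_mul, smul_mul_assoc, smul_mul_assoc, one_mul]
      exact add_mem ((Word.base hr).append hn hw').mem_wordSpan (Submodule.smul_mem _ _
        (Submodule.subset_span (.inl (.inr ⟨n, hn.1, w', hw', rfl⟩))))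
  | @snoc v m p hv hm hp ih =>
    obtain hq | ⟨q, n, w', hq, hn, hw', rfl⟩ := hw.left_cases
    · obtain ⟨r, hr, c, hc⟩ := hP hp hq
      rw [mul_assoc, hc, mul_add, mul_smul_comm, mul_one]
      exact add_mem (hv.snoc hm hr).mem_wordSpan (Submodule.smul_mem _ _
        (Submodule.subset_span (.inr ⟨m, hm.1, v, hv, rfl⟩)))
    · obtain ⟨r, hr, c, hc⟩ := hP hp hq
      have hmn := h.plf.sub_centered h.one h.free.subN (mul_mem hm.1 hn.1)
      have e : v * m * p * (q * n * w') = v * m * r * n * w' +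
          c • (v * (m * n - φ (m * n) • 1) * w' + φ (m * n) • (v * w')) := by
        have : v * m * p * (q * n * w') = v * m * (p * q) * n * w' := by simp only [mul_assoc]
        rw [this, hc]
        simp only [mul_add, add_mul, mul_smul_comm, smul_mul_assoc, mul_one, mul_sub, sub_mul,
          mul_assoc, sub_add_cancel]
      rw [e]
      exact add_mem (((hv.snoc hm hr).append hn hw').mem_wordSpan) (Submodule.smul_mem _ _
        (add_mem (hv.append hmn hw').mem_wordSpan (Submodule.smul_mem _ _ (ih hw'))))

theorem FreeExp.wordSpan_exp (h : FreeExp M N P φ φN φP E) {x : Op H}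
    (hx : x ∈ wordSpan N P φ) : x ∈ M ∧ E x = φ x • 1 := by
  have key : x ∈ M ∧ ∃ c : ℂ, E x = c • 1 := by
    induction hx using Submodule.span_induction with
    | mem x hx =>
      obtain (rfl | ⟨c, hc, w, hw, rfl⟩) | ⟨c, hc, w, hw, rfl⟩ := hx
      · exact ⟨one_mem M, 1, by rw [h.exp.fix' 1 (one_mem N), one_smul]⟩
      · exact ⟨mul_mem (h.exp.mem hc) (h.word_mem hw), 0, by
          rw [h.exp.map_mul_left hc (h.word_mem hw), h.exp_word hw, mul_zero, zero_smul]⟩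
      · exact ⟨mul_mem (h.word_mem hw) (h.exp.mem hc), 0, by
          rw [h.exp.map_mul_right (h.word_mem hw) hc, h.exp_word hw, zero_mul, zero_smul]⟩
    | zero => exact ⟨zero_mem M, 0, by rw [h.exp.map_zero, zero_smul]⟩
    | add x y _ _ hx hy =>
      obtain ⟨hx, c, hc⟩ := hx
      obtain ⟨hy, d, hd⟩ := hy
      exact ⟨add_mem hx hy, c + d, by rw [h.exp.map_add' _ hx _ hy, hc, hd, add_smul]⟩
    | smul a x _ hx =>
      obtain ⟨hx, c, hc⟩ := hx
      exact ⟨smul_memV a hx, a * c, by rw [h.exp.map_smul' _ _ hx, hc, smul_smul]⟩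
  obtain ⟨hxM, c, hc⟩ := key
  refine ⟨hxM, ?_⟩
  rw [← h.inv x hxM, hc, h.plf.map_smul _ _ (one_mem M), h.one, mul_one]

theorem FreeExp.exp_mul_mul (h : FreeExp M N P φ φN φP E) {v w c : Op H}
    (hv : Word N P φ v) (hw : Word N P φ w) (hc : c ∈ N) :
    E (v * c * w) = (φ c * φ (v * w)) • 1 := by
  have hcc := h.plf.sub_centered h.one h.free.subN hc
  have hvw := h.wordSpan_exp (h.mul_mem_wordSpan hv hw)
  have hw' := hv.append hcc hw
  have : v * c * w = v * (c - φ c • 1) * w + φ c • (v * w) := by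
    simp only [mul_sub, sub_mul, mul_smul_comm, smul_mul_assoc, mul_one, sub_add_cancel]
  rw [this, h.exp.map_add' _ (h.word_mem hw') _ (smul_memV _ hvw.1), h.exp_word hw', zero_add,
    h.exp.map_smul' _ _ hvw.1, hvw.2, smul_smul]

/-- The left `N`-module generated by the reduced words beginning and ending in `P`. -/
def freeModule (N P : VonNeumannAlgebra H) (φ : Op H → ℂ) : Submodule ℂ (Op H) :=
  Submodule.span ℂ {x | ∃ c ∈ N, ∃ w, Word N P φ w ∧ x = c * w}

theorem FreeExp.freeModule_mem (h : FreeExp M N P φ φN φP E) {x : Op H}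
    (hx : x ∈ freeModule N P φ) : x ∈ M := by
  induction hx using Submodule.span_induction with
  | mem x hx =>
    obtain ⟨c, hc, w, hw, rfl⟩ := hx
    exact mul_mem (h.exp.mem hc) (h.word_mem hw)
  | zero => exact zero_mem M
  | add x y _ _ hx hy => exact add_mem hx hy
  | smul a x _ hx => exact smul_memV a hx

theorem FreeExp.freeModule_exp (h : FreeExp M N P φ φN φP E) {x : Op H}
    (hx : x ∈ freeModule N P φ) : E x = 0 := by
  induction hx using Submodule.span_induction with
  | mem x hx =>
    obtain ⟨c, hc, w, hw, rfl⟩ := hx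
    rw [h.exp.map_mul_left hc (h.word_mem hw), h.exp_word hw, mul_zero]
  | zero => exact h.exp.map_zero
  | add x y hx' hy' hx hy =>
    rw [h.exp.map_add' _ (h.freeModule_mem hx') _ (h.freeModule_mem hy'), hx, hy, add_zero]
  | smul a x hx' hx => rw [h.exp.map_smul' _ _ (h.freeModule_mem hx'), hx, smul_zero]

theorem FreeExp.star_freeModule_exp (h : FreeExp M N P φ φN φP E) {x : Op H}
    (hx : x ∈ freeModule N P φ) : E (star x) = 0 := by
  rw [h.exp.map_star' _ (h.freeModule_mem hx), h.freeModule_exp hx, star_zero]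

theorem FreeExp.exp_star_mul (h : FreeExp M N P φ φN φP E) {x y : Op H}
    (hx : x ∈ freeModule N P φ) (hy : y ∈ freeModule N P φ) :
    E (star x * y) = φ (star x * y) • 1 := by
  have key : ∃ c : ℂ, E (star x * y) = c • 1 := by
    induction hx using Submodule.span_induction with
    | mem x hx =>
      obtain ⟨c, hc, v, hv, rfl⟩ := hx
      have hx : c * v ∈ M := mul_mem (h.exp.mem hc) (h.word_mem hv)
      induction hy using Submodule.span_induction with
      | mem y hy =>
        obtain ⟨d, hd, w, hw, rfl⟩ := hy
        refine ⟨φ (star c * d) * φ (star v * w), ?_⟩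
        rw [show star (c * v) * (d * w) = star v * (star c * d) * w by
          rw [star_mul]; simp only [mul_assoc]]
        exact h.exp_mul_mul (h.star_word hv) hw (mul_mem (star_mem hc) hd)
      | zero => exact ⟨0, by rw [mul_zero, h.exp.map_zero, zero_smul]⟩
      | add y z hy' hz' hy hz =>
        obtain ⟨⟨a, ha⟩, b, hb⟩ := hy, hz
        exact ⟨a + b, by
          rw [mul_add, h.exp.map_add' _ (mul_mem (star_mem hx) (h.freeModule_mem hy')) _
            (mul_mem (star_mem hx) (h.freeModule_mem hz')), ha, hb, add_smul]⟩
      | smul a y hy' hy =>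
        obtain ⟨b, hb⟩ := hy
        exact ⟨a * b, by
          rw [mul_smul_comm, h.exp.map_smul' _ _ (mul_mem (star_mem hx) (h.freeModule_mem hy')),
            hb, smul_smul]⟩
    | zero => exact ⟨0, by rw [star_zero, zero_mul, h.exp.map_zero, zero_smul]⟩
    | add x z hx' hz' hx hz =>
      obtain ⟨⟨a, ha⟩, b, hb⟩ := hx, hz
      have hy' := h.freeModule_mem hy
      exact ⟨a + b, by
        rw [star_add, add_mul, h.exp.map_add' _ (mul_mem (star_mem (h.freeModule_mem hx')) hy') _
          (mul_mem (star_mem (h.freeModule_mem hz')) hy'), ha, hb, add_smul]⟩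
    | smul a x hx' hx =>
      obtain ⟨b, hb⟩ := hx
      exact ⟨star a * b, by
        rw [star_smul, smul_mul_assoc, h.exp.map_smul' _ _
          (mul_mem (star_mem (h.freeModule_mem hx')) (h.freeModule_mem hy)), hb, smul_smul]⟩
  obtain ⟨c, hc⟩ := key
  rw [← h.inv _ (mul_mem (star_mem (h.freeModule_mem hx)) (h.freeModule_mem hy)), hc,
    h.plf.map_smul _ _ (one_mem M), h.one, mul_one]

theorem FreeExp.exp_mul_star (h : FreeExp M N P φ φN φP E) {x y c : Op H}
    (hx : x ∈ freeModule N P φ) (hy : y ∈ freeModule N P φ) (hc : Centered N φ c) :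
    E (x * c * star y) = 0 := by
  have hcM := h.exp.mem hc.1
  induction hx using Submodule.span_induction with
  | mem x hx =>
    obtain ⟨a, ha, v, hv, rfl⟩ := hx
    have hx : a * v ∈ M := mul_mem (h.exp.mem ha) (h.word_mem hv)
    induction hy using Submodule.span_induction with
    | mem y hy =>
      obtain ⟨d, hd, w, hw, rfl⟩ := hy
      have hw' := hv.append hc (h.star_word hw)
      rw [show a * v * c * star (d * w) = a * (v * c * star w) * star d by
          rw [star_mul]; simp only [mul_assoc], h.exp.bimod' a ha _ (h.word_mem hw') _
          (star_mem hd), h.exp_word hw', mul_zero, zero_mul]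
    | zero => rw [star_zero, mul_zero, h.exp.map_zero]
    | add y z hy' hz' hy hz =>
      rw [star_add, mul_add, h.exp.map_add' _
        (mul_mem (mul_mem hx hcM) (star_mem (h.freeModule_mem hy'))) _
        (mul_mem (mul_mem hx hcM) (star_mem (h.freeModule_mem hz'))), hy, hz, add_zero]
    | smul a y hy' hy =>
      rw [star_smul, mul_smul_comm, h.exp.map_smul' _ _
        (mul_mem (mul_mem hx hcM) (star_mem (h.freeModule_mem hy'))), hy, smul_zero]
  | zero => rw [zero_mul, zero_mul, h.exp.map_zero]
  | add x z hx' hz' hx hz =>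
    have hy' := star_mem (h.freeModule_mem hy)
    rw [add_mul, add_mul, h.exp.map_add' _ (mul_mem (mul_mem (h.freeModule_mem hx') hcM) hy') _
      (mul_mem (mul_mem (h.freeModule_mem hz') hcM) hy'), hx, hz, add_zero]
  | smul a x hx' hx =>
    rw [smul_mul_assoc, smul_mul_assoc, h.exp.map_smul' _ _
      (mul_mem (mul_mem (h.freeModule_mem hx') hcM) (star_mem (h.freeModule_mem hy))), hx,
      smul_zero]

/-- The algebra generated by `N` and `P`. -/
def freeAlgebra (N P : VonNeumannAlgebra H) (φ : Op H → ℂ) : Submodule ℂ (Op H) :=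
  Submodule.span ℂ ((N : Set (Op H)) ∪
    {x | ∃ c ∈ N, ∃ w, Word N P φ w ∧ ∃ d ∈ N, x = c * w * d})

theorem mem_freeAlgebra_of_mem {c : Op H} (hc : c ∈ N) : c ∈ freeAlgebra N P φ :=
  Submodule.subset_span (.inl hc)

theorem Word.mem_freeAlgebra {c w d : Op H} (hw : Word N P φ w) (hc : c ∈ N) (hd : d ∈ N) :
    c * w * d ∈ freeAlgebra N P φ :=
  Submodule.subset_span (.inr ⟨c, hc, w, hw, d, hd, rfl⟩)

theorem mul_mul_mem_freeAlgebra {c x d : Op H} (hc : c ∈ N) (hx : x ∈ freeAlgebra N P φ)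
    (hd : d ∈ N) : c * x * d ∈ freeAlgebra N P φ := by
  induction hx using Submodule.span_induction with
  | mem x hx =>
    obtain hx | ⟨a, ha, w, hw, b, hb, rfl⟩ := hx
    · exact mem_freeAlgebra_of_mem (mul_mem (mul_mem hc hx) hd)
    · rw [show c * (a * w * b) * d = (c * a) * w * (b * d) by simp only [mul_assoc]]
      exact hw.mem_freeAlgebra (mul_mem hc ha) (mul_mem hb hd)
  | zero => simp
  | add x y _ _ hx hy => rw [mul_add, add_mul]; exact add_mem hx hy
  | smul a x _ hx =>
    rw [mul_smul_comm, smul_mul_assoc]; exact Submodule.smul_mem _ _ hx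

theorem wordSpan_le : wordSpan N P φ ≤ freeAlgebra N P φ := by
  refine Submodule.span_le.2 ?_
  rintro _ ((rfl | ⟨c, hc, w, hw, rfl⟩) | ⟨c, hc, w, hw, rfl⟩)
  · exact mem_freeAlgebra_of_mem (one_mem N)
  · simpa using hw.mem_freeAlgebra hc (one_mem N)
  · simpa using hw.mem_freeAlgebra (one_mem N) hc

theorem FreeExp.freeAlgebra_mul (h : FreeExp M N P φ φN φP E) {x y : Op H}
    (hx : x ∈ freeAlgebra N P φ) (hy : y ∈ freeAlgebra N P φ) : x * y ∈ freeAlgebra N P φ := by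
  induction hx using Submodule.span_induction with
  | mem x hx =>
    obtain hx | ⟨a, ha, v, hv, b, hb, rfl⟩ := hx
    · simpa using mul_mul_mem_freeAlgebra hx hy (one_mem N)
    · induction hy using Submodule.span_induction with
      | mem y hy =>
        obtain hy | ⟨c, hc, w, hw, d, hd, rfl⟩ := hy
        · rw [mul_assoc]
          exact hv.mem_freeAlgebra ha (mul_mem hb hy)
        · have hbc := h.plf.sub_centered h.one h.free.subN (mul_mem hb hc)
          have : a * v * b * (c * w * d) =
              a * (v * (b * c - φ (b * c) • 1) * w + φ (b * c) • (v * w)) * d := by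
            simp only [mul_sub, sub_mul, mul_smul_comm, smul_mul_assoc, mul_one, sub_add_cancel,
              mul_assoc]
          rw [this]
          exact mul_mul_mem_freeAlgebra ha (wordSpan_le (add_mem (hv.append hbc hw).mem_wordSpan
            (Submodule.smul_mem _ _ (h.mul_mem_wordSpan hv hw)))) hd
      | zero => simp
      | add y z _ _ hy hz => rw [mul_add]; exact add_mem hy hz
      | smul a y _ hy => rw [mul_smul_comm]; exact Submodule.smul_mem _ _ hy
  | zero => simp
  | add x z _ _ hx hz => rw [add_mul]; exact add_mem hx hz
  | smul a x _ hx => rw [smul_mul_assoc]; exact Submodule.smul_mem _ _ hx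

theorem FreeExp.freeAlgebra_star (h : FreeExp M N P φ φN φP E) {x : Op H}
    (hx : x ∈ freeAlgebra N P φ) : star x ∈ freeAlgebra N P φ := by
  induction hx using Submodule.span_induction with
  | mem x hx =>
    obtain hx | ⟨c, hc, w, hw, d, hd, rfl⟩ := hx
    · exact mem_freeAlgebra_of_mem (star_mem hx)
    · rw [star_mul, star_mul, ← mul_assoc]
      exact (h.star_word hw).mem_freeAlgebra (star_mem hd) (star_mem hc)
  | zero => simp
  | add x y _ _ hx hy => rw [star_add]; exact add_mem hx hy
  | smul a x _ hx => rw [star_smul]; exact Submodule.smul_mem _ _ hx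

theorem FreeExp.freeAlgebra_mem (h : FreeExp M N P φ φN φP E) {x : Op H}
    (hx : x ∈ freeAlgebra N P φ) : x ∈ M := by
  induction hx using Submodule.span_induction with
  | mem x hx =>
    obtain hx | ⟨c, hc, w, hw, d, hd, rfl⟩ := hx
    · exact h.exp.mem hx
    · exact mul_mem (mul_mem (h.exp.mem hc) (h.word_mem hw)) (h.exp.mem hd)
  | zero => exact zero_mem M
  | add x y _ _ hx hy => exact add_mem hx hy
  | smul a x _ hx => exact smul_memV a hx

/-- A normal functional on a free product vanishes as soon as it vanishes on reduced words. -/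
theorem FreeExp.eq_zero (h : FreeExp M N P φ φN φP E) {F : Op H → ℂ} (hF : WFOn M F)
    (hadd : ∀ x ∈ M, ∀ y ∈ M, F (x + y) = F x + F y) (hsmul : ∀ (c : ℂ), ∀ x ∈ M, F (c • x) = c * F x)
    (h0 : ∀ c ∈ N, F c = 0) (h1 : ∀ k ∈ freeModule N P φ, F k = 0)
    (h2 : ∀ k ∈ freeModule N P φ, ∀ c, Centered N φ c → F (k * c) = 0) {f : Op H} (hf : f ∈ M) :
    F f = 0 := by
  refine hF.eq_zero (freeAlgebra N P φ) (fun a ha => h.freeAlgebra_mem ha)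
    (mem_freeAlgebra_of_mem (one_mem N)) (fun a ha b hb => h.freeAlgebra_mul ha hb)
    (fun a ha => h.freeAlgebra_star ha) (fun a ha => ?_) hf ?_
  · induction ha using Submodule.span_induction with
    | mem x hx =>
      obtain hx | ⟨c, hc, w, hw, d, hd, rfl⟩ := hx
      · exact h0 x hx
      · have hk : c * w ∈ freeModule N P φ := Submodule.subset_span ⟨c, hc, w, hw, rfl⟩
        have hkM := h.freeModule_mem hk
        have hcc := h.plf.sub_centered h.one h.free.subN hd
        have : c * w * d = c * w * (d - φ d • 1) + φ d • (c * w) := by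
          rw [mul_sub, mul_smul_comm, mul_one, sub_add_cancel]
        rw [this, hadd _ (mul_mem hkM (h.exp.mem hcc.1)) _ (smul_memV _ hkM), hsmul _ _ hkM,
          h1 _ hk, h2 _ hk _ hcc, mul_zero, add_zero]
    | zero => exact h0 0 (zero_mem N)
    | add x y hx' hy' hx hy =>
      rw [hadd _ (h.freeAlgebra_mem hx') _ (h.freeAlgebra_mem hy'), hx, hy, add_zero]
    | smul a x hx' hx => rw [hsmul _ _ (h.freeAlgebra_mem hx'), hx, mul_zero]
  · have hf' : f ∈ (M : Set (Op H)) := hf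
    rw [← h.free.generates] at hf'
    refine Set.centralizer_subset (Set.centralizer_subset ?_) hf'
    rintro x (hx | hx)
    · exact mem_freeAlgebra_of_mem hx
    · have hc := h.plf.sub_centered h.one h.free.subP hx
      have := add_mem (wordSpan_le (Word.base (N := N) hc).mem_wordSpan)
        (Submodule.smul_mem _ (φ x) (mem_freeAlgebra_of_mem (P := P) (φ := φ) (one_mem N)))
      rwa [sub_add_cancel] at this

end FreeProduct

section Compact

/-- The sums of diagonal entries of `A` over finite orthonormal families in `D` are bounded
by `C`. -/
def TraceBoundedOn (D : Submodule ℂ H) (A : Op H) (C : ℝ) : Prop :=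
  ∀ s : Finset H, (∀ e ∈ s, e ∈ D ∧ ‖e‖ = 1) →
    ((s : Set H).Pairwise fun a b => ⟪a, b⟫_ℂ = 0) → ∑ e ∈ s, (⟪e, A e⟫_ℂ).re ≤ C

/-- Outside of a finite dimensional subspace, a trace bounded operator is small. -/
theorem TraceBoundedOn.exists_small {D : Submodule ℂ H} {A : Op H} {C : ℝ}
    (h : TraceBoundedOn D A C) {ε : ℝ} (hε : 0 < ε) : ∃ s : Finset H, (∀ e ∈ s, e ∈ D) ∧
      ∀ u ∈ D, (∀ e ∈ s, ⟪e, u⟫_ℂ = 0) → (⟪u, A u⟫_ℂ).re ≤ ε * ‖u‖ ^ 2 := by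
  set T : Set ℝ := {t | ∃ s : Finset H, (∀ e ∈ s, e ∈ D ∧ ‖e‖ = 1) ∧
    ((s : Set H).Pairwise fun a b => ⟪a, b⟫_ℂ = 0) ∧ ∑ e ∈ s, (⟪e, A e⟫_ℂ).re = t} with hT
  have hne : T.Nonempty := ⟨0, ∅, by simp, by simp, by simp⟩
  have hb : BddAbove T := ⟨C, by rintro t ⟨s, h1, h2, rfl⟩; exact h s h1 h2⟩
  obtain ⟨t, ⟨s, h1, h2, rfl⟩, ht⟩ := exists_lt_of_lt_csSup hne (sub_lt_self (sSup T) hε)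
  refine ⟨s, fun e he => (h1 e he).1, fun u hu hs => ?_⟩
  obtain rfl | hu0 := eq_or_ne u 0
  · simp
  classical
  set c : ℂ := ((‖u‖⁻¹ : ℝ) : ℂ) with hc
  have hn : 0 < ‖u‖ := norm_pos_iff.2 hu0
  have hu1 : ‖c • u‖ = 1 := by
    rw [norm_smul, hc, Complex.norm_real, norm_inv, norm_norm, inv_mul_cancel₀ hn.ne']
  have horth : ∀ e ∈ s, ⟪e, c • u⟫_ℂ = 0 := fun e he => by rw [inner_smul_right, hs e he, mul_zero]
  have hnot : c • u ∉ s := fun hm => by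
    have := inner_self_eq_zero.1 (horth _ hm)
    rw [this, norm_zero] at hu1
    exact zero_ne_one hu1
  have hmem : ∑ e ∈ insert (c • u) s, (⟪e, A e⟫_ℂ).re ∈ T := by
    refine ⟨insert (c • u) s, fun e he => ?_, ?_, rfl⟩
    · obtain rfl | he := Finset.mem_insert.1 he
      · exact ⟨D.smul_mem _ hu, hu1⟩
      · exact h1 e he
    · rw [Finset.coe_insert, Set.pairwise_insert]
      exact ⟨h2, fun e he _ => ⟨inner_eq_zero_symm.1 (horth e he), horth e he⟩⟩
  have := le_csSup hb hmem
  rw [Finset.sum_insert hnot] at this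
  have h3 : (⟪c • u, A (c • u)⟫_ℂ).re = (‖u‖ ^ 2)⁻¹ * (⟪u, A u⟫_ℂ).re := by
    rw [_root_.map_smul, inner_smul_left, inner_smul_right, hc, Complex.conj_ofReal,
      Complex.re_ofReal_mul, Complex.re_ofReal_mul]
    field_simp
  rw [h3] at this
  have h4 : (‖u‖ ^ 2)⁻¹ * (⟪u, A u⟫_ℂ).re ≤ ε := by linarith
  rwa [inv_mul_le_iff₀ (by positivity), mul_comm] at h4

/-- A positive operator whose diagonal sums are bounded is compact. -/
theorem TraceBoundedOn.isCompactOperator {D : Submodule ℂ H} {A : Op H} {C : ℝ}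
    (h : TraceBoundedOn D A C) (h0 : 0 ≤ A) (hA : A * clProj D = A) : IsCompactOperator A := by
  have hcl := isClosed_setOfPred_isCompactOperator (𝕜₁ := ℂ) (σ₁₂ := RingHom.id ℂ) (M₁ := H) (M₂ := H)
  refine hcl.closure_subset_iff.2 subset_rfl (Metric.mem_closure_iff.2 fun ε hε => ?_)
  obtain ⟨S, hS0, hSs, hS⟩ : ∃ S : Op H, 0 ≤ S ∧ star S = S ∧ S * S = A :=
    ⟨CFC.sqrt A, CFC.sqrt_nonneg A, (CFC.sqrt_nonneg A).isSelfAdjoint, CFC.sqrt_mul_sqrt_self A⟩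
  set δ : ℝ := ε / (2 * (‖S‖ + 1)) with hδ
  have hδ0 : 0 < δ := by positivity
  obtain ⟨s, hsD, hs⟩ := h.exists_small (ε := δ ^ 2) (by positivity)
  set W : Submodule ℂ H := Submodule.span ℂ (s : Set H) with hW
  have hWD : W ≤ D := Submodule.span_le.2 hsD
  set Q : Op H := 1 - W.starProjection with hQ
  have hQW : ∀ u, ∀ w ∈ W, ⟪w, Q u⟫_ℂ = 0 := fun u w hw => by
    have := Submodule.sub_starProjection_mem_orthogonal (K := W) u
    exact (Submodule.mem_orthogonal W _).1 this w hw
  have hQ1 : ‖Q‖ ≤ 1 := by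
    have h1 : IsStarProjection Q := (isStarProjection_starProjection (U := W)).one_sub
    exact h1.norm_le
  have hSQ : ∀ u, ‖S (Q u)‖ ≤ δ * ‖u‖ := by
    have hform : ∀ u : H, (⟪u, A u⟫_ℂ).re = ‖S u‖ ^ 2 := fun u => by
      rw [← hS, mul_app]
      nth_rw 1 [← hSs]
      rw [← inner_star_left, star_star, inner_self_eq_norm_sq_to_K]
      norm_cast
    have hD : ∀ u ∈ D, ‖S (Q u)‖ ≤ δ * ‖u‖ := by
      intro u hu
      have h1 := hs (Q u) (D.sub_mem hu (hWD (Submodule.starProjection_apply_mem W u)))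
        fun e he => hQW u e (Submodule.subset_span he)
      have h2 : ‖Q u‖ ≤ ‖u‖ := by
        simpa using (Q.le_opNorm u).trans (mul_le_mul_of_nonneg_right hQ1 (norm_nonneg u))
      rw [hform, ← mul_pow] at h1
      exact (abs_le_of_sq_le_sq' h1 (by positivity)).2.trans (by gcongr)
    have hcl' : ∀ u ∈ D.topologicalClosure, ‖S (Q u)‖ ≤ δ * ‖u‖ := fun u hu =>
      closure_minimal (s := (D : Set H)) (t := {u | ‖S (Q u)‖ ≤ δ * ‖u‖}) hD
        (isClosed_le (by fun_prop) (by fun_prop)) hu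
    intro u
    have hSD : ∀ z : H, clProj D z = 0 → S z = 0 := fun z hz => by
      have : A z = 0 := by rw [← hA, mul_app, hz, _root_.map_zero]
      have h2 := hform z
      rw [this, inner_zero_right, Complex.zero_re] at h2
      exact norm_eq_zero.1 (pow_eq_zero_iff two_ne_zero |>.1 h2.symm)
    have hdec : S (Q u) = S (Q (clProj D u)) := by
      rw [← sub_eq_zero, ← map_sub, ← map_sub]
      refine hSD _ ?_
      have h3 : ∀ w ∈ W, clProj D w = w := fun w hw => clProj_of_mem (hWD hw)
      have h4 : clProj D (u - clProj D u) = 0 := by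
        rw [map_sub, ← mul_app, clProj_mul_self, sub_self]
      rw [hQ, sub_apply, map_sub, one_apply_eq_self, h4, h3 _ (Submodule.starProjection_apply_mem W _),
        zero_sub, neg_eq_zero]
      rw [Submodule.starProjection_apply_eq_zero_iff, Submodule.mem_orthogonal]
      intro w hw
      rw [← h3 w hw, inner_clProj, h4, inner_zero_right]
    rw [hdec]
    refine (hcl' _ (clProj_mem_closure D u)).trans ?_
    gcongr
    simpa using ((clProj D).le_opNorm u).trans (mul_le_mul_of_nonneg_right (norm_clProj_le D) (norm_nonneg u))
  refine ⟨A * W.starProjection, ?_, ?_⟩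
  · have h1 : IsCompactOperator (W.orthogonalProjectionOnto) :=
      isCompactOperator_of_locallyCompactSpace_dom W.orthogonalProjectionOnto
    exact h1.clm_comp (A ∘L W.subtypeL)
  · rw [dist_eq_norm, ← mul_one_sub A, ← hQ, ← hS, mul_assoc]
    refine (norm_mul_le _ _).trans_lt ?_
    have h1 : ‖S * Q‖ ≤ δ := ContinuousLinearMap.opNorm_le_bound _ hδ0.le hSQ
    calc ‖S‖ * ‖S * Q‖ ≤ ‖S‖ * δ := by gcongr
      _ ≤ (‖S‖ + 1) * δ := by gcongr; linarith
      _ = ε / 2 := by rw [hδ]; field_simp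
      _ < ε := by linarith

/-- A nonzero positive compact operator has a common eigenvector with any commuting operator. -/
theorem exists_common_eigenvector {A B : Op H} (hA : IsCompactOperator A) (h0 : 0 ≤ A)
    (hne : A ≠ 0) (hAB : A * B = B * A) :
    ∃ (e : H) (k : ℝ) (b : ℂ), e ≠ 0 ∧ 0 < k ∧ A e = (k : ℂ) • e ∧ B e = b • e := by
  have : Nontrivial (Op H) := ⟨A, 0, hne⟩
  have hk : 0 < ‖A‖ := norm_pos_iff.2 hne
  have hk0 : ((‖A‖ : ℝ) : ℂ) ≠ 0 := Complex.ofReal_ne_zero.2 hk.ne'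
  have hev : Module.End.HasEigenvalue (A : Module.End ℂ H) ((‖A‖ : ℝ) : ℂ) := by
    rw [hA.hasEigenvalue_iff_mem_spectrum hk0]
    have := CStarAlgebra.norm_mem_spectrum_of_nonneg h0
    exact spectrum.algebraMap_mem ℂ this
  set V : Submodule ℂ H := Module.End.eigenspace (A : Module.End ℂ H) ((‖A‖ : ℝ) : ℂ) with hV
  have hVm : ∀ v, v ∈ V ↔ A v = ((‖A‖ : ℝ) : ℂ) • v := fun v => Module.End.mem_eigenspace_iff
  have hVc : IsClosed (V : Set H) := by
    have : (V : Set H) = {v | A v = ((‖A‖ : ℝ) : ℂ) • v} := Set.ext hVm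
    rw [this]
    exact isClosed_eq (by fun_prop) (by fun_prop)
  have hcV : CompleteSpace V := hVc.completeSpace_coe
  have hfin : FiniteDimensional ℂ V := by
    have hmap : ∀ v ∈ V, (A : H →ₗ[ℂ] H) v ∈ V := fun v hv => by
      rw [ContinuousLinearMap.coe_coe, (hVm v).1 hv]; exact V.smul_mem _ hv
    have h1 := (IsCompactOperator.restrict' (f := (A : H →ₗ[ℂ] H)) hA hmap).smul
      (((‖A‖ : ℝ) : ℂ)⁻¹)
    refine FiniteDimensional.of_isCompactOperator_id (𝕜 := ℂ) ?_
    have h2 : (id : V → V) = (((‖A‖ : ℝ) : ℂ)⁻¹) • ⇑((A : H →ₗ[ℂ] H).restrict hmap) := by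
      funext v
      ext
      change (v : H) = ((‖A‖ : ℝ) : ℂ)⁻¹ • A v
      rw [(hVm v).1 v.2, smul_smul, inv_mul_cancel₀ hk0, one_smul]
    rw [h2]
    exact h1
  have hnt : Nontrivial V := (Submodule.nontrivial_iff_ne_bot).2 hev
  have hBV : ∀ v ∈ V, (B : H →ₗ[ℂ] H) v ∈ V := fun v hv => by
    rw [hVm, ContinuousLinearMap.coe_coe, ← mul_app, hAB, mul_app, (hVm v).1 hv, _root_.map_smul]
  obtain ⟨b, hb⟩ := Module.End.exists_eigenvalue ((B : H →ₗ[ℂ] H).restrict hBV)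
  obtain ⟨v, hv⟩ := hb.exists_hasEigenvector
  refine ⟨v, ‖A‖, b, fun h => hv.2 (Subtype.ext h), hk, (hVm v).1 v.2, ?_⟩
  exact congrArg Subtype.val hv.apply_eq_smul

end Compact

section Bessel
variable {M N P : VonNeumannAlgebra H} {φ φN φP ψ : Op H → ℂ} {E : Op H → Op H}

theorem IsNormalPLF.smul (h : IsNormalPLF N ψ) {c : ℂ} (hc : 0 ≤ c) :
    IsNormalPLF N fun x => c * ψ x where
  map_add x hx y hy := by rw [h.map_add x hx y hy, mul_add]
  map_smul a x hx := by rw [h.map_smul a x hx, mul_left_comm]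
  pos x hx := mul_nonneg hc (h.pos x hx)
  normal ι p q hp hq ho hs := (h.normal ι p q hp hq ho hs).mul_left c

/-- The composition of a normal functional with a conditional expectation is normal. -/
theorem IsCondExp.comp_normal (hE : IsCondExp M N E) (h : IsNormalPLF N ψ) :
    IsNormalPLF M fun x => ψ (E x) := by
  have h1 : 0 ≤ ψ 1 := by simpa using h.pos 1 (one_mem N)
  obtain h0 | h0 := eq_or_ne (ψ 1) 0
  · have hz : ∀ x ∈ N, ψ x = 0 := fun x hx => by
      have := h.toIsPLF.norm_le hx
      rw [h0, Complex.zero_re, zero_mul] at this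
      exact norm_le_zero_iff.1 this
    have hz' : ∀ x ∈ M, ψ (E x) = 0 := fun x hx => hz _ (hE.mem' x hx)
    refine ⟨⟨fun x hx y hy => ?_, fun c x hx => ?_, fun x hx => ?_⟩, fun ι p q hp hq ho hs => ?_⟩
    · rw [hz' _ (add_mem hx hy), hz' _ hx, hz' _ hy, add_zero]
    · rw [hz' _ (smul_memV c hx), hz' _ hx, mul_zero]
    · rw [hz' _ (mul_mem (star_mem hx) hx)]
    · simp only [hz' _ (hp _).1, hz' _ hq.1]
      exact hasSum_zero
  · have h2 : IsNormalState N fun x => (ψ 1)⁻¹ * ψ x :=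
      ⟨h.smul (inv_nonneg.2 h1), inv_mul_cancel₀ h0⟩
    have h3 := (hE.normal' _ h2).1.smul h1
    simpa only [mul_inv_cancel_left₀ h0] using h3

theorem IsCondExp.map_sub (hE : IsCondExp M N E) {x y : Op H} (hx : x ∈ M) (hy : y ∈ M) :
    E (x - y) = E x - E y := by
  have := hE.map_smul' (-1) y hy
  rw [sub_eq_add_neg, ← neg_one_smul ℂ y, hE.map_add' x hx _ (smul_memV _ hy), this, neg_one_smul,
    ← sub_eq_add_neg]

theorem IsCondExp.map_sum (hE : IsCondExp M N E) {κ : Type*} (s : Finset κ) {f : κ → Op H}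
    (hf : ∀ i ∈ s, f i ∈ M) : E (∑ i ∈ s, f i) = ∑ i ∈ s, E (f i) := by
  classical
  induction s using Finset.induction_on with
  | empty => simpa using hE.map_zero
  | insert a s ha ih =>
    rw [Finset.sum_insert ha, Finset.sum_insert ha, hE.map_add' _ (hf _ (Finset.mem_insert_self _ _))
      _ (sum_mem fun i hi => hf i (Finset.mem_insert_of_mem hi)),
      ih fun i hi => hf i (Finset.mem_insert_of_mem hi)]

theorem IsCondExp.nonneg (hE : IsCondExp M N E) {x : Op H} (hx : x ∈ M) : 0 ≤ E (star x * x) :=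
  (ContinuousLinearMap.nonneg_iff_isPositive _).2 <| hE.pos' _ (mul_mem (star_mem hx) hx)
    ((ContinuousLinearMap.nonneg_iff_isPositive _).1 (star_mul_self_nonneg x))

/-- Bessel's inequality for the `N`-valued inner product. -/
theorem FreeExp.bessel (h : FreeExp M N P φ φN φP E) {v : Op H} (hv : v ∈ M) {κ : Type*}
    (s : Finset κ) {f : κ → Op H} (hf : ∀ i ∈ s, f i ∈ freeModule N P φ)
    (h1 : ∀ i ∈ s, φ (star (f i) * f i) = 1)
    (h2 : ∀ i ∈ s, ∀ j ∈ s, i ≠ j → φ (star (f i) * f j) = 0) :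
    ∑ i ∈ s, E (star v * f i) * star (E (star v * f i)) ≤ E (star v * v) := by
  classical
  have hE := h.exp
  have hfM : ∀ i ∈ s, f i ∈ M := fun i hi => h.freeModule_mem (hf i hi)
  have hvf : ∀ i ∈ s, star v * f i ∈ M := fun i hi => mul_mem (star_mem hv) (hfM i hi)
  set S : κ → Op H := fun i => E (star v * f i) with hS
  have hSN : ∀ i ∈ s, S i ∈ N := fun i hi => hE.mem' _ (hvf i hi)
  have hfS : ∀ i ∈ s, f i * star (S i) ∈ M := fun i hi =>
    mul_mem (hfM i hi) (hE.mem (star_mem (hSN i hi)))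
  set g : Op H := ∑ i ∈ s, f i * star (S i) with hg
  have hgM : g ∈ M := sum_mem hfS
  set R : Op H := ∑ i ∈ s, S i * star (S i) with hR
  have hvg : E (star v * g) = R := by
    rw [hg, Finset.mul_sum, hE.map_sum _ fun i hi => mul_mem (star_mem hv) (hfS i hi)]
    refine Finset.sum_congr rfl fun i hi => ?_
    rw [← mul_assoc, hE.map_mul_right (hvf i hi) (star_mem (hSN i hi))]
  have hRs : star R = R := by simp [hR, star_sum]
  have hgv : E (star g * v) = R := by
    rw [← hRs, ← hvg, ← hE.map_star' _ (mul_mem (star_mem hv) hgM), star_mul, star_star]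
  have hfg : ∀ i ∈ s, E (star (f i) * g) = star (S i) := fun i hi => by
    rw [hg, Finset.mul_sum, hE.map_sum _ fun j hj => mul_mem (star_mem (hfM i hi)) (hfS j hj),
      Finset.sum_eq_single_of_mem i hi fun j hj hij => ?_]
    · rw [← mul_assoc, hE.map_mul_right (mul_mem (star_mem (hfM i hi)) (hfM i hi))
        (star_mem (hSN i hi)), h.exp_star_mul (hf i hi) (hf i hi), h1 i hi, one_smul, one_mul]
    · rw [← mul_assoc, hE.map_mul_right (mul_mem (star_mem (hfM i hi)) (hfM j hj))
        (star_mem (hSN j hj)), h.exp_star_mul (hf i hi) (hf j hj), h2 i hi j hj hij.symm, zero_smul,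
        zero_mul]
  have hgg : E (star g * g) = R := by
    conv_lhs => rw [hg, star_sum, Finset.sum_mul]
    rw [hE.map_sum _ fun i hi => mul_mem (star_mem (hfS i hi)) hgM]
    refine Finset.sum_congr rfl fun i hi => ?_
    rw [star_mul, star_star, mul_assoc,
      hE.map_mul_left (hSN i hi) (mul_mem (star_mem (hfM i hi)) hgM), hfg i hi]
  have hpos := hE.nonneg (sub_mem hv hgM)
  rw [star_sub, sub_mul, mul_sub, mul_sub,
    hE.map_sub (sub_mem (mul_mem (star_mem hv) hv) (mul_mem (star_mem hv) hgM))
      (sub_mem (mul_mem (star_mem hgM) hv) (mul_mem (star_mem hgM) hgM)),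
    hE.map_sub (mul_mem (star_mem hv) hv) (mul_mem (star_mem hv) hgM),
    hE.map_sub (mul_mem (star_mem hgM) hv) (mul_mem (star_mem hgM) hgM), hvg, hgv, hgg, sub_self,
    sub_zero] at hpos
  exact sub_nonneg.1 hpos

/-- The coefficients of `v` against the free module are bounded in the `L²`-norm. -/
theorem FreeExp.coeff_bound (h : FreeExp M N P φ φN φP E) {v : Op H} (hv : v ∈ M) :
    ∃ C : ℝ, 0 ≤ C ∧ ∀ f ∈ freeModule N P φ,
      ‖E (star v * f)‖ ^ 2 ≤ C ^ 2 * (φ (star f * f)).re := by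
  refine ⟨√‖E (star v * v)‖, Real.sqrt_nonneg _, fun f hf => ?_⟩
  rw [Real.sq_sqrt (norm_nonneg _)]
  have hfM := h.freeModule_mem hf
  obtain h0 | h0 := eq_or_ne (φ (star f * f)) 0
  · rw [h.state.2 f hfM h0, mul_zero, mul_zero, h.exp.map_zero, h.plf.map_zero]
    simp
  have h1 : φ (star f * f) = (((φ (star f * f)).re : ℝ) : ℂ) := Complex.eq_re_of_ofReal_le
    (r := 0) (by simpa using h.plf.pos f hfM)
  set r := (φ (star f * f)).re with hr
  have hr0 : 0 < r := by
    refine lt_of_le_of_ne (h.plf.re_nonneg hfM) fun h2 => h0 ?_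
    rw [h1, ← h2, Complex.ofReal_zero]
  set c : ℂ := (((√r)⁻¹ : ℝ) : ℂ) with hc
  have hcf : c • f ∈ freeModule N P φ := Submodule.smul_mem _ _ hf
  have hcc : conj c * c = ((r⁻¹ : ℝ) : ℂ) := by
    rw [hc, Complex.conj_ofReal, ← Complex.ofReal_mul, ← mul_inv, Real.mul_self_sqrt hr0.le]
  have := h.bessel hv (κ := Unit) {()} (f := fun _ => c • f) (fun _ _ => hcf) (fun _ _ => by
    rw [star_smul, smul_mul_smul_comm, h.plf.map_smul _ _ (mul_mem (star_mem hfM) hfM), h1]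
    change conj c * c * _ = 1
    rw [hcc, ← Complex.ofReal_mul, inv_mul_cancel₀ hr0.ne', Complex.ofReal_one])
    (fun i _ j _ hij => absurd (Subsingleton.elim i j) hij)
  rw [Finset.sum_singleton] at this
  have h3 := CStarAlgebra.norm_le_norm_of_nonneg_of_le (mul_star_self_nonneg _) this
  rw [CStarRing.norm_self_mul_star, mul_smul_comm, h.exp.map_smul' _ _ (mul_mem (star_mem hv) hfM),
    norm_smul, hc, Complex.norm_real, Real.norm_of_nonneg (by positivity)] at h3
  have h4 : (√r)⁻¹ * ‖E (star v * f)‖ * ((√r)⁻¹ * ‖E (star v * f)‖) =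
      r⁻¹ * ‖E (star v * f)‖ ^ 2 := by
    rw [show r⁻¹ = (√r)⁻¹ * (√r)⁻¹ by rw [← mul_inv, Real.mul_self_sqrt hr0.le]]
    ring
  rw [h4, inv_mul_le_iff₀ hr0] at h3
  linarith

end Bessel

section Crossing
variable {M N P : VonNeumannAlgebra H} {φ φN φP ψ ψ₁ : Op H → ℂ} {E : Op H → Op H} {v : Op H} {l : ℝ}
  {ι : Type} {ζ : Amp ι H}

/-- An element `v` orthogonal to `N` which intertwines `ψ₁ ∘ E` and `ψ ∘ E`. -/
structure Crossing (M N P : VonNeumannAlgebra H) (φ φN φP : Op H → ℂ) (E : Op H → Op H)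
    (ψ ψ₁ : Op H → ℂ) (v : Op H) (l : ℝ) : Prop extends FreeExp M N P φ φN φP E where
  normal : IsNormalPLF N ψ
  normal₁ : IsNormalPLF N ψ₁
  mem : v ∈ M
  exp_eq : E v = 0
  pos : 0 < l
  rel : ∀ x ∈ M, ψ₁ (E (v * x)) = (l : ℂ) * ψ (E (x * v))

theorem Crossing.rel_star (h : Crossing M N P φ φN φP E ψ ψ₁ v l) {z : Op H} (hz : z ∈ M) :
    (l : ℂ) * ψ (E (star v * z)) = ψ₁ (E (z * star v)) := by
  have h1 := congrArg conj (h.rel (star z) (star_mem hz))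
  rw [map_mul, Complex.conj_ofReal, (h.exp.comp_normal h.normal).toIsPLF.conj_eq
      (mul_mem (star_mem hz) h.mem), (h.exp.comp_normal h.normal₁).toIsPLF.conj_eq
      (mul_mem h.mem (star_mem hz)), star_mul, star_mul, star_star] at h1
  exact h1.symm

/-- The coefficients `E (v* f)` for `f` in the free module. -/
noncomputable def Crossing.coeff (h : Crossing M N P φ φN φP E ψ ψ₁ v l) :
    freeModule N P φ →ₗ[ℂ] Op H where
  toFun f := E (star v * f)
  map_add' f g := by
    rw [Submodule.coe_add, mul_add]
    exact h.exp.map_add' _ (mul_mem (star_mem h.mem) (h.freeModule_mem f.2)) _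
      (mul_mem (star_mem h.mem) (h.freeModule_mem g.2))
  map_smul' c f := by
    rw [Submodule.coe_smul, mul_smul_comm]
    exact h.exp.map_smul' _ _ (mul_mem (star_mem h.mem) (h.freeModule_mem f.2))

theorem Crossing.coeff_apply (h : Crossing M N P φ φN φP E ψ ψ₁ v l) (f : freeModule N P φ) :
    h.coeff f = E (star v * f) := rfl

theorem Crossing.coeff_mem (h : Crossing M N P φ φN φP E ψ ψ₁ v l) (f : freeModule N P φ) :
    h.coeff f ∈ N := h.exp.mem' _ (mul_mem (star_mem h.mem) (h.freeModule_mem f.2))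

theorem inner_ampOrbit (hζ : ∀ x ∈ M, φ x = ⟪ζ, amp ι x ζ⟫_ℂ) {g f : Op H} (hg : g ∈ M)
    (hf : f ∈ M) : ⟪amp ι g ζ, amp ι f ζ⟫_ℂ = φ (star g * f) := by
  rw [hζ _ (mul_mem (star_mem hg) hf), map_mul, StarHomClass.map_star, mul_app, inner_star_right]

/-- Vectors orthogonal to a subspace are orthogonal to its closure. -/
theorem inner_clProj_eq_zero {K : Type} [NormedAddCommGroup K] [InnerProductSpace ℂ K]
    [CompleteSpace K] {U : Submodule ℂ K} {a : K} (h : ∀ u ∈ U, ⟪u, a⟫_ℂ = 0) (t : K) :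
    ⟪clProj U t, a⟫_ℂ = 0 :=
  eq_on_closure (f := fun t => ⟪t, a⟫_ℂ) (g := fun _ => 0) (by fun_prop) (by fun_prop) h
    (clProj_mem_closure U t)

/-- The space of vectors `f* η` for `f` in the free module. -/
noncomputable def adjointOrbit (N P : VonNeumannAlgebra H) (φ : Op H → ℂ) {κ : Type} (η : Amp κ H) :
    Submodule ℂ (Amp κ H) where
  carrier := {t | ∃ f ∈ freeModule N P φ, t = amp κ (star f) η}
  zero_mem' := ⟨0, zero_mem _, by simp⟩
  add_mem' := by
    rintro _ _ ⟨f, hf, rfl⟩ ⟨g, hg, rfl⟩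
    exact ⟨f + g, add_mem hf hg, by rw [star_add, map_add, add_apply]⟩
  smul_mem' := by
    rintro c _ ⟨f, hf, rfl⟩
    exact ⟨conj c • f, Submodule.smul_mem _ _ hf, by
      rw [star_smul, map_smul, smul_apply, Complex.star_def, Complex.conj_conj]⟩

/-- The vector `t` represents the functional `f ↦ ℓ (E (v* f))` on the free module. -/
def Crossing.Represents (h : Crossing M N P φ φN φP E ψ ψ₁ v l) (ζ : Amp ι H) (ℓ : Op H → ℂ)
    (t : Amp ι H) : Prop :=
  (∀ f, ⟪t, ampOrbit (freeModule N P φ) ζ f⟫_ℂ = ℓ (h.coeff f)) ∧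
    clProj (LinearMap.range (ampOrbit (freeModule N P φ) ζ)) t = t

theorem ampOrbit_apply' (A : Submodule ℂ (Op H)) (f : A) : ampOrbit A ζ f = amp ι (f : Op H) ζ := rfl

/-- The cross terms are given by a Gram matrix. -/
theorem Crossing.exists_gram (h : Crossing M N P φ φN φP E ψ ψ₁ v l)
    (hζ : ∀ x ∈ M, φ x = ⟪ζ, amp ι x ζ⟫_ℂ) : ∃ (κ : Type) (r : Op H → Amp κ H),
      ∀ x ∈ N, ∀ y ∈ N, ∀ a b : Amp ι H, h.Represents ζ (fun z => ψ (z * x)) a →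
        h.Represents ζ (fun z => φ (y * z)) b → (l : ℂ) * ⟪a, b⟫_ℂ = ⟪r y, r x⟫_ℂ := by
  have hE := h.exp
  have hψ₁ := hE.comp_normal h.normal₁
  obtain ⟨κ, η, hη⟩ := hψ₁.exists_amp
  set U := adjointOrbit N P φ η with hU
  set r : Op H → Amp κ H := fun x => clProj U (amp κ (x * star v) η) with hr
  refine ⟨κ, r, fun x hx y hy a b ha hb => ?_⟩
  set L := ampOrbit (freeModule N P φ) ζ with hL
  have hv := h.mem
  have hxM := hE.mem hx
  have hηf : ∀ {f : Op H}, f ∈ M → ∀ t : Amp κ H, ⟪η, amp κ f t⟫_ℂ = ⟪amp κ (star f) η, t⟫_ℂ :=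
    fun hf t => by rw [StarHomClass.map_star, inner_star_left]
  have hin : ∀ {f g : Op H}, f ∈ M → g ∈ M →
      ⟪amp κ (star f) η, amp κ g η⟫_ℂ = ψ₁ (E (f * g)) := fun hf hg => by
    rw [hη _ (mul_mem hf hg), map_mul, mul_app, hηf hf]
  set F : Op H → ℂ := fun f => (l : ℂ) * ⟪a, amp ι f ζ⟫_ℂ - ⟪η, amp κ f (r x)⟫_ℂ with hF
  have hWF : WFOn M F := by
    have h1 : WFOn M fun f => ⟪a, amp ι f ζ⟫_ℂ := ⟨ι, a, ζ, fun f _ => rfl⟩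
    have h2 : WFOn M fun f => ⟪η, amp κ f (r x)⟫_ℂ := ⟨κ, η, r x, fun f _ => rfl⟩
    exact (h1.smul l).sub h2
  have hzero : ∀ {g : Op H}, g ∈ M → (∀ f ∈ freeModule N P φ, φ (star f * g) = 0) →
      (∀ f ∈ freeModule N P φ, ψ₁ (E (g * star f)) = 0) → F g = 0 := by
    intro g hg h1 h2
    have e1 : ⟪a, amp ι g ζ⟫_ℂ = 0 := by
      rw [← ha.2]
      refine inner_clProj_eq_zero ?_ a
      rintro _ ⟨f, rfl⟩
      exact (inner_ampOrbit hζ (h.freeModule_mem f.2) hg).trans (h1 f f.2)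
    have e2 : ⟪η, amp κ g (r x)⟫_ℂ = 0 := by
      rw [hηf hg, ← inner_conj_symm, inner_clProj_eq_zero, _root_.map_zero]
      rintro _ ⟨f, hf, rfl⟩
      rw [← inner_conj_symm, hin hg (star_mem (h.freeModule_mem hf)), h2 f hf, _root_.map_zero]
    simp only [hF, e1, e2, mul_zero, sub_zero]
  have hall : ∀ f ∈ M, F f = 0 := fun f hf => by
    refine h.toFreeExp.eq_zero hWF (fun f _ g _ => ?_) (fun c f _ => ?_) (fun n hn => ?_)
      (fun k hk => ?_) (fun k hk c hc => ?_) hf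
    · simp only [hF, map_add, add_apply, inner_add_right]
      ring
    · simp only [hF, map_smul, smul_apply, inner_smul_right]
      ring
    · refine hzero (hE.mem hn) (fun f hf => ?_) fun f hf => ?_
      · have hfM := star_mem (h.freeModule_mem hf)
        rw [← h.inv _ (mul_mem hfM (hE.mem hn)), hE.map_mul_right hfM hn, h.star_freeModule_exp hf,
          zero_mul, h.plf.map_zero]
      · rw [hE.map_mul_left hn (star_mem (h.freeModule_mem hf)), h.star_freeModule_exp hf, mul_zero,
          h.normal₁.toIsPLF.map_zero]
    · have hkM := h.freeModule_mem hk
      have e1 : ⟪a, amp ι k ζ⟫_ℂ = ψ (E (star v * k) * x) := ha.1 ⟨k, hk⟩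
      have e2 : ⟪η, amp κ k (r x)⟫_ℂ = ψ₁ (E (k * x * star v)) := by
        rw [hηf hkM, hr]
        beta_reduce
        rw [← inner_clProj, clProj_of_mem (U := U) ⟨k, hk, rfl⟩, hin hkM
          (mul_mem hxM (star_mem hv)), mul_assoc]
      simp only [hF]
      rw [e1, e2, ← hE.map_mul_right (mul_mem (star_mem hv) hkM) hx, mul_assoc,
        h.rel_star (mul_mem hkM hxM), sub_self]
    · have hkM := h.freeModule_mem hk
      have hcM := hE.mem hc.1
      refine hzero (mul_mem hkM hcM) (fun f hf => ?_) fun f hf => ?_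
      · have hfM := star_mem (h.freeModule_mem hf)
        rw [← mul_assoc, ← h.inv _ (mul_mem (mul_mem hfM hkM) hcM),
          hE.map_mul_right (mul_mem hfM hkM) hc.1, h.exp_star_mul hf hk, smul_mul_assoc, one_mul,
          h.plf.map_smul _ _ hcM, hc.2, mul_zero]
      · rw [h.exp_mul_star hk hf hc, h.normal₁.toIsPLF.map_zero]
  have hyM := star_mem (hE.mem hy)
  have hvy := mul_mem hv hyM
  have := hall (v * star y) hvy
  simp only [hF, sub_eq_zero] at this
  have e1 : ⟪a, amp ι (v * star y) ζ⟫_ℂ = ⟪a, b⟫_ℂ := by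
    have hb' : b = clProj (LinearMap.range L) (amp ι (v * star y) ζ) := by
      refine ext_of_clProj hb.2 ?_ fun f => ?_
      · rw [← mul_app, clProj_mul_self]
      · have hfM := h.freeModule_mem f.2
        rw [hb.1 f, inner_clProj, clProj_of_mem (LinearMap.mem_range_self L f), hL,
          ampOrbit_apply', inner_ampOrbit hζ hvy hfM, star_mul, star_star, mul_assoc,
          ← h.inv _ (mul_mem (hE.mem hy) (mul_mem (star_mem hv) hfM)),
          hE.map_mul_left hy (mul_mem (star_mem hv) hfM), h.coeff_apply]
    rw [hb', ← inner_clProj, ha.2]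
  have e2 : ⟪η, amp κ (v * star y) (r x)⟫_ℂ = ⟪r y, r x⟫_ℂ := by
    rw [hηf hvy, star_mul, star_star]
    simp only [hr]
    rw [inner_clProj U (amp κ (y * star v) η), ← mul_app (clProj U) (clProj U), clProj_mul_self]
  rw [← e1, this, e2]

theorem Crossing.symm (h : Crossing M N P φ φN φP E ψ ψ₁ v l)
    (hζ : ∀ x ∈ M, φ x = ⟪ζ, amp ι x ζ⟫_ℂ) {x y : Op H} (hx : x ∈ N) (hy : y ∈ N)
    {a b a' b' : Amp ι H} (ha : h.Represents ζ (fun z => ψ (z * x)) a)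
    (hb : h.Represents ζ (fun z => φ (x * z)) b) (ha' : h.Represents ζ (fun z => ψ (z * y)) a')
    (hb' : h.Represents ζ (fun z => φ (y * z)) b') : ⟪a, b'⟫_ℂ = ⟪b, a'⟫_ℂ := by
  obtain ⟨κ, r, hr⟩ := h.exists_gram hζ
  have h1 := hr x hx y hy a b' ha hb'
  have h2 := congrArg conj (hr y hy x hx a' b ha' hb)
  rw [map_mul, Complex.conj_ofReal, inner_conj_symm, inner_conj_symm, ← h1] at h2
  exact (mul_left_cancel₀ (Complex.ofReal_ne_zero.2 h.pos.ne') h2).symm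

end Crossing

section Eigenvector
variable {M N P : VonNeumannAlgebra H} {φ φN φP ψ ψ₁ : Op H → ℂ} {E : Op H → Op H} {v : Op H} {l : ℝ}
  {ι : Type} {ζ : Amp ι H}

/-- An operator whose sesquilinear form on the free module comes from a positive functional `ρ`. -/
theorem Crossing.exists_form (h : Crossing M N P φ φN φP E ψ ψ₁ v l)
    {C : ℝ} (hC0 : 0 ≤ C)
    (hC : ∀ f, ‖h.coeff f‖ ≤ C * ‖ampOrbit (freeModule N P φ) ζ f‖) {ρ : Op H → Op H → ℂ}
    {c : ℝ} (hc0 : 0 ≤ c) (hc : ∀ x ∈ N, ∀ y ∈ N, ‖ρ x y‖ ≤ c * ‖x‖ * ‖y‖)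
    (hadd : ∀ x ∈ N, ∀ y ∈ N, ∀ z ∈ N, ρ x (y + z) = ρ x y + ρ x z)
    (hsmul : ∀ x ∈ N, ∀ (a : ℂ), ∀ y ∈ N, ρ x (a • y) = a * ρ x y)
    (hadd' : ∀ x ∈ N, ∀ y ∈ N, ∀ z ∈ N, ρ (x + y) z = ρ x z + ρ y z)
    (hsmul' : ∀ x ∈ N, ∀ (a : ℂ), ∀ y ∈ N, ρ (a • x) y = a * ρ x y)
    (hpos : ∀ x ∈ N, 0 ≤ ρ (star x) x) :
    ∃ T : Op (Amp ι H), 0 ≤ T ∧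
      T * clProj (LinearMap.range (ampOrbit (freeModule N P φ) ζ)) = T ∧
      ∀ f, h.Represents ζ (ρ (star (h.coeff f))) (T (ampOrbit (freeModule N P φ) ζ f)) := by
  have hS := h.coeff_mem
  have hS' := fun f => star_mem (h.coeff_mem f)
  obtain ⟨T, h1, h2, h3⟩ := exists_sesq_rep (ampOrbit (freeModule N P φ) ζ)
    (fun f g => ρ (star (h.coeff f)) (h.coeff g))
    (fun f g k => by rw [map_add, hadd _ (hS' f) _ (hS g) _ (hS k)])
    (fun f a g => by rw [_root_.map_smul, hsmul _ (hS' f) _ _ (hS g)])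
    (fun f g k => by rw [map_add, star_add, hadd' _ (hS' f) _ (hS' g) _ (hS k)])
    (fun f a g => by rw [_root_.map_smul, star_smul, hsmul' _ (hS' f) _ _ (hS g)]; rfl)
    (C := c * C * C) (by positivity) (fun f g => by
      refine (hc _ (hS' f) _ (hS g)).trans ?_
      rw [norm_star]
      calc c * ‖h.coeff f‖ * ‖h.coeff g‖
          ≤ c * (C * ‖ampOrbit (freeModule N P φ) ζ f‖) *
            (C * ‖ampOrbit (freeModule N P φ) ζ g‖) := by gcongr <;> exact hC _
        _ = _ := by ring)
  exact ⟨T, nonneg_of_range h2 h3 fun f => by rw [h1]; exact hpos _ (hS f), h2, fun f =>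
    ⟨h1 f, congrArg (fun z : Op (Amp ι H) => z _) h3⟩⟩

theorem IsPLF.norm_mul_le (hψ : IsPLF N ψ) {x y : Op H} (hx : x ∈ N) (hy : y ∈ N) :
    ‖ψ (x * y)‖ ≤ (ψ 1).re * ‖x‖ * ‖y‖ := by
  have h1 : 0 ≤ (ψ 1).re := by simpa using hψ.re_nonneg (one_mem N)
  refine (hψ.norm_le (mul_mem hx hy)).trans ?_
  rw [mul_assoc]
  gcongr
  exact _root_.norm_mul_le x y

theorem Crossing.exists_represents (h : Crossing M N P φ φN φP E ψ ψ₁ v l)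
    {C : ℝ} (hC0 : 0 ≤ C)
    (hC : ∀ f, ‖h.coeff f‖ ≤ C * ‖ampOrbit (freeModule N P φ) ζ f‖) {ℓ : Op H → ℂ}
    {c : ℝ} (hc0 : 0 ≤ c) (hc : ∀ x ∈ N, ‖ℓ x‖ ≤ c * ‖x‖)
    (hadd : ∀ x ∈ N, ∀ y ∈ N, ℓ (x + y) = ℓ x + ℓ y)
    (hsmul : ∀ (a : ℂ), ∀ x ∈ N, ℓ (a • x) = a * ℓ x) : ∃ t, h.Represents ζ ℓ t := by
  have hS := h.coeff_mem
  obtain ⟨t, h1, h2, -⟩ := exists_rep (ampOrbit (freeModule N P φ) ζ)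
    (⟨⟨fun f => ℓ (h.coeff f), fun f g => by rw [map_add, hadd _ (hS f) _ (hS g)]⟩, fun a f => by
      change ℓ (h.coeff (a • f)) = a * ℓ (h.coeff f)
      rw [_root_.map_smul, hsmul _ _ (hS f)]⟩ : freeModule N P φ →ₗ[ℂ] ℂ) (C := c * C)
    (by positivity) fun f => (hc _ (hS f)).trans (by rw [mul_assoc]; gcongr; exact hC f)
  exact ⟨t, h1, h2⟩

theorem Crossing.coeff_ne_zero (h : Crossing M N P φ φN φP E ψ ψ₁ v l) (hv : v ≠ 0) :
    ∃ f, h.coeff f ≠ 0 := by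
  by_contra! hz
  refine hv (h.state.2 v h.mem ?_)
  have hE := h.exp
  have hvM := star_mem h.mem
  refine h.toFreeExp.eq_zero (F := fun x => φ (star v * x)) (h.state.1.1.wfOn.mul_left hvM)
    (fun x hx y hy => ?_) (fun c x hx => ?_) (fun n hn => ?_) (fun k hk => ?_)
    (fun k hk c hc => ?_) h.mem
  · rw [mul_add, h.plf.map_add _ (mul_mem hvM hx) _ (mul_mem hvM hy)]
  · rw [mul_smul_comm, h.plf.map_smul _ _ (mul_mem hvM hx)]
  · rw [← h.inv _ (mul_mem hvM (hE.mem hn)), hE.map_mul_right hvM hn, hE.map_star' _ h.mem,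
      h.exp_eq, star_zero, zero_mul, h.plf.map_zero]
  · have := hz ⟨k, hk⟩
    rw [h.coeff_apply] at this
    rw [← h.inv _ (mul_mem hvM (h.freeModule_mem hk)), this, h.plf.map_zero]
  · have := hz ⟨k, hk⟩
    rw [h.coeff_apply] at this
    have hkM := mul_mem hvM (h.freeModule_mem hk)
    rw [← mul_assoc, ← h.inv _ (mul_mem hkM (hE.mem hc.1)), hE.map_mul_right hkM hc.1, this,
      zero_mul, h.plf.map_zero]

theorem Crossing.traceBoundedOn (h : Crossing M N P φ φN φP E ψ ψ₁ v l)
    (hζ : ∀ x ∈ M, φ x = ⟪ζ, amp ι x ζ⟫_ℂ) {A : Op (Amp ι H)}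
    (hA : ∀ f, h.Represents ζ (fun z => ψ (z * star (h.coeff f)))
      (A (ampOrbit (freeModule N P φ) ζ f))) :
    TraceBoundedOn (LinearMap.range (ampOrbit (freeModule N P φ) ζ)) A
      (ψ (E (star v * v))).re := by
  intro s hs ho
  have hS := h.coeff_mem
  have hψ := h.normal.toIsPLF
  choose! f hf using fun e he => (hs e he).1
  have hin : ∀ i ∈ s, ∀ j ∈ s, φ (star (f i : Op H) * (f j : Op H)) = ⟪i, j⟫_ℂ := fun i hi j hj => by
    rw [← inner_ampOrbit hζ (h.freeModule_mem (f i).2) (h.freeModule_mem (f j).2),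
      ← ampOrbit_apply', ← ampOrbit_apply', hf i hi, hf j hj]
  have hb := h.bessel h.mem s (f := fun e => (f e : Op H)) (fun i _ => (f i).2)
    (fun i hi => by
      rw [hin i hi i hi, inner_self_eq_norm_sq_to_K, (hs i hi).2]; simp)
    (fun i hi j hj hij => by rw [hin i hi j hj]; exact ho hi hj hij)
  have hmem : ∀ i ∈ s, h.coeff (f i) * star (h.coeff (f i)) ∈ N := fun i _ =>
    mul_mem (hS _) (star_mem (hS _))
  have hsum : ∑ e ∈ s, (⟪e, A e⟫_ℂ).re = (ψ (∑ e ∈ s, h.coeff (f e) * star (h.coeff (f e)))).re := by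
    rw [hψ.map_sum _ hmem, Complex.re_sum]
    refine Finset.sum_congr rfl fun e he => ?_
    have := (hA (f e)).1 (f e)
    rw [hf e he] at this
    rw [← inner_conj_symm, Complex.conj_re, this]
  rw [hsum]
  exact (Complex.le_def.1 (hψ.mono (sum_mem hmem)
    (h.exp.mem' _ (mul_mem (star_mem h.mem) h.mem)) hb)).1

/-- A crossing produces a nonzero element of `N` intertwining `ψ` and `φ`. -/
theorem Crossing.exists_intertwiner (h : Crossing M N P φ φN φP E ψ ψ₁ v l) (hv0 : v ≠ 0)
    {p : Op H} (hpN : p ∈ N) (hp : star p = p)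
    (hsupp : ∀ x ∈ N, ψ (star x * x) = 0 → x * p = 0) (hvp : v * p = v) :
    ∃ w ∈ N, w ≠ 0 ∧ ∃ m : ℝ, 0 < m ∧ ∀ x ∈ N, ψ (w * x) = (m : ℂ) * φ (x * w) := by
  have hE := h.exp
  have hψ := h.normal.toIsPLF
  have hφ : IsPLF N φ := ⟨fun x hx y hy => h.plf.map_add x (hE.mem hx) y (hE.mem hy),
    fun c x hx => h.plf.map_smul c x (hE.mem hx), fun x hx => h.plf.pos x (hE.mem hx)⟩
  have hψ1 : 0 ≤ (ψ 1).re := by simpa using hψ.re_nonneg (one_mem N)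
  have hφ1 : 0 ≤ (φ 1).re := by simpa using hφ.re_nonneg (one_mem N)
  obtain ⟨ι, ζ, hζ⟩ := h.state.1.1.exists_amp
  set L := ampOrbit (freeModule N P φ) ζ with hL
  have hS := h.coeff_mem
  obtain ⟨C, hC0, hC⟩ : ∃ C : ℝ, 0 ≤ C ∧ ∀ f, ‖h.coeff f‖ ≤ C * ‖L f‖ := by
    obtain ⟨C, hC0, hC⟩ := h.coeff_bound h.mem
    refine ⟨C, hC0, fun f => ?_⟩
    have h1 := hC f f.2
    have h2 : (φ (star (f : Op H) * (f : Op H))).re = ‖L f‖ ^ 2 := by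
      rw [← inner_ampOrbit hζ (h.freeModule_mem f.2) (h.freeModule_mem f.2), ← ampOrbit_apply',
        inner_self_eq_norm_sq_to_K]
      norm_cast
    rw [h2, ← mul_pow] at h1
    exact (abs_le_of_sq_le_sq' h1 (by positivity)).2
  obtain ⟨J, hJ, hJp, -⟩ := exists_extension L h.coeff hC0 hC
  have hJN : ∀ t, J t ∈ N := fun t => by
    refine mem_of_commute fun y hy => ?_
    rw [← hJp]
    refine eq_on_closure (f := fun t => y * J t) (g := fun t => J t * y) (by fun_prop)
      (by fun_prop) ?_ (clProj_mem_closure (LinearMap.range L) t)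
    rintro _ ⟨f, rfl⟩
    simp only [hJ]
    exact (commute_of_mem (hS f) hy).symm
  obtain ⟨A, hA0, hAp, hA⟩ := h.exists_form (ζ := ζ) hC0 hC (ρ := fun x y => ψ (y * x)) hψ1
    (fun x hx y hy => (hψ.norm_mul_le hy hx).trans_eq (by ring))
    (fun x hx y hy z hz => by rw [add_mul, hψ.map_add _ (mul_mem hy hx) _ (mul_mem hz hx)])
    (fun x hx a y hy => by rw [smul_mul_assoc, hψ.map_smul _ _ (mul_mem hy hx)])
    (fun x hx y hy z hz => by rw [mul_add, hψ.map_add _ (mul_mem hz hx) _ (mul_mem hz hy)])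
    (fun x hx a y hy => by rw [mul_smul_comm, hψ.map_smul _ _ (mul_mem hy hx)])
    (fun x hx => by simpa using hψ.pos (star x) (star_mem hx))
  obtain ⟨B, hB0, hBp, hB⟩ := h.exists_form (ζ := ζ) hC0 hC (ρ := fun x y => φ (x * y)) hφ1
    (fun x hx y hy => hφ.norm_mul_le hx hy)
    (fun x hx y hy z hz => by rw [mul_add, hφ.map_add _ (mul_mem hx hy) _ (mul_mem hx hz)])
    (fun x hx a y hy => by rw [mul_smul_comm, hφ.map_smul _ _ (mul_mem hx hy)])
    (fun x hx y hy z hz => by rw [add_mul, hφ.map_add _ (mul_mem hx hz) _ (mul_mem hy hz)])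
    (fun x hx a y hy => by rw [smul_mul_assoc, hφ.map_smul _ _ (mul_mem hx hy)])
    (fun x hx => hφ.pos x hx)
  have hAs : star A = A := hA0.isSelfAdjoint
  have hBs : star B = B := hB0.isSelfAdjoint
  have hAp' : clProj (LinearMap.range L) * A = A := by
    have := congrArg star hAp
    rwa [star_mul, star_clProj, hAs] at this
  have hBp' : clProj (LinearMap.range L) * B = B := by
    have := congrArg star hBp
    rwa [star_mul, star_clProj, hBs] at this
  have hcomm : A * B = B * A := by
    refine op_ext_of_range (L := L) (by rw [mul_assoc, hBp]) (by rw [mul_assoc, hAp])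
      (by rw [← mul_assoc, hAp']) (by rw [← mul_assoc, hBp']) fun f g => ?_
    have h1 := h.symm hζ (star_mem (hS f)) (star_mem (hS g)) (hA f) (hB f) (hA g) (hB g)
    rw [mul_app, mul_app]
    nth_rw 1 [← hAs]
    nth_rw 2 [← hBs]
    rw [inner_star_left, inner_star_left]
    exact h1.symm
  have hAne : A ≠ 0 := by
    intro hA'
    obtain ⟨f, hf⟩ := h.coeff_ne_zero hv0
    have h1 := (hA f).1 f
    rw [hA', zero_apply, inner_zero_left] at h1
    have h2 := hsupp (star (h.coeff f)) (star_mem (hS f)) (by rw [star_star]; exact h1.symm)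
    refine hf ?_
    have h3 : p * h.coeff f = 0 := by
      have := congrArg star h2
      rwa [star_mul, star_star, hp, star_zero] at this
    have h4 : p * star v = star v := by
      have := congrArg star hvp
      rwa [star_mul, hp] at this
    rwa [h.coeff_apply, ← hE.map_mul_left hpN (mul_mem (star_mem h.mem) (h.freeModule_mem f.2)),
      ← mul_assoc, h4] at h3
  have hAc := (h.traceBoundedOn hζ hA).isCompactOperator hA0 hAp
  obtain ⟨e, k, b, he0, hk, hAe, hBe⟩ := exists_common_eigenvector hAc hA0 hAne hcomm
  have hk0 : (k : ℂ) ≠ 0 := Complex.ofReal_ne_zero.2 hk.ne'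
  have hee : clProj (LinearMap.range L) e = e := by
    have h1 : clProj (LinearMap.range L) ((k : ℂ) • e) = (k : ℂ) • e := by
      rw [← hAe, ← mul_app, hAp']
    rw [_root_.map_smul] at h1
    exact smul_right_injective _ hk0 h1
  have hext : ∀ {ℓ : Op H → ℂ} {c : ℝ} {t : Amp ι H}, (∀ x ∈ N, ‖ℓ x‖ ≤ c * ‖x‖) →
      (∀ x ∈ N, ∀ y ∈ N, ℓ (x + y) = ℓ x + ℓ y) → (∀ (a : ℂ), ∀ x ∈ N, ℓ (a • x) = a * ℓ x) →
      h.Represents ζ ℓ t → ⟪t, e⟫_ℂ = ℓ (J e) := by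
    intro ℓ c t hc hadd hsmul ht
    have hc0 : ∀ u, ‖ℓ (J u)‖ ≤ |c| * ‖J‖ * ‖u‖ := fun u =>
      calc ‖ℓ (J u)‖ ≤ c * ‖J u‖ := hc _ (hJN u)
        _ ≤ |c| * (‖J‖ * ‖u‖) := by gcongr; exacts [le_abs_self c, J.le_opNorm u]
        _ = _ := by ring
    set K : Amp ι H →L[ℂ] ℂ := LinearMap.mkContinuous
      ⟨⟨fun u => ℓ (J u), fun u w => by rw [map_add, hadd _ (hJN u) _ (hJN w)]⟩,
        fun a u => by
          change ℓ (J (a • u)) = a * ℓ (J u)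
          rw [_root_.map_smul, hsmul _ _ (hJN u)]⟩ _ hc0 with hK
    have := eq_on_closure (f := fun u => ⟪t, u⟫_ℂ) (g := fun u => K u) (by fun_prop) (by fun_prop)
      (by rintro _ ⟨f, rfl⟩
          change _ = ℓ (J (L f))
          rw [hJ]
          exact ht.1 f) (clProj_mem_closure (LinearMap.range L) e)
    rwa [hee] at this
  have hψb : ∀ {x : Op H}, x ∈ N → ∀ z ∈ N, ‖ψ (z * x)‖ ≤ (ψ 1).re * ‖x‖ * ‖z‖ :=
    fun hx z hz => (hψ.norm_mul_le hz hx).trans_eq (by ring)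
  have hψa : ∀ {x : Op H}, x ∈ N → ∀ y ∈ N, ∀ z ∈ N, ψ ((y + z) * x) = ψ (y * x) + ψ (z * x) :=
    fun hx y hy z hz => by rw [add_mul, hψ.map_add _ (mul_mem hy hx) _ (mul_mem hz hx)]
  have hψs : ∀ {x : Op H}, x ∈ N → ∀ (a : ℂ), ∀ z ∈ N, ψ ((a • z) * x) = a * ψ (z * x) :=
    fun hx a z hz => by rw [smul_mul_assoc, hψ.map_smul _ _ (mul_mem hz hx)]
  have hφb : ∀ {x : Op H}, x ∈ N → ∀ z ∈ N, ‖φ (x * z)‖ ≤ (φ 1).re * ‖x‖ * ‖z‖ :=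
    fun hx z hz => hφ.norm_mul_le hx hz
  have hφa : ∀ {x : Op H}, x ∈ N → ∀ y ∈ N, ∀ z ∈ N, φ (x * (y + z)) = φ (x * y) + φ (x * z) :=
    fun hx y hy z hz => by rw [mul_add, hφ.map_add _ (mul_mem hx hy) _ (mul_mem hx hz)]
  have hφs : ∀ {x : Op H}, x ∈ N → ∀ (a : ℂ), ∀ z ∈ N, φ (x * (a • z)) = a * φ (x * z) :=
    fun hx a z hz => by rw [mul_smul_comm, hφ.map_smul _ _ (mul_mem hx hz)]
  have hmain : ∀ x ∈ N, b * ψ (J e * x) = k * φ (x * J e) := by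
    intro x hx
    obtain ⟨a, ha⟩ := h.exists_represents (ζ := ζ) hC0 hC (ℓ := fun z => ψ (z * x)) (by positivity)
      (hψb hx) (hψa hx) (hψs hx)
    obtain ⟨a', ha'⟩ := h.exists_represents (ζ := ζ) hC0 hC (ℓ := fun z => φ (x * z))
      (by positivity) (hφb hx) (hφa hx) (hφs hx)
    have h1 := hext (hψb hx) (hψa hx) (hψs hx) ha
    have h2 := hext (hφb hx) (hφa hx) (hφs hx) ha'
    have h3 := eq_on_closure (f := fun u => ⟪a, B u⟫_ℂ) (g := fun u => ⟪a', A u⟫_ℂ) (by fun_prop)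
      (by fun_prop) (by
        rintro _ ⟨f, rfl⟩
        exact h.symm hζ hx (star_mem (hS f)) ha ha' (hA f) (hB f))
      (clProj_mem_closure (LinearMap.range L) e)
    beta_reduce at h1 h2 h3
    rwa [hee, hAe, hBe, inner_smul_right, inner_smul_right, h1, h2] at h3
  have hJe : J e ≠ 0 := by
    intro h0
    refine he0 ?_
    have h1 : A e = 0 := by
      refine ext_of_clProj (L := L) (by rw [← mul_app, hAp']) (_root_.map_zero _) fun f => ?_
      rw [← inner_conj_symm, inner_zero_left]
      have h2 := hext (hψb (star_mem (hS f))) (hψa (star_mem (hS f))) (hψs (star_mem (hS f))) (hA f)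
      beta_reduce at h2
      rw [h0, zero_mul, hψ.map_zero] at h2
      rw [← inner_star_left, hAs, h2, _root_.map_zero]
    rw [hAe] at h1
    exact (smul_eq_zero.1 h1).resolve_left hk0
  have hw := hJN e
  have h1 := hmain _ (star_mem hw)
  have h2 : 0 ≤ ψ (J e * star (J e)) := by simpa using hψ.pos _ (star_mem hw)
  have h3 : 0 < φ (star (J e) * J e) := lt_of_le_of_ne (hφ.pos _ hw) fun h0 =>
    hJe (h.state.2 _ (hE.mem hw) h0.symm)
  have hk' : (0 : ℂ) < k := by exact_mod_cast hk
  have h4 : 0 < b * ψ (J e * star (J e)) := by rw [h1]; exact mul_pos hk' h3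
  obtain ⟨r, hr⟩ : ∃ r : ℝ, ψ (J e * star (J e)) = r :=
    ⟨(ψ (J e * star (J e))).re, Complex.ext rfl (Complex.le_def.1 h2).2.symm⟩
  rw [hr] at h2 h4
  have hr0 : 0 < r := lt_of_le_of_ne (by exact_mod_cast h2) fun h0 => by simp [← h0] at h4
  have h5 := Complex.lt_def.1 h4
  simp only [Complex.zero_re, Complex.zero_im, Complex.re_mul_ofReal, Complex.im_mul_ofReal,
    eq_comm (a := (0 : ℝ)), mul_eq_zero, hr0.ne', or_false] at h5
  have hb1 : 0 < b.re := pos_of_mul_pos_left h5.1 hr0.le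
  have hbr : b = (b.re : ℂ) := Complex.ext rfl h5.2
  refine ⟨J e, hw, hJe, k / b.re, div_pos hk hb1, fun x hx => ?_⟩
  have := hmain x hx
  rw [hbr] at this
  have hb0 : (b.re : ℂ) ≠ 0 := Complex.ofReal_ne_zero.2 (ne_of_gt hb1)
  push_cast
  field_simp
  rw [← this, mul_comm]

end Eigenvector

section Main
variable {M N P : VonNeumannAlgebra H} {φ φN φP ψ : Op H → ℂ} {E : Op H → Op H}

theorem IsCondExp.comm_invFun (hE : IsCondExp M N E) {Θ : VNAut M}
    (hΘ : ∀ x ∈ M, E (Θ.toFun x) = Θ.toFun (E x)) {x : Op H} (hx : x ∈ M) :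
    E (Θ.invFun x) = Θ.invFun (E x) := by
  have h1 := hΘ _ (Θ.inv_mem' x hx)
  rw [Θ.right_inv' x hx] at h1
  rw [h1, Θ.left_inv' _ (hE.mem (hE.mem' _ (Θ.inv_mem' x hx)))]

/-- The restriction to `N` of an automorphism commuting with the expectation onto `N`. -/
def IsCondExp.restrictAut (hE : IsCondExp M N E) {Θ : VNAut M}
    (hΘ : ∀ x ∈ M, E (Θ.toFun x) = Θ.toFun (E x)) : VNAut N where
  toFun := Θ.toFun
  invFun := Θ.invFun
  mem' x hx := by
    rw [← hE.fix' x hx, ← hΘ x (hE.mem hx)]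
    exact hE.mem' _ (Θ.mem' x (hE.mem hx))
  inv_mem' x hx := by
    rw [← hE.fix' x hx, ← hE.comm_invFun hΘ (hE.mem hx)]
    exact hE.mem' _ (Θ.inv_mem' x (hE.mem hx))
  left_inv' x hx := Θ.left_inv' x (hE.mem hx)
  right_inv' x hx := Θ.right_inv' x (hE.mem hx)
  map_add' x hx y hy := Θ.map_add' x (hE.mem hx) y (hE.mem hy)
  map_smul' c x hx := Θ.map_smul' c x (hE.mem hx)
  map_mul' x hx y hy := Θ.map_mul' x (hE.mem hx) y (hE.mem hy)
  map_star' x hx := Θ.map_star' x (hE.mem hx)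

/-- If `w` intertwines `ψ` and the state `φ` with factorial centralizer, then every `φ`-preserving
automorphism `Θ` of `N` satisfies `Θ(ψ) ∼ ψ`. -/
theorem intertwined_comp_invFun (hφ : IsNormalPLF N φ) (hφf : IsFaithfulOn N φ)
    (hψ : IsNormalPLF N ψ) (hfac : IsFactorSet (stateCentralizer N φ)) (Θ : VNAut N)
    (hΘ : ∀ x ∈ N, φ (Θ.invFun x) = φ x) {w : Op H} (hw : w ∈ N) (hw0 : w ≠ 0) {m : ℝ} (hm : 0 < m)
    (hr : ∀ x ∈ N, ψ (w * x) = (m : ℂ) * φ (x * w)) :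
    Intertwined N (fun x => ψ (Θ.invFun x)) ψ := by
  have hw' := star_mem hw
  have hm0 : (m : ℂ) ≠ 0 := Complex.ofReal_ne_zero.2 hm.ne'
  have hr' : ∀ x ∈ N, ψ (x * star w) = (m : ℂ) * φ (star w * x) := fun x hx => by
    have h1 := congrArg conj (hr (star x) (star_mem hx))
    rwa [map_mul, Complex.conj_ofReal, hψ.toIsPLF.conj_eq (mul_mem hw (star_mem hx)),
      hφ.toIsPLF.conj_eq (mul_mem (star_mem hx) hw), star_mul, star_mul, star_star] at h1
  obtain ⟨p, hp, hp0, hpr, -⟩ := hψ.exists_support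
  have hp1 : p ∈ N := hp.1.1
  have hps : star p = p := hp.1.2.1
  have hpp : p * p = p := hp.1.2.2
  have hpw : p * w = w := by
    have hq : (1 - p) * w ∈ N := mul_mem (sub_mem (one_mem N) hp1) hw
    have h1 := hr (star w * (1 - p)) (mul_mem hw' (sub_mem (one_mem N) hp1))
    rw [mul_sub, mul_one, mul_sub, hψ.toIsPLF.map_sub (mul_mem hw hw')
      (mul_mem hw (mul_mem hw' hp1)), ← mul_assoc w, hpr _ (mul_mem hw hw'), sub_self] at h1
    have h2 : (1 - p) * w = 0 := by
      refine hφf _ hq ?_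
      rw [← (mul_eq_zero.1 h1.symm).resolve_left hm0, star_mul, star_sub, hps, star_one]
      congr 1
      simp only [sub_mul, mul_sub, one_mul, mul_one, mul_assoc]
      rw [← mul_assoc p p w, hpp, sub_self, sub_zero]
    rw [sub_mul, one_mul, sub_eq_zero] at h2
    exact h2.symm
  have hwp : star w * p = star w := by
    have := congrArg star hpw
    rwa [star_mul, hps] at this
  have hb : star w * w ∈ stateCentralizer N φ := ⟨mul_mem hw' hw, fun x hx => by
    refine mul_left_cancel₀ hm0 ?_
    rw [mul_assoc, ← hr' _ (mul_mem hw hx), mul_assoc, hr _ (mul_mem hx hw'), mul_assoc]⟩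
  have hb0 : star w * w ≠ 0 := fun h0 => hw0 (hφf _ hw (by rw [h0, hφ.toIsPLF.map_zero]))
  have ha := Θ.mem' w hw
  have ha0 : Θ.toFun w ≠ 0 := fun h0 => hw0 (by
    rw [← Θ.left_inv' w hw, h0]
    exact Θ.symm.map_zero)
  obtain ⟨z, hz, hne⟩ := hfac.exists_mul_ne_zero hφ hb ha0 hb0
  have hx : Θ.toFun w * z * star w ∈ N := mul_mem (mul_mem ha hz.1) hw'
  refine intertwined_of_mul (hψ.comp_aut Θ.symm) hψ hx (fun h0 => hne ?_) one_pos fun y hy => ?_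
  · have h1 := hp0 _ hx h0
    rw [mul_assoc _ _ p, hwp] at h1
    rw [← mul_assoc, h1, zero_mul]
  · have hzy : z * star w * y ∈ N := mul_mem (mul_mem hz.1 hw') hy
    have hi := Θ.inv_mem' _ hzy
    have e1 : Θ.invFun (Θ.toFun w * z * star w * y) = w * Θ.invFun (z * star w * y) := by
      rw [show Θ.toFun w * z * star w * y = Θ.toFun w * (z * star w * y) by
        simp only [mul_assoc]]
      exact (Θ.symm.map_mul' _ ha _ hzy).trans (congrArg (· * _) (Θ.left_inv' w hw))
    have e2 : Θ.invFun (z * star w * y) * w = Θ.invFun (z * star w * y * Θ.toFun w) := by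
      exact ((Θ.symm.map_mul' _ hzy _ ha).trans (congrArg (_ * ·) (Θ.left_inv' w hw))).symm
    rw [e1, hr _ hi, e2, hΘ _ (mul_mem hzy ha), Complex.ofReal_one, one_mul, ← mul_assoc y,
      hr' _ (mul_mem hy (mul_mem ha hz.1))]
    congr 1
    rw [show z * star w * y * Θ.toFun w = z * (star w * (y * Θ.toFun w)) by
      simp only [mul_assoc], hz.2 _ (mul_mem hw' (mul_mem hy ha))]
    simp only [mul_assoc]

end Main

/-- Proposition 4.4.  Let `(M, φ_M) = (N, φ_N) ∗ (P, φ_P)` be a free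
product of von Neumann algebras with `E : M → N` the unique `φ_M`-preserving conditional
expectation (`φ_N ∘ E = φ_M`).  If the centralizer `N_{φ_N}` is a factor, then the
triple `(M, N, φ_M)` is intertwining stable. -/
theorem freeProduct_intertwining_stable
    {H : Type} [NormedAddCommGroup H] [InnerProductSpace ℂ H] [CompleteSpace H]
    (M N P : VonNeumannAlgebra H) (φM φN φP : Op H → ℂ)
    (hfp : IsFreeProductDecomposition M N P φM φN φP)
    (hφM : IsFNState M φM) (hφN : IsFNState N φN) (hφP : IsFNState P φP)
    (E : Op H → Op H) (hE : IsCondExp M N E)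
    (hEφ : ∀ x ∈ M, φN (E x) = φM x)
    (hfac : IsFactorSet (stateCentralizer N φN)) :
    IntertwiningStable M N E φM := by
  intro Θ hΘ hφΘ ψ hψ _ hI
  have hfree : FreeExp M N P φM φN φP E :=
    ⟨hfp, hφM, hE, fun x hx => by rw [hfp.restN _ (hE.mem' x hx), hEφ x hx]⟩
  set Θ' : VNAut N := hE.restrictAut hΘ with hΘ'
  have hψ₁ : IsNormalPLF N fun x => ψ (Θ.invFun x) := hψ.comp_aut Θ'.symm
  obtain ⟨v, -, p, l, hl, hv, -, hv0, -, hp, -, hvp, hrel⟩ := hI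
  obtain ⟨p₀, hp₀, hsupp, -⟩ := hψ.exists_support
  have hp₀N : p₀ ∈ N := hp₀.1.1
  have hpp₀ : p * p₀ = p := hp.2.2 _ ⟨hE.mem hp₀N, hp₀.1.2⟩ fun x hx => by
    beta_reduce
    rw [hE.bimod' _ hp₀N _ hx _ hp₀N, hp₀.2.1 _ (hE.mem' x hx)]
  have hvp₀ : v * p₀ = v := by
    rw [← hvp, mul_assoc, hpp₀]
  have hrel' : ∀ x ∈ M, ψ (Θ.invFun (E (v * x))) = (l : ℂ) * ψ (E (x * v)) := fun x hx => by
    rw [← hE.comm_invFun hΘ (mul_mem hv hx)]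
    exact hrel x hx
  by_cases hEv : E v = 0
  · have hc : Crossing M N P φM φN φP E ψ (fun x => ψ (Θ.invFun x)) v l :=
      { hfree with normal := hψ, normal₁ := hψ₁, mem := hv, exp_eq := hEv, pos := hl, rel := hrel' }
    obtain ⟨w, hw, hw0, m, hm, hr⟩ := hc.exists_intertwiner hv0 hp₀N hp₀.1.2.1 hsupp hvp₀
    exact intertwined_comp_invFun hφN.1.1 hφN.2 hψ hfac Θ'
      (fun x hx => by
        rw [← hfp.restN _ (Θ'.inv_mem' x hx), ← hfp.restN x hx]
        exact hφΘ x (hE.mem hx)) hw hw0 hm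
      fun x hx => by rw [hr x hx, hfp.restN _ (mul_mem hx hw)]
  · refine intertwined_of_mul hψ₁ hψ (hE.mem' v hv) (fun h0 => hEv ?_) hl fun z hz => ?_
    · rw [← hsupp _ (hE.mem' v hv) h0, ← hE.map_mul_right hv hp₀N, hvp₀]
    · rw [← hE.map_mul_right hv hz, hrel' z (hE.mem hz), hE.map_mul_left hz hv]

end HSC
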